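/- arXiv:0806.4561 — 3 statements merged into one kernel-verified Lean document; each statement's English description precedes it below -/
import Mathlib

section
/- Suppose there exist C, p₀ ∈ (0,∞) such that for every t ∈ ℤ⁺, Y_t^{2p₀} is integrable and E[Y_{t+1}^{2p₀} − Y_t^{2p₀} | F_t] ≤ −C Y_t^{2p₀−2} on the event {υ_B > t}. Then for any p ∈ [0,p₀) and any deterministic initial value Y₀ = x, E[υ_B^p] < ∞. -/
open MeasureTheory
open scoped ENNReal

noncomputable section

/-- `υ_B = min {t ∈ ℕ, t ≥ 1 : Y_t ≤ B}`, with value `∞` if no such time exists. -/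
def upsilon {Ω : Type*} (B : ℝ) (Y : ℕ → Ω → ℝ) (ω : Ω) : ℝ≥0∞ :=
  ⨅ (t : ℕ) (_ : 1 ≤ t ∧ Y t ω ≤ B), (t : ℝ≥0∞)

lemma rpow_succ_sub_le {q : ℝ} (hq : 0 < q) {t : ℝ} (ht : 1 ≤ t) :
    (t + 1) ^ q ≤ t ^ q + (q + 2 ^ q) * t ^ (q - 1) := by
  have ht0 : 0 < t := by linarith
  have hu : 0 ≤ 1 / t := by positivity
  have hu1 : 1 / t ≤ 1 := by rw [div_le_one ht0]; exact ht
  have key : (1 + 1 / t) ^ q ≤ 1 + (q + 2 ^ q) * (1 / t) := by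
    have h2 : (0 : ℝ) < 2 ^ q := by positivity
    rcases le_total q 1 with h | h
    · have := rpow_one_add_le_one_add_mul_self (by linarith : -1 ≤ 1 / t) hq.le h
      nlinarith
    · have := (convexOn_rpow h).2 (x := 1) (y := 2) (by simp) (by simp)
        (sub_nonneg.2 hu1) hu (by ring)
      simp only [smul_eq_mul, mul_one, Real.one_rpow] at this
      have e : 1 - 1 / t + 1 / t * 2 = 1 + 1 / t := by ring
      rw [e] at this
      nlinarith
  have e1 : t + 1 = t * (1 + 1 / t) := by field_simp
  rw [e1, Real.mul_rpow ht0.le (by positivity), Real.rpow_sub_one ht0.ne']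
  calc t ^ q * (1 + 1 / t) ^ q ≤ t ^ q * (1 + (q + 2 ^ q) * (1 / t)) := by gcongr
    _ = _ := by ring

lemma rpow_add_const_le_tangent {p : ℝ} (hp : 1 ≤ p) {w w' s : ℝ} (hw : 0 < w) (hw' : 0 ≤ w')
    (hs : 0 ≤ s) :
    (w' + s) ^ p ≤ (w + s) ^ p + (1 + s / w) ^ (p - 1) * (w' ^ p - w ^ p) := by
  have hws : 0 < w + s := by linarith
  have h := (convexOn_rpow hp).2
    (show w' / w ∈ Set.Ici 0 from div_nonneg hw' hw.le) (show (1 : ℝ) ∈ Set.Ici 0 by simp)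
    (show 0 ≤ w / (w + s) by positivity) (show 0 ≤ s / (w + s) by positivity) (by field_simp)
  simp only [smul_eq_mul, mul_one, Real.one_rpow] at h
  have e : w / (w + s) * (w' / w) + s / (w + s) = (w' + s) / (w + s) := by field_simp
  rw [e, Real.div_rpow (by positivity) hws.le, Real.div_rpow hw' hw.le] at h
  have e2 : 1 + s / w = (w + s) / w := by field_simp
  rw [e2, Real.div_rpow hws.le hw.le, Real.rpow_sub_one hws.ne', Real.rpow_sub_one hw.ne']
  have hP := Real.rpow_pos_of_pos hws p
  have hQ := Real.rpow_pos_of_pos hw p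
  rw [div_le_iff₀ hP] at h
  refine h.trans (le_of_eq ?_)
  field_simp
  ring

lemma rpow_sub_rpow_le {p : ℝ} (hp : 1 ≤ p) {a b : ℝ} (ha : 0 < a) (hb : 0 ≤ b) :
    a ^ p - b ^ p ≤ p * (a - b) * a ^ (p - 1) := by
  have h := one_add_mul_self_le_rpow_one_add (s := b / a - 1)
    (by linarith [div_nonneg hb ha.le]) hp
  have e : 1 + (b / a - 1) = b / a := by ring
  rw [e, Real.div_rpow hb ha.le, le_div_iff₀ (by positivity)] at h
  rw [Real.rpow_sub_one ha.ne']
  have e3 : (1 + p * (b / a - 1)) * a ^ p = a ^ p - p * (a - b) * (a ^ p / a) := by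
    field_simp; ring
  linarith

lemma lt_upsilon_iff {Ω : Type*} {B : ℝ} {Y : ℕ → Ω → ℝ} {ω : Ω} {t : ℕ} :
    (t : ℝ≥0∞) < upsilon B Y ω ↔ ∀ i, 1 ≤ i → i ≤ t → B < Y i ω := by
  constructor
  · intro h i h1 hit
    by_contra! hB
    have : upsilon B Y ω ≤ (i : ℝ≥0∞) := iInf₂_le i ⟨h1, hB⟩
    exact absurd (h.trans_le this) (not_lt.2 (by exact_mod_cast hit))
  · intro h
    have h1 : ((t + 1 : ℕ) : ℝ≥0∞) ≤ upsilon B Y ω := by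
      refine le_iInf₂ fun j hj => ?_
      have : t < j := by
        by_contra! hjt
        exact absurd (h j hj.1 hjt) (not_lt.2 hj.2)
      exact_mod_cast this
    exact lt_of_lt_of_le (by exact_mod_cast Nat.lt_succ_self t) h1

lemma one_le_upsilon {Ω : Type*} (B : ℝ) (Y : ℕ → Ω → ℝ) (ω : Ω) : 1 ≤ upsilon B Y ω :=
  le_iInf₂ fun j hj => by exact_mod_cast hj.1

lemma measurableSet_lt_upsilon {Ω : Type*} {m : MeasurableSpace Ω} {F : Filtration ℕ m}
    {Y : ℕ → Ω → ℝ} (hY : Adapted F Y) (B : ℝ) (t : ℕ) :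
    MeasurableSet[F t] {ω | (t : ℝ≥0∞) < upsilon B Y ω} := by
  simp only [lt_upsilon_iff, Set.ofPred_forall]
  refine MeasurableSet.iInter fun i => MeasurableSet.iInter fun _ => MeasurableSet.iInter fun hi =>
    ?_
  exact F.mono hi _ (measurableSet_lt measurable_const (hY i))

lemma rpow_le_one_add_sum {q : ℝ} (hq : 0 < q) (n : ℕ) :
    ((n + 1 : ℕ) : ℝ) ^ q ≤
      1 + ∑ k ∈ Finset.range n, (q + 2 ^ q) * ((k + 1 : ℕ) : ℝ) ^ (q - 1) := by
  induction n with
  | zero => simp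
  | succ n ih =>
    rw [Finset.sum_range_succ]
    have := rpow_succ_sub_le hq (t := ((n + 1 : ℕ) : ℝ))
      (by push_cast; linarith [n.cast_nonneg (α := ℝ)])
    rw [Nat.cast_succ (n + 1)]
    linarith

lemma upsilon_rpow_le_tsum {Ω : Type*} (B : ℝ) (Y : ℕ → Ω → ℝ) {q : ℝ} (hq : 0 < q) (ω : Ω) :
    upsilon B Y ω ^ q ≤ 1 + ∑' k : ℕ, {ω | ((k + 1 : ℕ) : ℝ≥0∞) < upsilon B Y ω}.indicator
      (fun _ => ENNReal.ofReal ((q + 2 ^ q) * ((k + 1 : ℕ) : ℝ) ^ (q - 1))) ω := by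
  set R := 1 + ∑' k : ℕ, {ω | ((k + 1 : ℕ) : ℝ≥0∞) < upsilon B Y ω}.indicator
      (fun _ => ENNReal.ofReal ((q + 2 ^ q) * ((k + 1 : ℕ) : ℝ) ^ (q - 1))) ω with hR
  have key : ∀ n : ℕ, (n : ℝ≥0∞) < upsilon B Y ω → ((n + 1 : ℕ) : ℝ≥0∞) ^ q ≤ R := by
    intro n hn
    have h1 := ENNReal.ofReal_le_ofReal (rpow_le_one_add_sum hq n)
    rw [← ENNReal.ofReal_rpow_of_nonneg (by positivity) hq.le, ENNReal.ofReal_natCast,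
      ENNReal.ofReal_add zero_le_one (Finset.sum_nonneg fun _ _ => by positivity),
      ENNReal.ofReal_one, ENNReal.ofReal_sum_of_nonneg (fun _ _ => by positivity)] at h1
    refine h1.trans ?_
    rw [hR]
    gcongr
    refine le_trans (Finset.sum_le_sum fun k hk => ?_) (ENNReal.sum_le_tsum (Finset.range n))
    rw [Set.indicator_of_mem]
    have : k + 1 ≤ n := Finset.mem_range.1 hk
    exact lt_of_le_of_lt (by exact_mod_cast this) hn
  rw [← ENNReal.le_rpow_inv_iff hq]
  by_contra! hlt
  have hfin : R ^ q⁻¹ ≠ ⊤ := hlt.ne_top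
  obtain ⟨r, hr⟩ : ∃ r : NNReal, (r : ℝ≥0∞) = R ^ q⁻¹ := ⟨_, ENNReal.coe_toNNReal hfin⟩
  have hfl : ((⌊r⌋₊ : ℕ) : ℝ≥0∞) ≤ R ^ q⁻¹ := by
    rw [← hr]; exact_mod_cast Nat.floor_le r.2
  have h2 := key _ (hfl.trans_lt hlt)
  rw [← ENNReal.le_rpow_inv_iff hq, ← hr] at h2
  have h3 : r < ((⌊r⌋₊ + 1 : ℕ) : NNReal) := by exact_mod_cast Nat.lt_floor_add_one r
  exact absurd h2 (not_le.2 (by exact_mod_cast h3))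

lemma lintegral_upsilon_rpow_lt_top {Ω : Type*} {m : MeasurableSpace Ω} (P : Measure Ω)
    [IsProbabilityMeasure P] {F : Filtration ℕ m} {Y : ℕ → Ω → ℝ} (hY : Adapted F Y) (B : ℝ)
    {p q : ℝ} (hq : 0 < q) (hpq : p ≤ q) {K : ℝ}
    (hK : ∀ n : ℕ, ∑ k ∈ Finset.range n, ((k + 1 : ℕ) : ℝ) ^ (q - 1) *
      P.real {ω | ((k + 1 : ℕ) : ℝ≥0∞) < upsilon B Y ω} ≤ K) :
    ∫⁻ ω, upsilon B Y ω ^ p ∂P < ⊤ := by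
  have hms : ∀ k : ℕ, MeasurableSet {ω | ((k + 1 : ℕ) : ℝ≥0∞) < upsilon B Y ω} := fun k =>
    F.le _ _ (measurableSet_lt_upsilon hY B (k + 1))
  calc ∫⁻ ω, upsilon B Y ω ^ p ∂P
      ≤ ∫⁻ ω, (1 + ∑' k : ℕ, {ω | ((k + 1 : ℕ) : ℝ≥0∞) < upsilon B Y ω}.indicator
        (fun _ => ENNReal.ofReal ((q + 2 ^ q) * ((k + 1 : ℕ) : ℝ) ^ (q - 1))) ω) ∂P :=
        lintegral_mono fun ω => (ENNReal.rpow_le_rpow_of_exponent_le (one_le_upsilon B Y ω)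
          hpq).trans (upsilon_rpow_le_tsum B Y hq ω)
    _ = 1 + ∑' k : ℕ, ENNReal.ofReal ((q + 2 ^ q) * (((k + 1 : ℕ) : ℝ) ^ (q - 1) *
          P.real {ω | ((k + 1 : ℕ) : ℝ≥0∞) < upsilon B Y ω})) := by
        rw [lintegral_add_left measurable_const, lintegral_one, measure_univ, lintegral_tsum]
        · congr 2 with k
          rw [lintegral_indicator_const (hms k), ← mul_assoc,
            ENNReal.ofReal_mul (by positivity : (0 : ℝ) ≤ (q + 2 ^ q) * ((k + 1 : ℕ) : ℝ) ^ (q - 1)),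
            ofReal_measureReal]
        · exact fun k => (measurable_const.indicator (hms k)).aemeasurable
    _ ≤ 1 + ENNReal.ofReal ((q + 2 ^ q) * K) := by
        gcongr
        refine ENNReal.tsum_le_of_sum_range_le fun n => ?_
        rw [← ENNReal.ofReal_sum_of_nonneg (fun _ _ => by positivity), ← Finset.mul_sum]
        exact ENNReal.ofReal_le_ofReal (by gcongr; exact hK n)
    _ < ⊤ := by simp

/-- If `X` is dominated on `A` by an affine function of `Δ` with bounded `m'`-measurable slope
`φ ≥ 0`, then a bound on the conditional expectation of `Δ` transfers to `X`. -/
lemma setIntegral_le_of_condExp_le {Ω : Type*} {m' m : MeasurableSpace Ω} (P : Measure Ω)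
    [IsFiniteMeasure P] (hm : m' ≤ m) {A : Set Ω} (hA : MeasurableSet[m'] A)
    {X X₀ Z φ Δ g : Ω → ℝ} (hX : Integrable X P) (hX₀ : Integrable X₀ P) (hZ : Integrable Z P)
    (hΔ : Integrable Δ P) (hφ : StronglyMeasurable[m'] φ) {M : ℝ} (hφ0 : ∀ ω, 0 ≤ φ ω)
    (hφM : ∀ ω, φ ω ≤ M) (hdrift : ∀ᵐ ω ∂P, ω ∈ A → (P[Δ | m']) ω ≤ g ω)
    (hXle : ∀ ω ∈ A, X ω ≤ X₀ ω + φ ω * Δ ω) (hle : ∀ ω ∈ A, X₀ ω + φ ω * g ω ≤ Z ω) :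
    ∫ ω in A, X ω ∂P ≤ ∫ ω in A, Z ω ∂P := by
  have hb : ∀ᵐ ω ∂P, ‖φ ω‖ ≤ M := ae_of_all _ fun ω => by
    rw [Real.norm_of_nonneg (hφ0 ω)]; exact hφM ω
  have hφ' : AEStronglyMeasurable φ P := (hφ.mono hm).aestronglyMeasurable
  have i1 : Integrable (fun ω => φ ω * Δ ω) P := hΔ.bdd_mul hφ' hb
  have i2 : Integrable (fun ω => φ ω * (P[Δ | m']) ω) P := integrable_condExp.bdd_mul hφ' hb
  have e : ∫ ω in A, φ ω * Δ ω ∂P = ∫ ω in A, φ ω * (P[Δ | m']) ω ∂P := by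
    rw [← setIntegral_condExp hm i1 hA]
    refine setIntegral_congr_ae (hm _ hA) ?_
    filter_upwards [condExp_stronglyMeasurable_mul_of_bound hm hφ hΔ M hb] with ω h _
    exact h
  calc ∫ ω in A, X ω ∂P ≤ ∫ ω in A, (X₀ ω + φ ω * Δ ω) ∂P :=
        setIntegral_mono_on hX.integrableOn (hX₀.add i1).integrableOn (hm _ hA) hXle
    _ = ∫ ω in A, (X₀ ω + φ ω * (P[Δ | m']) ω) ∂P := by
        rw [integral_add hX₀.integrableOn i1.integrableOn, e,
          integral_add hX₀.integrableOn i2.integrableOn]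
    _ ≤ ∫ ω in A, Z ω ∂P := by
        refine setIntegral_mono_on_ae (hX₀.add i2).integrableOn hZ.integrableOn (hm _ hA) ?_
        filter_upwards [hdrift] with ω h hω
        exact (by gcongr; exacts [hφ0 ω, h hω] :
          X₀ ω + φ ω * (P[Δ | m']) ω ≤ X₀ ω + φ ω * g ω).trans (hle ω hω)

lemma sum_add_setIntegral_le {Ω : Type*} {m : MeasurableSpace Ω} (P : Measure Ω)
    {A : ℕ → Set Ω} (hA : ∀ k, A (k + 1) ⊆ A k) {h : ℕ → Ω → ℝ} {d : ℕ → ℝ}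
    (hint : ∀ k, Integrable (h k) P) (h0 : ∀ k ω, 0 ≤ h k ω)
    (hstep : ∀ k, ∫ ω in A k, h (k + 1) ω ∂P ≤ ∫ ω in A k, h k ω ∂P - d k) (n : ℕ) :
    ∑ k ∈ Finset.range n, d k + ∫ ω in A n, h n ω ∂P ≤ ∫ ω in A 0, h 0 ω ∂P := by
  induction n with
  | zero => simp
  | succ n ih =>
    rw [Finset.sum_range_succ]
    have h1 : ∫ ω in A (n + 1), h (n + 1) ω ∂P ≤ ∫ ω in A n, h (n + 1) ω ∂P :=
      setIntegral_mono_set (hint _).integrableOn (ae_of_all _ (h0 _)) (hA n).eventuallyLE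
    linarith [hstep n]

lemma integrable_sq_add_rpow {Ω : Type*} {m : MeasurableSpace Ω} {P : Measure Ω}
    [IsFiniteMeasure P] {f : Ω → ℝ} (hf : Measurable f) (hf0 : ∀ ω, 0 ≤ f ω) {r : ℝ} (hr : 0 < r)
    (hint : Integrable (fun ω => f ω ^ (2 * r)) P) {s : ℝ} (hs : 0 ≤ s) :
    Integrable (fun ω => (f ω ^ 2 + s) ^ r) P := by
  refine Integrable.mono' ((hint.const_mul (2 ^ r)).add (integrable_const ((2 * s) ^ r)))
    (((hf.pow_const 2).add_const s).pow_const r).aestronglyMeasurable (ae_of_all _ fun ω => ?_)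
  have hf' := hf0 ω
  rw [Real.norm_of_nonneg (by positivity)]
  simp only [Pi.add_apply]
  rw [Real.rpow_mul (hf0 ω), Real.rpow_two, ← Real.mul_rpow zero_le_two (by positivity)]
  rcases le_total (f ω ^ 2) s with h | h
  · have : (f ω ^ 2 + s) ^ r ≤ (2 * s) ^ r := by gcongr; linarith
    linarith [Real.rpow_nonneg (by positivity : 0 ≤ 2 * f ω ^ 2) r]
  · have : (f ω ^ 2 + s) ^ r ≤ (2 * f ω ^ 2) ^ r := by gcongr; linarith
    linarith [Real.rpow_nonneg (by positivity : 0 ≤ 2 * s) r]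

lemma rpow_sub_one_le_add {r q y t : ℝ} (hr : 0 < r) (hr1 : r ≤ 1) (hqr : q ≤ r) (hy : 0 < y)
    (ht : 1 ≤ t) :
    t ^ (q - 1) ≤ y ^ (2 * r - 2) + y ^ (2 * r) * t ^ (q - 1 - r) := by
  have ht0 : 0 < t := by linarith
  have e1 : y ^ (2 * r - 2) = (y ^ 2) ^ (r - 1) := by
    rw [← Real.rpow_two, ← Real.rpow_mul hy.le]; ring_nf
  have e2 : y ^ (2 * r) = (y ^ 2) ^ r := by rw [Real.rpow_mul hy.le, Real.rpow_two]
  rw [e1, e2]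
  have p1 : 0 ≤ (y ^ 2) ^ (r - 1) := by positivity
  have p2 : 0 ≤ (y ^ 2) ^ r * t ^ (q - 1 - r) := by positivity
  rcases le_total (y ^ 2) t with h | h
  · have h1 : t ^ (q - 1) ≤ t ^ (r - 1) := Real.rpow_le_rpow_of_exponent_le ht (by linarith)
    have h2 : t ^ (r - 1) ≤ (y ^ 2) ^ (r - 1) :=
      Real.rpow_le_rpow_of_nonpos (by positivity) h (by linarith)
    linarith
  · have h1 : t ^ (q - 1) = t ^ r * t ^ (q - 1 - r) := by
      rw [← Real.rpow_add ht0]; ring_nf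
    have h2 : t ^ r * t ^ (q - 1 - r) ≤ (y ^ 2) ^ r * t ^ (q - 1 - r) := by gcongr
    linarith

section Drift

variable {Ω : Type*} {m : MeasurableSpace Ω} {P : Measure Ω} [IsProbabilityMeasure P]
  {F : Filtration ℕ m} {Y : ℕ → Ω → ℝ} {B C p₀ : ℝ}

lemma setOf_lt_upsilon_succ_subset (B : ℝ) (Y : ℕ → Ω → ℝ) (k : ℕ) :
    {ω | ((k + 1 + 1 : ℕ) : ℝ≥0∞) < upsilon B Y ω} ⊆ {ω | ((k + 1 : ℕ) : ℝ≥0∞) < upsilon B Y ω} :=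
  fun _ hω => lt_upsilon_iff.2 fun i h1 hi => lt_upsilon_iff.1 hω i h1 (hi.trans (k + 1).le_succ)

lemma exists_sum_le_of_one_le (hadapted : Adapted F Y) (hY0 : ∀ t ω, 0 ≤ Y t ω) (hB : 0 < B)
    (hC : 0 < C) (hp₀ : 1 ≤ p₀)
    (hint : ∀ t : ℕ, Integrable (fun ω => Y t ω ^ (2 * p₀)) P)
    (hdrift : ∀ t : ℕ, ∀ᵐ ω ∂P, (t : ℝ≥0∞) < upsilon B Y ω →
      (P[(fun ω' => Y (t + 1) ω' ^ (2 * p₀) - Y t ω' ^ (2 * p₀)) | F t]) ω ≤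
        -C * Y t ω ^ (2 * p₀ - 2)) :
    ∃ K : ℝ, ∀ n : ℕ, ∑ k ∈ Finset.range n, ((k + 1 : ℕ) : ℝ) ^ (p₀ - 1) *
      P.real {ω | ((k + 1 : ℕ) : ℝ≥0∞) < upsilon B Y ω} ≤ K := by
  have hp0 : 0 < p₀ := by linarith
  obtain ⟨c, hc, hcC⟩ : ∃ c : ℝ, 0 < c ∧ p₀ * c = C / 2 :=
    ⟨C / (2 * p₀), by positivity, by field_simp⟩
  let A : ℕ → Set Ω := fun k => {ω | ((k + 1 : ℕ) : ℝ≥0∞) < upsilon B Y ω}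
  let h : ℕ → Ω → ℝ := fun k ω => (Y (k + 1) ω ^ 2 + c * (k + 1 : ℕ)) ^ p₀
  have hmeas : ∀ t, Measurable (Y t) := fun t => (hadapted t).mono (F.le t) le_rfl
  have hAm : ∀ k, MeasurableSet[F (k + 1)] (A k) := fun k =>
    measurableSet_lt_upsilon hadapted B (k + 1)
  have hh : ∀ k, Integrable (h k) P := fun k =>
    integrable_sq_add_rpow (hmeas _) (hY0 _) hp0 (hint _) (by positivity)
  have hstep : ∀ k, ∫ ω in A k, h (k + 1) ω ∂P ≤ ∫ ω in A k, h k ω ∂P -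
      C / 2 * c ^ (p₀ - 1) * (((k + 1 : ℕ) : ℝ) ^ (p₀ - 1) * P.real (A k)) := by
    intro k
    have hs : 0 < c * (k + 1 + 1 : ℕ) := by positivity
    set s := c * (k + 1 + 1 : ℕ) with hs'
    have hsk : s = c * (k + 1 : ℕ) + c := by rw [hs']; push_cast; ring
    let d := C / 2 * (c ^ (p₀ - 1) * ((k + 1 : ℕ) : ℝ) ^ (p₀ - 1))
    let φ : Ω → ℝ := fun ω => (1 + s / max (Y (k + 1) ω ^ 2) (B ^ 2)) ^ (p₀ - 1)
    have hφ : StronglyMeasurable[F (k + 1)] φ := by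
      have := hadapted (k + 1)
      refine Measurable.stronglyMeasurable ?_
      exact ((measurable_const.div ((this.pow_const 2).max measurable_const)).const_add
        1).pow_const (p₀ - 1)
    have hmax : ∀ ω, 0 < max (Y (k + 1) ω ^ 2) (B ^ 2) := fun ω => lt_max_of_lt_right (by positivity)
    have hsq : ∀ t ω, Y t ω ^ (2 * p₀) = (Y t ω ^ 2) ^ p₀ := fun t ω => by
      rw [Real.rpow_mul (hY0 t ω), Real.rpow_two]
    have hw : ∀ ω ∈ A k, B ^ 2 < Y (k + 1) ω ^ 2 := fun ω hω =>
      pow_lt_pow_left₀ (lt_upsilon_iff.1 hω (k + 1) (by omega) le_rfl) hB.le two_ne_zero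
    have hB2 : 0 < B ^ 2 := by positivity
    have hφeq : ∀ ω ∈ A k, φ ω = (1 + s / Y (k + 1) ω ^ 2) ^ (p₀ - 1) := fun ω hω => by
      simp only [φ, max_eq_left (hw ω hω).le]
    have key := setIntegral_le_of_condExp_le P (F.le (k + 1)) (hAm k) (X := h (k + 1))
      (X₀ := fun ω => (Y (k + 1) ω ^ 2 + s) ^ p₀) (Z := fun ω => h k ω - d) (φ := φ)
      (Δ := fun ω => Y (k + 1 + 1) ω ^ (2 * p₀) - Y (k + 1) ω ^ (2 * p₀))
      (g := fun ω => -C * Y (k + 1) ω ^ (2 * p₀ - 2)) (M := (1 + s / B ^ 2) ^ (p₀ - 1))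
      (hh _) (integrable_sq_add_rpow (hmeas _) (hY0 _) hp0 (hint _) hs.le)
      ((hh k).sub (integrable_const d)) ((hint _).sub (hint _)) hφ
      (fun ω => by have := hmax ω; positivity)
      (fun ω => by
        have := hmax ω
        refine Real.rpow_le_rpow (by positivity) ?_ (by linarith)
        gcongr
        exact le_max_right _ _)
      (hdrift (k + 1))
      (fun ω hω => by
        simp only [hφeq ω hω, hsq]
        exact rpow_add_const_le_tangent hp₀ (hB2.trans (hw ω hω)) (by positivity) hs.le)
      (fun ω hω => by
        have hw0 := hB2.trans (hw ω hω)
        simp only [hφeq ω hω]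
        have e1 : Y (k + 1) ω ^ (2 * p₀ - 2) = (Y (k + 1) ω ^ 2) ^ (p₀ - 1) := by
          rw [← Real.rpow_two, ← Real.rpow_mul (hY0 _ ω)]; ring_nf
        have e2 : (1 + s / Y (k + 1) ω ^ 2) ^ (p₀ - 1) * (Y (k + 1) ω ^ 2) ^ (p₀ - 1) =
            (Y (k + 1) ω ^ 2 + s) ^ (p₀ - 1) := by
          rw [← Real.mul_rpow (by positivity) hw0.le]
          congr 1
          rw [add_mul, one_mul, div_mul_cancel₀ _ hw0.ne']
        have e3 := rpow_sub_rpow_le hp₀ (a := Y (k + 1) ω ^ 2 + s)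
          (b := Y (k + 1) ω ^ 2 + c * (k + 1 : ℕ)) (by positivity) (by positivity)
        have e4 : p₀ * (Y (k + 1) ω ^ 2 + s - (Y (k + 1) ω ^ 2 + c * (k + 1 : ℕ))) = C / 2 := by
          rw [hsk, ← hcC]; ring
        rw [e4] at e3
        have e5 : c ^ (p₀ - 1) * ((k + 1 : ℕ) : ℝ) ^ (p₀ - 1) ≤
            (Y (k + 1) ω ^ 2 + s) ^ (p₀ - 1) := by
          rw [← Real.mul_rpow hc.le (by positivity)]
          exact Real.rpow_le_rpow (by positivity) (by linarith) (by linarith)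
        have e6 : d ≤ C / 2 * (Y (k + 1) ω ^ 2 + s) ^ (p₀ - 1) := by
          simp only [d]; gcongr
        have e7 : (1 + s / Y (k + 1) ω ^ 2) ^ (p₀ - 1) * (-C * Y (k + 1) ω ^ (2 * p₀ - 2)) =
            -C * (Y (k + 1) ω ^ 2 + s) ^ (p₀ - 1) := by
          rw [← e2, e1]; ring
        rw [e7]
        simp only [h]
        linarith)
    refine key.trans (le_of_eq ?_)
    rw [integral_sub (hh k).integrableOn (integrable_const d).integrableOn, setIntegral_const,
      smul_eq_mul]
    simp only [d]
    ring
  have hcc : 0 < C / 2 * c ^ (p₀ - 1) := by positivity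
  refine ⟨(∫ ω in A 0, h 0 ω ∂P) / (C / 2 * c ^ (p₀ - 1)), fun n => ?_⟩
  have hh0 : ∀ k ω, 0 ≤ h k ω := fun k ω => by positivity
  have hsum := sum_add_setIntegral_le P (setOf_lt_upsilon_succ_subset B Y) hh hh0 hstep n
  rw [← Finset.mul_sum] at hsum
  rw [le_div_iff₀ hcc, mul_comm]
  have hn : 0 ≤ ∫ ω in A n, h n ω ∂P := integral_nonneg (hh0 n)
  linarith

lemma exists_sum_le_of_le_one (hadapted : Adapted F Y) (hY0 : ∀ t ω, 0 ≤ Y t ω) (hB : 0 < B)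
    (hC : 0 < C) (hp0 : 0 < p₀) (hp₀ : p₀ ≤ 1) {q : ℝ} (hq : q < p₀)
    (hint : ∀ t : ℕ, Integrable (fun ω => Y t ω ^ (2 * p₀)) P)
    (hdrift : ∀ t : ℕ, ∀ᵐ ω ∂P, (t : ℝ≥0∞) < upsilon B Y ω →
      (P[(fun ω' => Y (t + 1) ω' ^ (2 * p₀) - Y t ω' ^ (2 * p₀)) | F t]) ω ≤
        -C * Y t ω ^ (2 * p₀ - 2)) :
    ∃ K : ℝ, ∀ n : ℕ, ∑ k ∈ Finset.range n, ((k + 1 : ℕ) : ℝ) ^ (q - 1) *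
      P.real {ω | ((k + 1 : ℕ) : ℝ≥0∞) < upsilon B Y ω} ≤ K := by
  let A : ℕ → Set Ω := fun k => {ω | ((k + 1 : ℕ) : ℝ≥0∞) < upsilon B Y ω}
  let V : ℕ → Ω → ℝ := fun k ω => Y (k + 1) ω ^ (2 * p₀)
  have hV : ∀ k, Integrable (V k) P := fun k => hint (k + 1)
  have hV0 : ∀ k ω, 0 ≤ V k ω := fun k ω => Real.rpow_nonneg (hY0 _ ω) _
  have hAm : ∀ k, MeasurableSet[F (k + 1)] (A k) := fun k =>
    measurableSet_lt_upsilon hadapted B (k + 1)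
  have hYpos : ∀ k, ∀ ω ∈ A k, 0 < Y (k + 1) ω := fun k ω hω =>
    hB.trans (lt_upsilon_iff.1 hω (k + 1) (by omega) le_rfl)
  have hstep : ∀ k, ∀ Z : Ω → ℝ, Integrable Z P →
      (∀ ω ∈ A k, V k ω - C * Y (k + 1) ω ^ (2 * p₀ - 2) ≤ Z ω) →
      ∫ ω in A k, V (k + 1) ω ∂P ≤ ∫ ω in A k, Z ω ∂P := fun k Z hZ hle =>
    setIntegral_le_of_condExp_le P (F.le (k + 1)) (hAm k) (X₀ := V k) (φ := fun _ => 1) (M := 1)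
      (Δ := fun ω => Y (k + 1 + 1) ω ^ (2 * p₀) - Y (k + 1) ω ^ (2 * p₀))
      (g := fun ω => -C * Y (k + 1) ω ^ (2 * p₀ - 2))
      (hV _) (hV _) hZ ((hV (k + 1)).sub (hV k)) stronglyMeasurable_const
      (fun _ => zero_le_one) (fun _ => le_rfl) (hdrift (k + 1))
      (fun ω _ => by simp only [V]; linarith)
      (fun ω hω => by have := hle ω hω; linarith)
  set K₀ := ∫ ω in A 0, V 0 ω ∂P with hK₀
  have hK₀0 : 0 ≤ K₀ := integral_nonneg (hV0 0)
  have hVle : ∀ k, ∫ ω in A k, V k ω ∂P ≤ K₀ := fun k => by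
    have := sum_add_setIntegral_le P (setOf_lt_upsilon_succ_subset B Y) hV hV0 (d := fun _ => 0)
      (fun k => by
        rw [sub_zero]
        refine hstep k _ (hV k) fun ω hω => ?_
        have := hYpos k ω hω
        have : 0 ≤ C * Y (k + 1) ω ^ (2 * p₀ - 2) := by positivity
        linarith) k
    simpa using this
  have hmain := sum_add_setIntegral_le P (setOf_lt_upsilon_succ_subset B Y) hV hV0
    (d := fun k => C * (((k + 1 : ℕ) : ℝ) ^ (q - 1) * P.real (A k)) -
      C * K₀ * ((k + 1 : ℕ) : ℝ) ^ (q - 1 - p₀)) fun k => by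
    have ht : (1 : ℝ) ≤ (k + 1 : ℕ) := by exact_mod_cast Nat.le_add_left 1 k
    refine (hstep k (fun ω => V k ω * (1 + C * ((k + 1 : ℕ) : ℝ) ^ (q - 1 - p₀)) -
      C * ((k + 1 : ℕ) : ℝ) ^ (q - 1)) (((hV k).mul_const _).sub (integrable_const _))
      fun ω hω => ?_).trans ?_
    · have := rpow_sub_one_le_add hp0 hp₀ hq.le (hYpos k ω hω) ht
      have := mul_le_mul_of_nonneg_left this hC.le
      simp only [V]
      linarith
    · rw [integral_sub ((hV k).mul_const _).integrableOn (integrable_const _).integrableOn,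
        setIntegral_const, integral_mul_const, smul_eq_mul]
      have h1 : (∫ ω in A k, V k ω ∂P) * (C * ((k + 1 : ℕ) : ℝ) ^ (q - 1 - p₀)) ≤
          K₀ * (C * ((k + 1 : ℕ) : ℝ) ^ (q - 1 - p₀)) := by
        gcongr
        exact hVle k
      linarith
  have hsummable : Summable fun k : ℕ => ((k + 1 : ℕ) : ℝ) ^ (q - 1 - p₀) :=
    (summable_nat_add_iff 1).2 (Real.summable_nat_rpow.2 (by linarith))
  refine ⟨(K₀ + C * K₀ * ∑' k : ℕ, ((k + 1 : ℕ) : ℝ) ^ (q - 1 - p₀)) / C, fun n => ?_⟩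
  have hn := hmain n
  rw [Finset.sum_sub_distrib, ← Finset.mul_sum, ← Finset.mul_sum] at hn
  have hts := mul_le_mul_of_nonneg_left (hsummable.sum_le_tsum (Finset.range n)
    (fun _ _ => by positivity)) (by positivity : 0 ≤ C * K₀)
  rw [le_div_iff₀ hC, mul_comm]
  have hVn : 0 ≤ ∫ ω in A n, V n ω ∂P := integral_nonneg (hV0 n)
  linarith

end Drift

/-- Lemma 3.1, from Aspandiiarov–Iasnogorodski–Menshikov:
if `E[Y_{t+1}^{2p₀} - Y_t^{2p₀} ∣ F_t] ≤ -C Y_t^{2p₀-2}` on `{υ_B > t}`, then for any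
`p ∈ [0,p₀)` and deterministic initial value `Y₀ = x`, `E[υ_B^p] < ∞`. -/
theorem passage_time_moment_exists
    {Ω : Type*} {m : MeasurableSpace Ω} (P : Measure Ω) [IsProbabilityMeasure P]
    (F : Filtration ℕ m) (Y : ℕ → Ω → ℝ) (hadapted : Adapted F Y)
    (Λ : Set ℝ) (hΛnn : Λ ⊆ Set.Ici (0 : ℝ)) (hΛunb : ¬ BddAbove Λ)
    (hYΛ : ∀ t ω, Y t ω ∈ Λ)
    (B : ℝ) (hB : 0 < B)
    (C p₀ : ℝ) (hC : 0 < C) (hp₀ : 0 < p₀)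
    (hint : ∀ t : ℕ, Integrable (fun ω => Y t ω ^ (2 * p₀)) P)
    (hdrift : ∀ t : ℕ, ∀ᵐ ω ∂P, (t : ℝ≥0∞) < upsilon B Y ω →
      (P[(fun ω' => Y (t + 1) ω' ^ (2 * p₀) - Y t ω' ^ (2 * p₀)) | F t]) ω ≤
        -C * Y t ω ^ (2 * p₀ - 2))
    (x : ℝ) (hx : ∀ ω, Y 0 ω = x) :
    ∀ p : ℝ, 0 ≤ p → p < p₀ → ∫⁻ ω, upsilon B Y ω ^ p ∂P < ⊤ := by
  intro p _ hpp
  have hY0 : ∀ t ω, 0 ≤ Y t ω := fun t ω => hΛnn (hYΛ t ω)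
  rcases le_total 1 p₀ with h1 | h1
  · obtain ⟨K, hK⟩ := exists_sum_le_of_one_le hadapted hY0 hB hC h1 hint hdrift
    exact lintegral_upsilon_rpow_lt_top P hadapted B hp₀ hpp.le hK
  · obtain ⟨K, hK⟩ := exists_sum_le_of_le_one hadapted hY0 hB hC hp₀ h1
      (q := (p + p₀) / 2) (by linarith) hint hdrift
    exact lintegral_upsilon_rpow_lt_top P hadapted B (by linarith) (by linarith) hK
end
end

section
/- Suppose (A1) and (A2) hold and ‖μ(x)‖ = O(‖x‖^{−1}) as ‖x‖ → ∞. Let α ∈ (0,π/2) and x ∈ W(α). Then there exist γ ∈ (0,∞), not depending on x, and C ∈ (0,∞), which may depend on x, such that for all t > 0, P[τ_α > t | ξ₀ = x] ≤ C t^{−γ}. -/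
open MeasureTheory
open scoped ENNReal

noncomputable section

/-- Euclidean norm of a lattice point in `ℤ²`. -/
def znorm (x : ℤ × ℤ) : ℝ := Real.sqrt ((x.1 : ℝ) ^ 2 + (x.2 : ℝ) ^ 2)

/-- Polar angle in `(-π, π]` of a lattice point. -/
def ang (x : ℤ × ℤ) : ℝ := Complex.arg ⟨(x.1 : ℝ), (x.2 : ℝ)⟩

/-- The harmonic function `f_w(x) = r^w cos(w φ)` in polar coordinates. -/
def fw (w : ℝ) (x : ℤ × ℤ) : ℝ := znorm x ^ w * Real.cos (w * ang x)

/-- First component of the mean drift at `x` given jump pmf `p`. -/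
def mu1 (p : ℤ × ℤ → ℤ × ℤ → ℝ) (x : ℤ × ℤ) : ℝ := ∑' y : ℤ × ℤ, p x y * (y.1 : ℝ)

/-- Second component of the mean drift at `x`. -/
def mu2 (p : ℤ × ℤ → ℤ × ℤ → ℝ) (x : ℤ × ℤ) : ℝ := ∑' y : ℤ × ℤ, p x y * (y.2 : ℝ)

/-- Euclidean norm of the mean drift at `x`. -/
def muNorm (p : ℤ × ℤ → ℤ × ℤ → ℝ) (x : ℤ × ℤ) : ℝ :=
  Real.sqrt (mu1 p x ^ 2 + mu2 p x ^ 2)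

/-- Second moment `M₁₁(x)`. -/
def M11 (p : ℤ × ℤ → ℤ × ℤ → ℝ) (x : ℤ × ℤ) : ℝ := ∑' y : ℤ × ℤ, p x y * (y.1 : ℝ) ^ 2

/-- Second moment `M₂₂(x)`. -/
def M22 (p : ℤ × ℤ → ℤ × ℤ → ℝ) (x : ℤ × ℤ) : ℝ := ∑' y : ℤ × ℤ, p x y * (y.2 : ℝ) ^ 2

/-- Mixed second moment `M₁₂(x)`. -/
def M12 (p : ℤ × ℤ → ℤ × ℤ → ℝ) (x : ℤ × ℤ) : ℝ :=
  ∑' y : ℤ × ℤ, p x y * ((y.1 : ℝ) * (y.2 : ℝ))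

/-- `p` is a family of probability mass functions on `ℤ²` (the jump laws `θ(x)`). -/
def IsJumpPMF (p : ℤ × ℤ → ℤ × ℤ → ℝ) : Prop :=
  (∀ x y, 0 ≤ p x y) ∧ ∀ x, HasSum (p x) 1

/-- (A2): jumps are uniformly bounded by `b`: `P[‖θ(x)‖ > b] = 0` for all `x`. -/
def A2 (p : ℤ × ℤ → ℤ × ℤ → ℝ) (b : ℝ) : Prop :=
  ∀ x y, b < znorm y → p x y = 0

section walk

variable {Ω : Type*} [MeasurableSpace Ω]

/-- `ξ` is a time-homogeneous Markov chain with one-step jump law `p`: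
conditionally on the past and on `ξ_t = x`, the law of `ξ_{t+1} - ξ_t` is `p x`. -/
def IsMarkovWith (P : Measure Ω) (ξ : ℕ → Ω → ℤ × ℤ) (p : ℤ × ℤ → ℤ × ℤ → ℝ) : Prop :=
  ∀ (t : ℕ) (x y : ℤ × ℤ) (A : Set Ω),
    MeasurableSet[⨆ s ∈ Finset.range (t + 1), MeasurableSpace.comap (ξ s) ⊤] A →
    P (A ∩ {ω | ξ t ω = x} ∩ {ω | ξ (t + 1) ω = x + y}) =
      ENNReal.ofReal (p x y) * P (A ∩ {ω | ξ t ω = x})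

/-- (A1): uniform weak isotropy: from any `x ∈ S`, in `n₀` steps the walk moves by
each of `±k e₁, ±k e₂` with conditional probability at least `κ`. -/
def A1 (P : Measure Ω) (S : Set (ℤ × ℤ)) (ξ : ℕ → Ω → ℤ × ℤ)
    (κ : ℝ) (k n₀ : ℕ) : Prop :=
  ∀ (t : ℕ), ∀ x ∈ S,
    ∀ y ∈ ({((k : ℤ), (0 : ℤ)), (-(k : ℤ), 0), (0, (k : ℤ)), (0, -(k : ℤ))} : Set (ℤ × ℤ)),
      ENNReal.ofReal κ * P {ω | ξ t ω = x} ≤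
        P ({ω | ξ t ω = x} ∩ {ω | ξ (t + n₀) ω = x + y})

/-- First exit time from a region `Wm`, with value `∞` if the walk never leaves. -/
def exitTime (Wm : Set (ℤ × ℤ)) (ξ : ℕ → Ω → ℤ × ℤ) (ω : Ω) : ℝ≥0∞ :=
  ⨅ (t : ℕ) (_ : ξ t ω ∉ Wm), (t : ℝ≥0∞)

end walk

/-- The wedge `W(α)` for `α ∈ (0,π)`, together with the `α = π` case, where
`W(π) = ℝ² \ H_b` is the complement of the thickened half-line of half-width `b`. -/
def Wset (b α : ℝ) : Set (ℤ × ℤ) :=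
  {x | (α < Real.pi ∧ znorm x * Real.cos α < (x.1 : ℝ)) ∨
       (α = Real.pi ∧ ¬ ((x.1 : ℝ) ≤ 0 ∧ |(x.2 : ℝ)| ≤ b))}

/-- The wedge `W(α) = {x : r > 0, -α < φ < α}` in polar form, for `α ∈ (0,π]`. -/
def WsetArg (α : ℝ) : Set (ℤ × ℤ) :=
  {x | 0 < znorm x ∧ -α < ang x ∧ ang x < α}

end

/-! ### The transition operator of the walk -/

/-- The box `{-N, …, N}²`. -/
noncomputable def jumpBox (N : ℕ) : Finset (ℤ × ℤ) := Finset.Icc (-(N : ℤ), -(N : ℤ)) (N, N)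

lemma mem_jumpBox {N : ℕ} {y : ℤ × ℤ} : y ∈ jumpBox N ↔ |y.1| ≤ N ∧ |y.2| ≤ N := by
  simp only [jumpBox, Finset.mem_Icc, Prod.le_def, abs_le]
  tauto

lemma add_mem_jumpBox {M N : ℕ} {y z : ℤ × ℤ} (hy : y ∈ jumpBox M) (hz : z ∈ jumpBox N) :
    y + z ∈ jumpBox (M + N) := by
  rw [mem_jumpBox] at *
  push_cast
  exact ⟨(abs_add_le _ _).trans (add_le_add hy.1 hz.1),
    (abs_add_le _ _).trans (add_le_add hy.2 hz.2)⟩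

lemma abs_fst_le_znorm (y : ℤ × ℤ) : |(y.1 : ℝ)| ≤ znorm y :=
  Real.abs_le_sqrt (by nlinarith [sq_nonneg (y.2 : ℝ)])

lemma abs_snd_le_znorm (y : ℤ × ℤ) : |(y.2 : ℝ)| ≤ znorm y :=
  Real.abs_le_sqrt (by nlinarith [sq_nonneg (y.1 : ℝ)])

lemma A2.eq_zero_of_notMem_jumpBox {p : ℤ × ℤ → ℤ × ℤ → ℝ} {b : ℝ} (hA2 : A2 p b) {N : ℕ}
    (hN : b ≤ N) (x : ℤ × ℤ) {y : ℤ × ℤ} (hy : y ∉ jumpBox N) : p x y = 0 := by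
  refine hA2 x y (lt_of_not_ge fun h => hy (mem_jumpBox.2 ⟨?_, ?_⟩))
  · exact_mod_cast ((abs_fst_le_znorm y).trans h).trans hN
  · exact_mod_cast ((abs_snd_le_znorm y).trans h).trans hN

/-- The one-step transition operator, for jumps supported in `jumpBox N`. -/
noncomputable def transOp (p : ℤ × ℤ → ℤ × ℤ → ℝ) (N : ℕ) : Module.End ℝ (ℤ × ℤ → ℝ) where
  toFun f x := ∑ y ∈ jumpBox N, p x y * f (x + y)
  map_add' f g := by
    ext x
    simp [mul_add, Finset.sum_add_distrib]
  map_smul' c f := by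
    ext x
    simp only [Pi.smul_apply, smul_eq_mul, RingHom.id_apply, Finset.mul_sum]
    exact Finset.sum_congr rfl fun y _ => by ring

lemma transOp_apply (p : ℤ × ℤ → ℤ × ℤ → ℝ) (N : ℕ) (f : ℤ × ℤ → ℝ) (x : ℤ × ℤ) :
    transOp p N f x = ∑ y ∈ jumpBox N, p x y * f (x + y) := rfl

/-- A set of states that the jumps of positive probability do not leave. -/
def ClosedUnder (p : ℤ × ℤ → ℤ × ℤ → ℝ) (V : Set (ℤ × ℤ)) : Prop :=
  ∀ x ∈ V, ∀ y, p x y ≠ 0 → x + y ∈ V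

section operator

variable {p : ℤ × ℤ → ℤ × ℤ → ℝ} {N : ℕ} {V : Set (ℤ × ℤ)}

lemma transOp_pow_mono (hp : ∀ x y, 0 ≤ p x y) (hV : ClosedUnder p V) (n : ℕ)
    {f g : ℤ × ℤ → ℝ} {x : ℤ × ℤ} (hx : x ∈ V)
    (hfg : ∀ z ∈ V, z - x ∈ jumpBox (n * N) → f z ≤ g z) :
    (transOp p N ^ n) f x ≤ (transOp p N ^ n) g x := by
  induction n generalizing x with
  | zero => exact hfg x hx (by simp [mem_jumpBox])
  | succ n ih =>
    simp only [pow_succ', Module.End.mul_apply, transOp_apply]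
    refine Finset.sum_le_sum fun y hy => ?_
    rcases eq_or_ne (p x y) 0 with h0 | h0
    · simp [h0]
    refine mul_le_mul_of_nonneg_left (ih (hV x hx y h0) fun z hz hzx => hfg z hz ?_) (hp x y)
    have := add_mem_jumpBox hzx hy
    rwa [add_comm x y, sub_add_eq_sub_sub_swap, sub_add_cancel,
      ← Nat.succ_mul] at this

lemma transOp_one (hsum : ∀ x, ∑ y ∈ jumpBox N, p x y = 1) : transOp p N 1 = 1 := by
  ext x
  simp [transOp_apply, hsum]

lemma transOp_pow_one (hsum : ∀ x, ∑ y ∈ jumpBox N, p x y = 1) (n : ℕ) :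
    (transOp p N ^ n) 1 = 1 := by
  induction n with
  | zero => simp
  | succ n ih => rw [pow_succ, Module.End.mul_apply, transOp_one hsum, ih]

lemma transOp_pow_le_add (hp : ∀ x y, 0 ≤ p x y) (hsum : ∀ x, ∑ y ∈ jumpBox N, p x y = 1)
    (hV : ClosedUnder p V) (n : ℕ) {f : ℤ × ℤ → ℝ} {x : ℤ × ℤ} (hx : x ∈ V) {ε : ℝ}
    (hf : ∀ z ∈ V, z - x ∈ jumpBox (n * N) → transOp p N f z ≤ f z + ε) :
    (transOp p N ^ n) f x ≤ f x + n * ε := by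
  induction n with
  | zero => simp
  | succ n ih =>
    have hsub : ∀ z : ℤ × ℤ, z - x ∈ jumpBox (n * N) → z - x ∈ jumpBox ((n + 1) * N) := by
      intro z hz
      have := add_mem_jumpBox hz (z := 0) (N := N) (by simp [mem_jumpBox])
      rwa [add_zero, ← Nat.succ_mul] at this
    have hf' := fun z hz hzx => hf z hz (hsub z hzx)
    calc (transOp p N ^ (n + 1)) f x = (transOp p N ^ n) (transOp p N f) x := by
          rw [pow_succ, Module.End.mul_apply]
      _ ≤ (transOp p N ^ n) (f + ε • 1) x :=
          transOp_pow_mono hp hV n hx fun z hz hzx => by simpa using hf' z hz hzx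
      _ = (transOp p N ^ n) f x + ε := by
          rw [map_add, map_smul, transOp_pow_one hsum]; simp
      _ ≤ f x + (n + 1 : ℕ) * ε := by
          push_cast
          linarith [ih hf']

lemma transOp_pow_ge_sub (hp : ∀ x y, 0 ≤ p x y) (hsum : ∀ x, ∑ y ∈ jumpBox N, p x y = 1)
    (hV : ClosedUnder p V) (n : ℕ) {f : ℤ × ℤ → ℝ} {x : ℤ × ℤ} (hx : x ∈ V) {ε : ℝ}
    (hf : ∀ z ∈ V, z - x ∈ jumpBox (n * N) → f z - ε ≤ transOp p N f z) :
    f x - n * ε ≤ (transOp p N ^ n) f x := by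
  have := transOp_pow_le_add hp hsum hV n hx (f := -f) (ε := ε) fun z hz hzx => by
    rw [map_neg, Pi.neg_apply, Pi.neg_apply]
    linarith [hf z hz hzx]
  rw [map_neg, Pi.neg_apply, Pi.neg_apply] at this
  linarith

lemma transOp_fst (hsum : ∀ x, ∑ y ∈ jumpBox N, p x y = 1)
    (hsupp : ∀ x, ∀ y ∉ jumpBox N, p x y = 0) (x : ℤ × ℤ) :
    transOp p N (fun z => (z.1 : ℝ)) x = x.1 + mu1 p x := by
  rw [mu1, tsum_eq_sum (s := jumpBox N) fun y hy => by rw [hsupp x y hy, zero_mul], transOp_apply]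
  simp [mul_add, Finset.sum_add_distrib, ← Finset.sum_mul, hsum]

lemma transOp_snd (hsum : ∀ x, ∑ y ∈ jumpBox N, p x y = 1)
    (hsupp : ∀ x, ∀ y ∉ jumpBox N, p x y = 0) (x : ℤ × ℤ) :
    transOp p N (fun z => (z.2 : ℝ)) x = x.2 + mu2 p x := by
  rw [mu2, tsum_eq_sum (s := jumpBox N) fun y hy => by rw [hsupp x y hy, zero_mul], transOp_apply]
  simp [mul_add, Finset.sum_add_distrib, ← Finset.sum_mul, hsum]

end operator

/-- The one-step transition operator on functions with values in `[0, ∞]`. -/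
noncomputable def transOpENN (p : ℤ × ℤ → ℤ × ℤ → ℝ) (g : ℤ × ℤ → ℝ≥0∞) (x : ℤ × ℤ) : ℝ≥0∞ :=
  ∑' y, ENNReal.ofReal (p x y) * g (x + y)

lemma transOp_pow_nonneg {p : ℤ × ℤ → ℤ × ℤ → ℝ} {N : ℕ} (hp : ∀ x y, 0 ≤ p x y) (n : ℕ)
    {f : ℤ × ℤ → ℝ} (hf : ∀ z, 0 ≤ f z) (x : ℤ × ℤ) : 0 ≤ (transOp p N ^ n) f x := by
  have := transOp_pow_mono hp (V := Set.univ) (fun _ _ _ _ => trivial) n (N := N)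
    (f := 0) (g := f) (Set.mem_univ x) fun z _ _ => hf z
  simpa using this

lemma transOpENN_iterate_ofReal {p : ℤ × ℤ → ℤ × ℤ → ℝ} {N : ℕ} (hp : ∀ x y, 0 ≤ p x y)
    (hsupp : ∀ x, ∀ y ∉ jumpBox N, p x y = 0) (n : ℕ)
    {f : ℤ × ℤ → ℝ} (hf : ∀ z, 0 ≤ f z) :
    (transOpENN p)^[n] (fun z => ENNReal.ofReal (f z)) =
      fun x => ENNReal.ofReal ((transOp p N ^ n) f x) := by
  induction n with
  | zero => simp
  | succ n ih =>
    rw [Function.iterate_succ_apply', ih, pow_succ']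
    ext x
    rw [transOpENN, tsum_eq_sum (s := jumpBox N) fun y hy => by simp [hsupp x y hy],
      Module.End.mul_apply, transOp_apply, ENNReal.ofReal_sum_of_nonneg fun y _ =>
        mul_nonneg (hp x y) (transOp_pow_nonneg hp n hf _)]
    exact Finset.sum_congr rfl fun y _ => (ENNReal.ofReal_mul (hp x y)).symm

/-! ### The Markov property along the transition operator -/

section markov

variable {Ω : Type*} {ξ : ℕ → Ω → ℤ × ℤ}

/-- The event `A` is determined by `ξ_0, …, ξ_t`. -/
def InPast (ξ : ℕ → Ω → ℤ × ℤ) (t : ℕ) (A : Set Ω) : Prop :=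
  MeasurableSet[⨆ s ∈ Finset.range (t + 1), MeasurableSpace.comap (ξ s) ⊤] A

lemma InPast.mono {s t : ℕ} (hst : s ≤ t) {A : Set Ω} (hA : InPast ξ s A) : InPast ξ t A := by
  refine (iSup₂_le fun i hi => ?_ : _ ≤ ⨆ s ∈ Finset.range (t + 1),
    MeasurableSpace.comap (ξ s) ⊤) A hA
  refine le_iSup₂_of_le i ?_ le_rfl
  simp only [Finset.mem_range] at *
  omega

lemma inPast_preimage (t : ℕ) (B : Set (ℤ × ℤ)) : InPast ξ t {ω | ξ t ω ∈ B} := by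
  have h : MeasurableSpace.comap (ξ t) ⊤ ≤
      ⨆ s ∈ Finset.range (t + 1), MeasurableSpace.comap (ξ s) ⊤ :=
    le_iSup₂_of_le t (by simp) le_rfl
  exact h _ ⟨B, trivial, rfl⟩

lemma InPast.inter {t : ℕ} {A B : Set Ω} (hA : InPast ξ t A) (hB : InPast ξ t B) :
    InPast ξ t (A ∩ B) :=
  MeasurableSet.inter hA hB

/-- The walk, observed at multiples of `n`, starts at `x` and stays in `W` up to time `j n`. -/
def staysIn (ξ : ℕ → Ω → ℤ × ℤ) (n : ℕ) (W : Set (ℤ × ℤ)) (x : ℤ × ℤ) (j : ℕ) : Set Ω :=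
  {ω | ξ 0 ω = x ∧ ∀ i ≤ j, ξ (i * n) ω ∈ W}

lemma inPast_staysIn (n : ℕ) (W : Set (ℤ × ℤ)) (x : ℤ × ℤ) (j : ℕ) :
    InPast ξ (j * n) (staysIn ξ n W x j) := by
  have : staysIn ξ n W x j = {ω | ξ 0 ω ∈ ({x} : Set (ℤ × ℤ))} ∩
      ⋂ i ∈ Set.Iic j, {ω | ξ (i * n) ω ∈ W} := by
    ext ω
    simp [staysIn]
  rw [this]
  refine ((inPast_preimage 0 {x}).mono (Nat.zero_le _)).inter ?_
  refine MeasurableSet.biInter (Set.to_countable _) fun i hi => ?_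
  exact (inPast_preimage (i * n) W).mono (Nat.mul_le_mul_right n hi)

lemma staysIn_antitone (n : ℕ) (W : Set (ℤ × ℤ)) (x : ℤ × ℤ) : Antitone (staysIn ξ n W x) :=
  fun _ _ hij _ hω => ⟨hω.1, fun l hl => hω.2 l (hl.trans hij)⟩

variable [MeasurableSpace Ω] {P : Measure Ω} {p : ℤ × ℤ → ℤ × ℤ → ℝ}

lemma InPast.measurableSet (hmeas : ∀ t, Measurable (ξ t)) {t : ℕ} {A : Set Ω}
    (hA : InPast ξ t A) : MeasurableSet A := by
  refine (iSup₂_le fun i _ => ?_ : _ ≤ ‹MeasurableSpace Ω›) A hA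
  rintro _ ⟨B, -, rfl⟩
  exact hmeas i (MeasurableSet.of_discrete)

/-- The expectation of `g (ξ_t)` over the event `A`. -/
noncomputable def expOn (P : Measure Ω) (ξ : ℕ → Ω → ℤ × ℤ) (t : ℕ) (A : Set Ω)
    (g : ℤ × ℤ → ℝ≥0∞) : ℝ≥0∞ :=
  ∑' z, g z * P (A ∩ {ω | ξ t ω = z})

lemma tsum_measure_inter (hmeas : ∀ t, Measurable (ξ t)) (t : ℕ) {A : Set Ω}
    (hA : MeasurableSet A) : ∑' z, P (A ∩ {ω | ξ t ω = z}) = P A := by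
  rw [← measure_iUnion]
  · congr 1
    ext ω
    simp
  · intro x y hxy
    refine Set.disjoint_left.2 fun ω hx hy => hxy ?_
    exact hx.2.symm.trans hy.2
  · exact fun z => hA.inter (hmeas t (MeasurableSet.singleton z))

lemma expOn_succ (hmeas : ∀ t, Measurable (ξ t)) (hM : IsMarkovWith P ξ p) {t : ℕ} {A : Set Ω}
    (hA : InPast ξ t A) (g : ℤ × ℤ → ℝ≥0∞) :
    expOn P ξ (t + 1) A g = expOn P ξ t A (transOpENN p g) := by
  have hAm := hA.measurableSet hmeas
  have h1 : ∀ z, P (A ∩ {ω | ξ (t + 1) ω = z}) =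
      ∑' x, ENNReal.ofReal (p x (z - x)) * P (A ∩ {ω | ξ t ω = x}) := by
    intro z
    have hz : MeasurableSet (A ∩ {ω | ξ (t + 1) ω = z}) :=
      hAm.inter (hmeas (t + 1) (MeasurableSet.singleton z))
    rw [← tsum_measure_inter hmeas t hz]
    refine tsum_congr fun x => ?_
    rw [← hM t x (z - x) A hA, add_sub_cancel, Set.inter_right_comm]
  simp only [expOn, h1, transOpENN, ← ENNReal.tsum_mul_left, ← ENNReal.tsum_mul_right]
  rw [ENNReal.tsum_comm]
  refine tsum_congr fun x => ?_
  rw [← (Equiv.addLeft x).tsum_eq]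
  refine tsum_congr fun y => ?_
  simp only [Equiv.coe_addLeft, add_sub_cancel_left]
  ring

lemma expOn_add (hmeas : ∀ t, Measurable (ξ t)) (hM : IsMarkovWith P ξ p) {t : ℕ} {A : Set Ω}
    (hA : InPast ξ t A) (n : ℕ) (g : ℤ × ℤ → ℝ≥0∞) :
    expOn P ξ (t + n) A g = expOn P ξ t A ((transOpENN p)^[n] g) := by
  induction n generalizing g with
  | zero => rfl
  | succ n ih =>
    rw [← add_assoc, expOn_succ hmeas hM (hA.mono (Nat.le_add_right t n)), ih,
      Function.iterate_succ_apply]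

lemma expOn_eq_single {t : ℕ} (x : ℤ × ℤ) (g : ℤ × ℤ → ℝ≥0∞) :
    expOn P ξ t {ω | ξ t ω = x} g = g x * P {ω | ξ t ω = x} := by
  rw [expOn, tsum_eq_single x, Set.inter_self]
  intro z hz
  have : {ω | ξ t ω = x} ∩ {ω | ξ t ω = z} = ∅ :=
    Set.eq_empty_of_forall_notMem fun ω h => hz (h.2.symm.trans h.1)
  simp [this]

lemma expOn_indicator (t : ℕ) (A : Set Ω) (x : ℤ × ℤ) :
    expOn P ξ t A (fun z => ENNReal.ofReal ((Pi.single x 1 : ℤ × ℤ → ℝ) z)) =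
      P (A ∩ {ω | ξ t ω = x}) := by
  rw [expOn, tsum_eq_single x]
  · simp
  · intro z hz
    simp [hz]

/-- The states that are visited with positive probability. -/
def visited (P : Measure Ω) (ξ : ℕ → Ω → ℤ × ℤ) : Set (ℤ × ℤ) :=
  {x | ∃ t, P {ω | ξ t ω = x} ≠ 0}

lemma closedUnder_visited (hp : ∀ x y, 0 ≤ p x y) (hM : IsMarkovWith P ξ p) :
    ClosedUnder p (visited P ξ) := by
  rintro x ⟨t, ht⟩ y hy
  refine ⟨t + 1, fun h0 => ?_⟩
  have h := hM t x y Set.univ MeasurableSet.univ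
  rw [measure_mono_null Set.inter_subset_right h0, Set.univ_inter] at h
  have := (hp x y).lt_of_ne' hy
  exact mul_ne_zero (by simpa using this) ht h.symm

lemma visited_subset {S : Set (ℤ × ℤ)} (hinS : ∀ t, ∀ᵐ ω ∂P, ξ t ω ∈ S) :
    visited P ξ ⊆ S := by
  rintro x ⟨t, ht⟩
  by_contra hx
  refine ht (measure_mono_null (fun ω hω => ?_) (hinS t))
  change ξ t ω ∉ S
  rwa [show ξ t ω = x from hω]

lemma A1.le_transOp_pow [IsFiniteMeasure P] {S : Set (ℤ × ℤ)} {κ : ℝ} {k n₀ N : ℕ}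
    (hmeas : ∀ t, Measurable (ξ t)) (hM : IsMarkovWith P ξ p) (hp : ∀ x y, 0 ≤ p x y)
    (hsupp : ∀ x, ∀ y ∉ jumpBox N, p x y = 0)
    (hA1 : A1 P S ξ κ k n₀) {x : ℤ × ℤ} (hxS : x ∈ S) (hx : x ∈ visited P ξ) {y : ℤ × ℤ}
    (hy : y ∈ ({((k : ℤ), (0 : ℤ)), (-(k : ℤ), 0), (0, (k : ℤ)), (0, -(k : ℤ))} :
      Set (ℤ × ℤ))) :
    κ ≤ (transOp p N ^ n₀) (Pi.single (x + y) 1) x := by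
  obtain ⟨t, ht⟩ := hx
  have hnn : ∀ z, (0 : ℝ) ≤ (Pi.single (x + y) 1 : ℤ × ℤ → ℝ) z := fun z => by
    rw [Pi.single_apply]
    split_ifs <;> norm_num
  have h := hA1 t x hxS y hy
  have hpast : InPast ξ t {ω | ξ t ω = x} := inPast_preimage t {x}
  rw [← expOn_indicator (P := P) (ξ := ξ) (t + n₀), expOn_add hmeas hM hpast,
    transOpENN_iterate_ofReal hp hsupp n₀ hnn, expOn_eq_single,
    ENNReal.mul_le_mul_iff_left ht (measure_ne_top _ _)] at h
  exact (ENNReal.ofReal_le_ofReal_iff (transOp_pow_nonneg hp _ hnn _)).1 h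

lemma expOn_mono_set {t : ℕ} {A B : Set Ω} (hAB : A ⊆ B) (g : ℤ × ℤ → ℝ≥0∞) :
    expOn P ξ t A g ≤ expOn P ξ t B g :=
  ENNReal.tsum_le_tsum fun _ => mul_le_mul_right (measure_mono (by gcongr)) _

lemma expOn_add_fun (t : ℕ) (A : Set Ω) (g h : ℤ × ℤ → ℝ≥0∞) :
    expOn P ξ t A (fun z => g z + h z) = expOn P ξ t A g + expOn P ξ t A h := by
  simp only [expOn, add_mul]
  exact ENNReal.tsum_add

lemma expOn_const_mul (t : ℕ) (A : Set Ω) (a : ℝ≥0∞) (g : ℤ × ℤ → ℝ≥0∞) :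
    expOn P ξ t A (fun z => a * g z) = a * expOn P ξ t A g := by
  simp only [expOn, mul_assoc]
  exact ENNReal.tsum_mul_left

lemma expOn_staysIn_mono {n : ℕ} {W : Set (ℤ × ℤ)} {x : ℤ × ℤ} {j : ℕ}
    {g h : ℤ × ℤ → ℝ≥0∞} (hgh : ∀ z ∈ W, z ∈ visited P ξ → g z ≤ h z) :
    expOn P ξ (j * n) (staysIn ξ n W x j) g ≤ expOn P ξ (j * n) (staysIn ξ n W x j) h := by
  refine ENNReal.tsum_le_tsum fun z => ?_
  by_cases h0 : P (staysIn ξ n W x j ∩ {ω | ξ (j * n) ω = z}) = 0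
  · simp [h0]
  refine mul_le_mul_left (hgh z ?_ ⟨j * n, fun h => h0 (measure_inter_null_of_null_right _ h)⟩) _
  obtain ⟨ω, hω⟩ := nonempty_of_measure_ne_zero h0
  have := hω.1.2 j le_rfl
  rwa [show ξ (j * n) ω = z from hω.2] at this

/-- A Foster–Lyapunov bound: if `F` decreases on average by `D` inside `W`, and `1` is dominated
on `W` by `a F + c D`, then the probability of staying in `W` is controlled. -/
lemma measure_staysIn_le [IsFiniteMeasure P] (hmeas : ∀ t, Measurable (ξ t))
    (hM : IsMarkovWith P ξ p)
    {n : ℕ} {W : Set (ℤ × ℤ)} {F D : ℤ × ℤ → ℝ≥0∞}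
    (hFD : ∀ z ∈ W, z ∈ visited P ξ → (transOpENN p)^[n] F z + D z ≤ F z)
    {a c : ℝ≥0∞} (hac : ∀ z ∈ W, z ∈ visited P ξ → 1 ≤ a * F z + c * D z) (x : ℤ × ℤ) (J : ℕ) :
    (J + 1 : ℕ) * P (staysIn ξ n W x J) ≤
      ((J + 1 : ℕ) * a + c) * (F x * P {ω | ξ 0 ω = x}) := by
  set U : ℕ → ℝ≥0∞ := fun j => expOn P ξ (j * n) (staysIn ξ n W x j) F with hU
  set E : ℕ → ℝ≥0∞ := fun j => expOn P ξ (j * n) (staysIn ξ n W x j) D with hE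
  have hstep : ∀ j, U (j + 1) + E j ≤ U j := by
    intro j
    calc U (j + 1) + E j
        ≤ expOn P ξ (j * n + n) (staysIn ξ n W x j) F + E j := by
          gcongr
          simp only [hU, Nat.succ_mul]
          exact expOn_mono_set (staysIn_antitone n W x (Nat.le_succ j)) F
      _ = expOn P ξ (j * n) (staysIn ξ n W x j) fun z => (transOpENN p)^[n] F z + D z := by
          rw [expOn_add hmeas hM (inPast_staysIn n W x j), expOn_add_fun]
      _ ≤ U j := expOn_staysIn_mono hFD
  have hsum : ∀ j, U j + ∑ i ∈ Finset.range j, E i ≤ U 0 := by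
    intro j
    induction j with
    | zero => simp
    | succ j ih =>
      rw [Finset.sum_range_succ, add_comm (Finset.sum _ _), ← add_assoc]
      exact (add_le_add_left (hstep j) _).trans ih
  have hU0 : U 0 ≤ F x * P {ω | ξ 0 ω = x} := by
    simp only [hU, zero_mul]
    rw [← expOn_eq_single]
    exact expOn_mono_set (fun ω hω => hω.1) F
  have hterm : ∀ j, P (staysIn ξ n W x j) ≤ a * U j + c * E j := by
    intro j
    rw [← tsum_measure_inter hmeas (j * n) ((inPast_staysIn n W x j).measurableSet hmeas)]
    calc _ = expOn P ξ (j * n) (staysIn ξ n W x j) (fun _ => 1) := by simp [expOn]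
      _ ≤ expOn P ξ (j * n) (staysIn ξ n W x j) (fun z => a * F z + c * D z) :=
          expOn_staysIn_mono hac
      _ = _ := by rw [expOn_add_fun, expOn_const_mul, expOn_const_mul]
  calc (J + 1 : ℕ) * P (staysIn ξ n W x J)
      = ∑ j ∈ Finset.range (J + 1), P (staysIn ξ n W x J) := by simp
    _ ≤ ∑ j ∈ Finset.range (J + 1), (a * U 0 + c * E j) := by
        refine Finset.sum_le_sum fun j hj => ?_
        refine (measure_mono (staysIn_antitone n W x
          (Nat.lt_succ_iff.1 (Finset.mem_range.1 hj)))).trans ((hterm j).trans ?_)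
        gcongr
        exact le_self_add.trans (hsum j)
    _ = (J + 1 : ℕ) * a * U 0 + c * ∑ j ∈ Finset.range (J + 1), E j := by
        rw [Finset.sum_add_distrib, Finset.mul_sum]
        simp [mul_assoc]
    _ ≤ (J + 1 : ℕ) * a * U 0 + c * U 0 := by
        gcongr
        exact le_add_self.trans (hsum (J + 1))
    _ ≤ _ := by
        rw [← add_mul]
        gcongr

end markov

/-! ### The Lyapunov function -/

lemma one_add_add_sq_div_four_le_exp {z : ℝ} (hz : |z| ≤ 1) : 1 + z + z ^ 2 / 4 ≤ Real.exp z := by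
  have h := (abs_le.1 (Real.exp_bound hz (n := 3) (by norm_num))).1
  norm_num [Finset.sum_range_succ, Nat.factorial] at h
  have h3 : |z| ^ 3 ≤ z ^ 2 := by
    rw [← sq_abs z]
    nlinarith [sq_nonneg |z|]
  nlinarith [sq_nonneg z]

/-- `log x - Λ exp (lam y / x)`, a function of the position `(x, y)` in the right half-plane whose
mean increments are negative when `lam` and `Λ` are large. -/
noncomputable def logLyap (lam Λ x y : ℝ) : ℝ := Real.log x - Λ * Real.exp (lam * (y / x))

section increments

variable {X y D₁ D₂ B T : ℝ}

lemma abs_cross_le (hX : 0 < X) (hy : |y| ≤ T * X) (h₁ : |D₁| ≤ B)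
    (h₂ : |D₂| ≤ B) : |X * D₂ - y * D₁| ≤ B * (1 + T) * X := by
  calc |X * D₂ - y * D₁| ≤ |X * D₂| + |y * D₁| := abs_sub _ _
    _ = X * |D₂| + |y| * |D₁| := by rw [abs_mul, abs_mul, abs_of_pos hX]
    _ ≤ X * B + (T * X) * B := by gcongr; exact (abs_nonneg y).trans hy
    _ = B * (1 + T) * X := by ring

lemma slope_sub_eq (hX : 0 < X) (hXD : 0 < X + D₁) :
    (y + D₂) / (X + D₁) - y / X = (X * D₂ - y * D₁) / (X * (X + D₁)) := by
  field_simp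
  ring

lemma abs_slope_sub_le (hB : 0 < B) (hX : 2 * B ≤ X) (hy : |y| ≤ T * X)
    (h₁ : |D₁| ≤ B) (h₂ : |D₂| ≤ B) :
    |(y + D₂) / (X + D₁) - y / X| ≤ 2 * B * (1 + T) / X := by
  have hX0 : 0 < X := by linarith
  have hXD : X / 2 ≤ X + D₁ := by linarith [(abs_le.1 h₁).1]
  have hN := abs_cross_le hX0 hy h₁ h₂
  rw [slope_sub_eq hX0 (by linarith), abs_div, abs_of_pos (mul_pos hX0 (by linarith : 0 < X + D₁)),
    div_le_div_iff₀ (by nlinarith) hX0]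
  have hK : 0 ≤ B * (1 + T) := by
    by_contra! h
    nlinarith [abs_nonneg (X * D₂ - y * D₁)]
  nlinarith [mul_le_mul_of_nonneg_right hN hX0.le,
    mul_le_mul_of_nonneg_left hXD (mul_nonneg hK hX0.le)]

lemma slope_sub_ge (hB : 0 < B) (hX : 2 * B ≤ X) (hy : |y| ≤ T * X)
    (h₁ : |D₁| ≤ B) (h₂ : |D₂| ≤ B) :
    (X * D₂ - y * D₁) / X ^ 2 - 2 * B ^ 2 * (1 + T) / X ^ 2 ≤ (y + D₂) / (X + D₁) - y / X := by
  have hX0 : 0 < X := by linarith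
  have hXD : 0 < X + D₁ := by linarith [(abs_le.1 h₁).1]
  have h := abs_slope_sub_le hB hX hy h₁ h₂
  have hs : (X * D₂ - y * D₁) / X ^ 2 - ((y + D₂) / (X + D₁) - y / X) =
      ((y + D₂) / (X + D₁) - y / X) * (D₁ / X) := by
    field_simp
    ring
  have hD : |D₁ / X| ≤ B / X := by
    rw [abs_div, abs_of_pos hX0]
    gcongr
  have hprod : ((y + D₂) / (X + D₁) - y / X) * (D₁ / X) ≤ 2 * B ^ 2 * (1 + T) / X ^ 2 := by
    calc _ ≤ |(y + D₂) / (X + D₁) - y / X| * |D₁ / X| := by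
          rw [← abs_mul]
          exact le_abs_self _
      _ ≤ 2 * B * (1 + T) / X * (B / X) :=
          mul_le_mul h hD (abs_nonneg _) ((abs_nonneg _).trans h)
      _ = _ := by ring
  linarith

lemma sq_slope_sub_ge (hB : 0 < B) (hX : 2 * B ≤ X) (h₁ : |D₁| ≤ B) :
    (X * D₂ - y * D₁) ^ 2 / (4 * X ^ 4) ≤ ((y + D₂) / (X + D₁) - y / X) ^ 2 := by
  have hX0 : 0 < X := by linarith
  have hXD : 0 < X + D₁ := by linarith [(abs_le.1 h₁).1]
  have hXD' : X + D₁ ≤ 2 * X := by linarith [(abs_le.1 h₁).2]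
  rw [slope_sub_eq hX0 hXD, div_pow]
  refine div_le_div_of_nonneg_left (sq_nonneg _) (by positivity) ?_
  calc (X * (X + D₁)) ^ 2 ≤ (X * (2 * X)) ^ 2 := by gcongr
    _ = 4 * X ^ 4 := by ring

variable {lam Λ : ℝ}

lemma logLyap_sub_le (hB : 0 < B) (hX : 2 * B ≤ X) (hy : |y| ≤ T * X)
    (h₁ : |D₁| ≤ B) (h₂ : |D₂| ≤ B) (hlam : 0 < lam) (hΛ : 0 ≤ Λ)
    (hXlam : lam * (2 * B * (1 + T)) ≤ X) :
    logLyap lam Λ (X + D₁) (y + D₂) - logLyap lam Λ X y ≤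
      D₁ / X - Λ * Real.exp (lam * (y / X)) * (lam * ((X * D₂ - y * D₁) / X ^ 2 -
        2 * B ^ 2 * (1 + T) / X ^ 2) + lam ^ 2 * ((X * D₂ - y * D₁) ^ 2 / (16 * X ^ 4))) := by
  have hX0 : 0 < X := by linarith
  have hXD : 0 < X + D₁ := by linarith [(abs_le.1 h₁).1]
  have hlog : Real.log (X + D₁) - Real.log X ≤ D₁ / X := by
    rw [← Real.log_div hXD.ne' hX0.ne']
    have := Real.log_le_sub_one_of_pos (div_pos hXD hX0)
    rwa [add_div, div_self hX0.ne', add_sub_cancel_left, ← div_self hX0.ne', ← add_div] at this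
  set s := (y + D₂) / (X + D₁) - y / X with hs
  have habs : |lam * s| ≤ 1 := by
    rw [abs_mul, abs_of_pos hlam]
    calc lam * |s| ≤ lam * (2 * B * (1 + T) / X) := by
          gcongr
          exact abs_slope_sub_le hB hX hy h₁ h₂
      _ = lam * (2 * B * (1 + T)) / X := by ring
      _ ≤ 1 := (div_le_one hX0).2 hXlam
  have hexp := one_add_add_sq_div_four_le_exp habs
  have h1 := mul_le_mul_of_nonneg_left (slope_sub_ge hB hX hy h₁ h₂) hlam.le
  have h2 := mul_le_mul_of_nonneg_left (sq_slope_sub_ge (y := y) (D₂ := D₂) hB hX h₁)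
    (sq_nonneg lam)
  rw [← hs] at h1 h2
  have hsplit : Real.exp (lam * ((y + D₂) / (X + D₁))) =
      Real.exp (lam * (y / X)) * Real.exp (lam * s) := by
    rw [← Real.exp_add, hs]
    ring_nf
  have h16 : (X * D₂ - y * D₁) ^ 2 / (16 * X ^ 4) = (X * D₂ - y * D₁) ^ 2 / (4 * X ^ 4) / 4 := by
    rw [div_div]
    ring_nf
  have hG : 0 ≤ Λ * Real.exp (lam * (y / X)) := by positivity
  have := mul_le_mul_of_nonneg_left (a := Λ * Real.exp (lam * (y / X)))
    (b := lam * ((X * D₂ - y * D₁) / X ^ 2 - 2 * B ^ 2 * (1 + T) / X ^ 2) +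
      lam ^ 2 * ((X * D₂ - y * D₁) ^ 2 / (16 * X ^ 4)))
    (c := Real.exp (lam * s) - 1) (by rw [h16]; nlinarith) hG
  rw [logLyap, logLyap, hsplit]
  linarith

lemma abs_logLyap_sub_le (hB : 0 < B) (hX : 2 * B ≤ X) (hy : |y| ≤ T * X)
    (h₁ : |D₁| ≤ B) (h₂ : |D₂| ≤ B) (hlam : 0 < lam) (hΛ : 0 ≤ Λ)
    (hXlam : lam * (2 * B * (1 + T)) ≤ X) :
    |logLyap lam Λ (X + D₁) (y + D₂) - logLyap lam Λ X y| ≤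
      (2 * B + Λ * Real.exp (lam * T) * (2 * (lam * (2 * B * (1 + T))))) / X := by
  have hX0 : 0 < X := by linarith
  have hXD : X / 2 ≤ X + D₁ := by linarith [(abs_le.1 h₁).1]
  have hXD0 : 0 < X + D₁ := by linarith
  have hlog : |Real.log (X + D₁) - Real.log X| ≤ 2 * B / X := by
    rw [← Real.log_div hXD0.ne' hX0.ne', abs_le]
    constructor
    · refine le_trans ?_ (Real.one_sub_inv_le_log_of_pos (div_pos hXD0 hX0))
      rw [inv_div, neg_le_sub_iff_le_add, add_div' _ _ _ hX0.ne', div_le_div_iff₀ hXD0 hX0]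
      nlinarith [(abs_le.1 h₁).1]
    · refine (Real.log_le_sub_one_of_pos (div_pos hXD0 hX0)).trans ?_
      rw [sub_le_iff_le_add, div_add' _ _ _ hX0.ne']
      refine div_le_div_of_nonneg_right ?_ hX0.le
      linarith [(abs_le.1 h₁).2]
  set s := (y + D₂) / (X + D₁) - y / X with hs
  have hsX : |lam * s| ≤ lam * (2 * B * (1 + T)) / X := by
    rw [abs_mul, abs_of_pos hlam, mul_div_assoc]
    gcongr
    exact abs_slope_sub_le hB hX hy h₁ h₂
  have habs : |lam * s| ≤ 1 := hsX.trans ((div_le_one hX0).2 hXlam)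
  have hexp := (Real.abs_exp_sub_one_le habs).trans (mul_le_mul_of_nonneg_left hsX zero_le_two)
  have hsplit : Real.exp (lam * ((y + D₂) / (X + D₁))) =
      Real.exp (lam * (y / X)) * Real.exp (lam * s) := by
    rw [← Real.exp_add, hs]
    ring_nf
  have hyX : y / X ≤ T := (div_le_iff₀ hX0).2 ((le_abs_self y).trans hy)
  calc |logLyap lam Λ (X + D₁) (y + D₂) - logLyap lam Λ X y|
      = |(Real.log (X + D₁) - Real.log X) -
          Λ * Real.exp (lam * (y / X)) * (Real.exp (lam * s) - 1)| := by
        rw [logLyap, logLyap, hsplit]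
        ring_nf
    _ ≤ |Real.log (X + D₁) - Real.log X| +
          |Λ * Real.exp (lam * (y / X)) * (Real.exp (lam * s) - 1)| := abs_sub _ _
    _ = |Real.log (X + D₁) - Real.log X| +
          Λ * Real.exp (lam * (y / X)) * |Real.exp (lam * s) - 1| := by
        rw [abs_mul, abs_of_nonneg (by positivity : 0 ≤ Λ * Real.exp (lam * (y / X)))]
    _ ≤ 2 * B / X + Λ * Real.exp (lam * T) * (2 * (lam * (2 * B * (1 + T)) / X)) := by
        gcongr
    _ = _ := by ring

lemma exp_logLyap_le {δ C ε k : ℝ} (hB : 0 < B) (hX : 2 * B ≤ X) (hy : |y| ≤ T * X)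
    (h₁ : |D₁| ≤ B) (h₂ : |D₂| ≤ B) (hlam : 0 < lam) (hΛ : 0 ≤ Λ)
    (hXlam : lam * (2 * B * (1 + T)) ≤ X)
    (hC : C = 2 * B + Λ * Real.exp (lam * T) * (2 * (lam * (2 * B * (1 + T)))))
    (hXC : C ≤ X) (hδ : 0 < δ) (hδ1 : δ ≤ 1) (hε : ε * k ^ 2 * X ^ 2 ≤ (X * D₂ - y * D₁) ^ 2)
    {G : ℝ} (hG : G = Λ * Real.exp (lam * (y / X))) :
    Real.exp (δ * logLyap lam Λ (X + D₁) (y + D₂)) ≤ Real.exp (δ * logLyap lam Λ X y) *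
      (1 + (δ ^ 2 * C ^ 2 / X ^ 2 + δ * (G * lam * (2 * B ^ 2 * (1 + T)) / X ^ 2)) +
        δ * (1 / X + G * lam * y / X ^ 2) * D₁ + -(δ * (G * lam / X)) * D₂ -
        δ * (G * lam ^ 2 * k ^ 2 / (16 * X ^ 2)) * ε) := by
  have hX0 : 0 < X := by linarith
  have hG0 : 0 ≤ G := by rw [hG]; positivity
  have hup := logLyap_sub_le hB hX hy h₁ h₂ hlam hΛ hXlam
  have habs := abs_logLyap_sub_le hB hX hy h₁ h₂ hlam hΛ hXlam
  rw [← hC] at habs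
  rw [← hG] at hup
  set v := logLyap lam Λ (X + D₁) (y + D₂) - logLyap lam Λ X y with hv
  have hv1 : |δ * v| ≤ 1 := by
    rw [abs_mul, abs_of_pos hδ]
    exact mul_le_one₀ hδ1 (abs_nonneg _) (habs.trans ((div_le_one hX0).2 hXC))
  have hexp : Real.exp (δ * v) ≤ 1 + δ * v + (δ * v) ^ 2 := by
    linarith [(abs_le.1 (Real.abs_exp_sub_one_sub_id_le hv1)).2]
  have hv2 : (δ * v) ^ 2 ≤ δ ^ 2 * C ^ 2 / X ^ 2 := by
    rw [mul_pow, mul_div_assoc, ← div_pow, ← sq_abs v]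
    gcongr
  have hεN : δ * (G * lam ^ 2 * k ^ 2 / (16 * X ^ 2)) * ε ≤
      δ * (G * (lam ^ 2 * ((X * D₂ - y * D₁) ^ 2 / (16 * X ^ 4)))) := by
    calc δ * (G * lam ^ 2 * k ^ 2 / (16 * X ^ 2)) * ε
        = δ * (G * (lam ^ 2 * (ε * k ^ 2 * X ^ 2 / (16 * X ^ 4)))) := by
          field_simp
      _ ≤ _ := by gcongr
  have hsplit : Real.exp (δ * logLyap lam Λ (X + D₁) (y + D₂)) =
      Real.exp (δ * logLyap lam Λ X y) * Real.exp (δ * v) := by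
    rw [← Real.exp_add, hv]
    ring_nf
  rw [hsplit]
  refine mul_le_mul_of_nonneg_left ?_ (Real.exp_pos _).le
  have hup' := mul_le_mul_of_nonneg_left hup hδ.le
  have hid : δ * (D₁ / X - G * (lam * ((X * D₂ - y * D₁) / X ^ 2 - 2 * B ^ 2 * (1 + T) / X ^ 2) +
      lam ^ 2 * ((X * D₂ - y * D₁) ^ 2 / (16 * X ^ 4)))) =
      δ * (G * lam * (2 * B ^ 2 * (1 + T)) / X ^ 2) + δ * (1 / X + G * lam * y / X ^ 2) * D₁ +
        -(δ * (G * lam / X)) * D₂ -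
        δ * (G * (lam ^ 2 * ((X * D₂ - y * D₁) ^ 2 / (16 * X ^ 4)))) := by
    have h1 : X / X ^ 2 = 1 / X := by field_simp
    have h2 : (X * D₂ - y * D₁) / X ^ 2 = D₂ / X - y * D₁ / X ^ 2 := by
      rw [sub_div, mul_div_right_comm, h1, one_div_mul_eq_div]
    rw [h2]
    ring
  linarith

end increments

lemma drift_combination_le {X y G lam T δ C c d κ k e₁ e₂ s : ℝ} (hX0 : 0 < X) (hlam : 0 < lam)
    (hG : 0 < G) (hδ : 0 < δ) (hk : 0 < k) (hκ : 0 < κ) (hd : 0 < d) (hT : 0 < T)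
    (hδC : δ * C ^ 2 ≤ 1) (hGlam : d + 2 ≤ G * lam) (hy : |y| ≤ T * X)
    (hfst : |e₁| ≤ d / X) (hsnd : |e₂| ≤ d / X) (hs : κ ≤ s)
    (hlam_def : lam = 16 * (d * (1 + T) + c + 1) / (k ^ 2 * κ)) :
    1 + (δ ^ 2 * C ^ 2 / X ^ 2 + δ * (G * lam * c / X ^ 2)) +
      δ * (1 / X + G * lam * y / X ^ 2) * e₁ + -(δ * (G * lam / X)) * e₂ -
      δ * (G * lam ^ 2 * k ^ 2 / (16 * X ^ 2)) * s ≤ 1 - δ / X ^ 2 := by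
  obtain ⟨a, ha⟩ : ∃ a, a = δ * (1 / X + G * lam * y / X ^ 2) := ⟨_, rfl⟩
  obtain ⟨b, hb⟩ : ∃ b, b = -(δ * (G * lam / X)) := ⟨_, rfl⟩
  obtain ⟨q, hq⟩ : ∃ q, q = δ * (G * lam ^ 2 * k ^ 2 / (16 * X ^ 2)) := ⟨_, rfl⟩
  rw [← ha, ← hb, ← hq]
  have hGl : 0 < G * lam := by positivity
  have hae : a * e₁ ≤ δ * (d / X ^ 2 + G * lam * T * d / X ^ 2) := by
    have ha' : |a| ≤ δ * (1 / X + G * lam * T / X) := by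
      rw [ha, abs_mul, abs_of_pos hδ]
      refine mul_le_mul_of_nonneg_left ((abs_add_le _ _).trans (add_le_add ?_ ?_)) hδ.le
      · rw [abs_of_pos (by positivity)]
      · rw [abs_div, abs_mul, abs_of_pos hGl, abs_of_pos (by positivity : 0 < X ^ 2),
          div_le_div_iff₀ (by positivity) hX0]
        nlinarith [mul_le_mul_of_nonneg_left hy (mul_pos hGl hX0).le]
    calc a * e₁ ≤ |a| * |e₁| := by
          rw [← abs_mul]
          exact le_abs_self _
      _ ≤ δ * (1 / X + G * lam * T / X) * (d / X) := by gcongr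
      _ = _ := by
          field_simp
  have hbe : b * e₂ ≤ δ * (G * lam * d / X ^ 2) := by
    have : -e₂ ≤ d / X := (neg_le_abs _).trans hsnd
    calc b * e₂ = δ * (G * lam / X) * (-e₂) := by rw [hb]; ring
      _ ≤ δ * (G * lam / X) * (d / X) := by gcongr
      _ = _ := by
          field_simp
  have hqe : δ * (G * lam * (d * (1 + T) + c + 1) / X ^ 2) ≤ q * s := by
    have hlam' : d * (1 + T) + c + 1 = lam * (k ^ 2 * κ) / 16 := by
      rw [hlam_def]
      field_simp
    have hq0 : 0 ≤ q := by
      rw [hq]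
      positivity
    calc _ = q * κ := by
          rw [hq, hlam']
          field_simp
      _ ≤ q * s := by
          gcongr
  have hfinal : δ * (δ * C ^ 2 + G * lam * c + d + G * lam * T * d + G * lam * d -
      G * lam * (d * (1 + T) + c + 1)) / X ^ 2 ≤ δ * (-1) / X ^ 2 := by
    gcongr
    nlinarith
  have hid : δ * (δ * C ^ 2 + G * lam * c + d + G * lam * T * d + G * lam * d -
      G * lam * (d * (1 + T) + c + 1)) / X ^ 2 =
      δ ^ 2 * C ^ 2 / X ^ 2 + δ * (G * lam * c / X ^ 2) +
        δ * (d / X ^ 2 + G * lam * T * d / X ^ 2) + δ * (G * lam * d / X ^ 2) -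
        δ * (G * lam * (d * (1 + T) + c + 1) / X ^ 2) := by
    ring
  have hneg : δ * (-1) / X ^ 2 = -(δ / X ^ 2) := by ring
  linarith

/-- Far from the origin, `exp (δ * logLyap)` has negative mean increments under any averaging
operator `L` with bounded range, drift of order `1 / x` and a vertical jump. -/
lemma exists_logLyap_drift {B d κ k T : ℝ} (hB : 0 < B) (hd : 0 < d) (hκ : 0 < κ) (hk : 0 < k)
    (hT : 0 < T) :
    ∃ lam Λ δ R : ℝ, 0 < lam ∧ 0 < Λ ∧ 0 < δ ∧ δ ≤ 1 ∧ 2 * B ≤ R ∧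
      ∀ (L : (ℤ × ℤ → ℝ) →ₗ[ℝ] ℝ) (x x' : ℤ × ℤ), R ≤ x.1 → |(x.2 : ℝ)| ≤ T * x.1 →
        (x'.1 : ℝ) = x.1 → (x'.2 : ℝ) - x.2 = k → L 1 = 1 →
        (∀ f g : ℤ × ℤ → ℝ,
          (∀ z : ℤ × ℤ, |(z.1 : ℝ) - x.1| ≤ B → |(z.2 : ℝ) - x.2| ≤ B → f z ≤ g z) →
          L f ≤ L g) →
        |L (fun z => (z.1 : ℝ)) - x.1| ≤ d / x.1 → |L (fun z => (z.2 : ℝ)) - x.2| ≤ d / x.1 →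
        κ ≤ L (Pi.single x' 1) →
        L (fun z => Real.exp (δ * logLyap lam Λ z.1 z.2)) ≤
          Real.exp (δ * logLyap lam Λ x.1 x.2) * (1 - δ / x.1 ^ 2) := by
  set c := 2 * B ^ 2 * (1 + T) with hc
  set lam := 16 * (d * (1 + T) + c + 1) / (k ^ 2 * κ) with hlam_def
  have hlam : 0 < lam := by positivity
  set Λ := (d + 2) * Real.exp (lam * T) / lam with hΛ_def
  have hΛ : 0 < Λ := by positivity
  set C := 2 * B + Λ * Real.exp (lam * T) * (2 * (lam * (2 * B * (1 + T)))) with hC_def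
  have hC : 0 < C := by positivity
  have hC2 : 0 < C ^ 2 + 1 := by positivity
  refine ⟨lam, Λ, 1 / (C ^ 2 + 1), 2 * B + lam * (2 * B * (1 + T)) + C, hlam, hΛ, by positivity,
    (div_le_one hC2).2 (by nlinarith), ?_, ?_⟩
  · have : 0 < lam * (2 * B * (1 + T)) := by positivity
    linarith
  set δ := 1 / (C ^ 2 + 1) with hδ_def
  have hδ : 0 < δ := by positivity
  have hδ1 : δ ≤ 1 := (div_le_one hC2).2 (by nlinarith)
  have hδC : δ * C ^ 2 ≤ 1 := by
    rw [hδ_def, one_div, inv_mul_le_one₀ hC2]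
    linarith
  intro L x x' hR hy hx'1 hx'2 hL1 hmono hfst hsnd hsingle
  set X := (x.1 : ℝ) with hX_def
  set y := (x.2 : ℝ) with hy_def
  have hpos : 0 < lam * (2 * B * (1 + T)) := by positivity
  have hX2 : 2 * B ≤ X := by linarith
  have hXlam : lam * (2 * B * (1 + T)) ≤ X := by linarith
  have hXC : C ≤ X := by linarith
  have hX0 : 0 < X := by linarith
  set G := Λ * Real.exp (lam * (y / X)) with hG_def
  have hG : 0 < G := by positivity
  have hGlam : d + 2 ≤ G * lam := by
    have hyX : -T ≤ y / X := (le_div_iff₀ hX0).2 (by nlinarith [(abs_le.1 hy).1])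
    have : 1 ≤ Real.exp (lam * T) * Real.exp (lam * (y / X)) := by
      rw [← Real.exp_add]
      exact Real.one_le_exp (by nlinarith)
    calc d + 2 ≤ (d + 2) * (Real.exp (lam * T) * Real.exp (lam * (y / X))) :=
          le_mul_of_one_le_right (by linarith) this
      _ = G * lam := by
          rw [hG_def, hΛ_def]
          field_simp
  set e : ℤ × ℤ → ℝ := Pi.single x' 1 with he
  set a := δ * (1 / X + G * lam * y / X ^ 2) with ha
  set b := -(δ * (G * lam / X)) with hb
  set q := δ * (G * lam ^ 2 * k ^ 2 / (16 * X ^ 2)) with hq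
  set β := δ ^ 2 * C ^ 2 / X ^ 2 + δ * (G * lam * c / X ^ 2) with hβ
  set E := Real.exp (δ * logLyap lam Λ X y) with hE
  set h : ℤ × ℤ → ℝ := E • ((1 + β - a * X - b * y) • (1 : ℤ × ℤ → ℝ) +
    a • (fun z : ℤ × ℤ => (z.1 : ℝ)) + b • (fun z : ℤ × ℤ => (z.2 : ℝ)) - q • e) with hh
  have hle : L (fun z => Real.exp (δ * logLyap lam Λ z.1 z.2)) ≤ L h := by
    refine hmono _ _ fun z hz1 hz2 => ?_
    obtain ⟨D₁, hD₁⟩ : ∃ D₁, D₁ = (z.1 : ℝ) - X := ⟨_, rfl⟩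
    obtain ⟨D₂, hD₂⟩ : ∃ D₂, D₂ = (z.2 : ℝ) - y := ⟨_, rfl⟩
    rw [← hD₁] at hz1
    rw [← hD₂] at hz2
    have hz1' : (z.1 : ℝ) = X + D₁ := by linarith
    have hz2' : (z.2 : ℝ) = y + D₂ := by linarith
    have hez : e z * k ^ 2 * X ^ 2 ≤ (X * D₂ - y * D₁) ^ 2 := by
      rw [he, Pi.single_apply]
      split_ifs with hz
      · have h1 : D₁ = 0 := by rw [hD₁, hz, hx'1, sub_self]
        have h2 : D₂ = k := by rw [hD₂, hz, hx'2]
        rw [h1, h2]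
        exact le_of_eq (by ring)
      · simpa using sq_nonneg (X * D₂ - y * D₁)
    have hval : h z = E * (1 + β + a * D₁ + b * D₂ - q * e z) := by
      simp only [hh, Pi.smul_apply, Pi.sub_apply, Pi.add_apply, Pi.one_apply, smul_eq_mul, hz1',
        hz2']
      ring
    rw [hval, hz1', hz2']
    exact exp_logLyap_le hB hX2 hy hz1 hz2 hlam hΛ.le hXlam hC_def hXC hδ hδ1 hez hG_def
  refine hle.trans ?_
  rw [hh]
  simp only [map_smul, map_add, map_sub, hL1, smul_eq_mul, mul_one]
  refine mul_le_mul_of_nonneg_left ?_ (Real.exp_pos _).le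
  set e₁ := L (fun z => (z.1 : ℝ)) - X with he₁
  set e₂ := L (fun z => (z.2 : ℝ)) - y with he₂
  have hlhs : (1 + β - a * X - b * y) + a * L (fun z => (z.1 : ℝ)) +
      b * L (fun z => (z.2 : ℝ)) - q * L e = 1 + β + a * e₁ + b * e₂ - q * L e := by
    rw [he₁, he₂]
    ring
  rw [hlhs]
  exact drift_combination_le hX0 hlam hG hδ hk hκ hd hT hδC hGlam hy hfst hsnd hsingle hlam_def

lemma exp_logLyap_eq {γ lam Λ X y : ℝ} (hX : 0 < X) :
    Real.exp (2 * γ * logLyap lam Λ X y) =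
      (X ^ 2) ^ γ * Real.exp (-(2 * γ * (Λ * Real.exp (lam * (y / X))))) := by
  rw [Real.rpow_def_of_pos (by positivity), Real.log_pow, ← Real.exp_add, logLyap]
  congr 1
  push_cast
  ring

/-- A nonnegative function with negative mean increments throughout the cone `|y| ≤ T x`. -/
lemma exists_lyapunov {B d κ T R₀ : ℝ} {k : ℕ} (hB : 0 < B) (hd : 0 < d) (hκ : 0 < κ)
    (hk : 0 < k) (hT : 0 < T) :
    ∃ (F : ℤ × ℤ → ℝ) (γ A c : ℝ), 0 < γ ∧ γ < 1 ∧ 0 < A ∧ 0 < c ∧ (∀ z, 0 ≤ F z) ∧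
      (∀ z : ℤ × ℤ, 0 < z.1 → |(z.2 : ℝ)| ≤ T * z.1 → ((z.1 : ℝ) ^ 2) ^ γ ≤ A * F z) ∧
      ∀ (L : (ℤ × ℤ → ℝ) →ₗ[ℝ] ℝ) (x : ℤ × ℤ), 0 < x.1 → |(x.2 : ℝ)| ≤ T * x.1 → L 1 = 1 →
        (∀ f g : ℤ × ℤ → ℝ,
          (∀ z : ℤ × ℤ, |(z.1 : ℝ) - x.1| ≤ B → |(z.2 : ℝ) - x.2| ≤ B → f z ≤ g z) →
          L f ≤ L g) →
        (R₀ ≤ x.1 → |L (fun z => (z.1 : ℝ)) - x.1| ≤ d / x.1) →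
        (R₀ ≤ x.1 → |L (fun z => (z.2 : ℝ)) - x.2| ≤ d / x.1) →
        κ ≤ L (Pi.single (x + (0, (k : ℤ))) 1) → κ ≤ L (Pi.single (x + (-(k : ℤ), 0)) 1) →
        L F + c * ((x.1 : ℝ) ^ 2) ^ (γ - 1) ≤ F x := by
  have hk' : (0 : ℝ) < k := by exact_mod_cast hk
  obtain ⟨lam, Λ, δ, R₁, hlam, hΛ, hδ, hδ1, hR₁, hfar⟩ := exists_logLyap_drift hB hd hκ hk' hT
  obtain ⟨γ, rfl⟩ : ∃ γ, δ = 2 * γ := ⟨δ / 2, by ring⟩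
  set R := max R₀ R₁ with hR
  set s := 2 / (κ * k) with hs_def
  have hs : 0 < s := by positivity
  set K := Real.exp (R + B) with hK_def
  set M := (K + 1) * Real.exp (s * R) with hM_def
  have hM : 0 < M := by positivity
  set η := Real.exp (-(2 * γ * (Λ * Real.exp (lam * T)))) with hη_def
  have hη : 0 < η := Real.exp_pos _
  set f : ℤ × ℤ → ℝ := fun z => Real.exp (2 * γ * logLyap lam Λ z.1 z.2) with hf
  set g : ℤ × ℤ → ℝ := fun z => Real.exp (-(s * z.1)) with hg
  have hfη : ∀ z : ℤ × ℤ, 0 < z.1 → |(z.2 : ℝ)| ≤ T * z.1 →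
      ((z.1 : ℝ) ^ 2) ^ γ * η ≤ f z := by
    intro z hz hz2
    have hz' : (0 : ℝ) < z.1 := by exact_mod_cast hz
    change _ ≤ Real.exp (2 * γ * logLyap lam Λ z.1 z.2)
    rw [exp_logLyap_eq hz', hη_def]
    have : (z.2 : ℝ) / z.1 ≤ T := (div_le_iff₀ hz').2 ((le_abs_self _).trans hz2)
    gcongr
  have hFf : ∀ z, f z ≤ f z + M * max 0 (Real.exp (s * B) - g z) := fun z =>
    le_add_of_nonneg_right (mul_nonneg hM.le (le_max_left _ _))
  refine ⟨fun z => f z + M * max 0 (Real.exp (s * B) - g z), γ, 1 / η, min (2 * γ * η) 1,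
    by linarith, by linarith, by positivity, by positivity,
    fun z => (Real.exp_pos _).le.trans (hFf z), ?_, ?_⟩
  · intro z hz hz2
    rw [one_div_mul_eq_div, le_div_iff₀ hη]
    exact (hfη z hz hz2).trans (hFf z)
  intro L x hx hy hL1 hmono hfst hsnd hup hleft
  have hx0 : (0 : ℝ) < x.1 := by exact_mod_cast hx
  have hx1 : (1 : ℝ) ≤ x.1 := by exact_mod_cast hx
  have hFx : max 0 (Real.exp (s * B) - g x) = Real.exp (s * B) - g x := by
    refine max_eq_right (sub_nonneg.2 (Real.exp_le_exp.2 ?_))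
    nlinarith
  have hLF : L (fun z => f z + M * max 0 (Real.exp (s * B) - g z)) ≤
      L f + M * (Real.exp (s * B) - L g) := by
    calc _ ≤ L (f + M • (Real.exp (s * B) • (1 : ℤ × ℤ → ℝ) - g)) := by
          refine hmono _ _ fun z hz1 _ => ?_
          have : max 0 (Real.exp (s * B) - g z) = Real.exp (s * B) - g z := by
            refine max_eq_right (sub_nonneg.2 (Real.exp_le_exp.2 ?_))
            nlinarith [(abs_le.1 hz1).1]
          simp [this]
      _ = _ := by simp [hL1]
  have hLg : 2 * g x ≤ L g := by
    set e : ℤ × ℤ → ℝ := Pi.single (x + (-(k : ℤ), 0)) 1 with he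
    have hexp : 2 ≤ κ * Real.exp (s * k) := by
      have h1 : κ * (s * k) = 2 := by
        rw [hs_def]
        field_simp
      nlinarith [Real.add_one_le_exp (s * k)]
    calc 2 * g x ≤ κ * Real.exp (s * k) * g x :=
          mul_le_mul_of_nonneg_right hexp (Real.exp_pos _).le
      _ = Real.exp (s * k) * g x * κ := by ring
      _ ≤ Real.exp (s * k) * g x * L e :=
          mul_le_mul_of_nonneg_left hleft (mul_pos (Real.exp_pos _) (Real.exp_pos _)).le
      _ = L ((Real.exp (s * k) * g x) • e) := by rw [map_smul, smul_eq_mul]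
      _ ≤ L g := by
          refine hmono _ _ fun z _ _ => ?_
          simp only [he, Pi.smul_apply, smul_eq_mul, Pi.single_apply]
          split_ifs with hz
          · rw [hz, mul_one, hg, ← Real.exp_add]
            refine Real.exp_le_exp.2 (le_of_eq ?_)
            push_cast [Prod.fst_add]
            ring
          · simpa using (Real.exp_pos _).le
  have hgx : 0 < M * g x := mul_pos hM (Real.exp_pos _)
  have hMLg := mul_le_mul_of_nonneg_left hLg hM.le
  rw [mul_left_comm] at hMLg
  have hpow : ((x.1 : ℝ) ^ 2) ^ (γ - 1) = ((x.1 : ℝ) ^ 2) ^ γ / (x.1 : ℝ) ^ 2 :=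
    Real.rpow_sub_one (by positivity) γ
  have hpow0 : 0 < ((x.1 : ℝ) ^ 2) ^ (γ - 1) := by positivity
  simp only [hFx]
  rw [mul_sub] at hLF ⊢
  refine (add_le_add_left hLF _).trans ?_
  rcases le_or_gt R x.1 with hxR | hxR
  · have hLf := hfar L x (x + (0, (k : ℤ))) ((le_max_right _ _).trans hxR) hy (by simp) (by simp)
      hL1 hmono (hfst ((le_max_left _ _).trans hxR)) (hsnd ((le_max_left _ _).trans hxR)) hup
    have hdrop : min (2 * γ * η) 1 * ((x.1 : ℝ) ^ 2) ^ (γ - 1) ≤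
        f x * (2 * γ / (x.1 : ℝ) ^ 2) := by
      calc _ ≤ 2 * γ * η * ((x.1 : ℝ) ^ 2) ^ (γ - 1) := by
            gcongr
            exact min_le_left _ _
        _ = ((x.1 : ℝ) ^ 2) ^ γ * η * (2 * γ / (x.1 : ℝ) ^ 2) := by
            rw [hpow]
            ring
        _ ≤ _ := by
            gcongr
            exact hfη x hx hy
    change L f ≤ f x * _ at hLf
    rw [mul_sub, mul_one] at hLf
    linarith
  · have hLf : L f ≤ K := by
      calc L f ≤ L (K • (1 : ℤ × ℤ → ℝ)) := by
            refine hmono _ _ fun z hz1 _ => ?_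
            simp only [hf, Pi.smul_apply, Pi.one_apply, smul_eq_mul, mul_one, hK_def]
            refine Real.exp_le_exp.2 ?_
            have h1 : Real.log z.1 ≤ |(z.1 : ℝ)| := by
              rw [← Real.log_abs]
              exact Real.log_le_self (abs_nonneg _)
            have h2 : |(z.1 : ℝ)| ≤ R + B :=
              abs_le.2 ⟨by linarith [(abs_le.1 hz1).1], by linarith [(abs_le.1 hz1).2]⟩
            have h3 : logLyap lam Λ z.1 z.2 ≤ |(z.1 : ℝ)| := by
              have : 0 < Λ * Real.exp (lam * ((z.2 : ℝ) / z.1)) := by positivity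
              rw [logLyap]
              linarith
            calc 2 * γ * logLyap lam Λ z.1 z.2 ≤ 2 * γ * |(z.1 : ℝ)| := by gcongr
              _ ≤ 1 * |(z.1 : ℝ)| := by gcongr
              _ ≤ R + B := by linarith
        _ = K := by simp [hL1]
    have hMg : K + 1 ≤ M * g x := by
      rw [hM_def, hg, mul_assoc, ← Real.exp_add]
      refine le_mul_of_one_le_right (by positivity) (Real.one_le_exp ?_)
      nlinarith
    have hdrop : min (2 * γ * η) 1 * ((x.1 : ℝ) ^ 2) ^ (γ - 1) ≤ 1 := by
      refine mul_le_one₀ (min_le_right _ _) hpow0.le ?_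
      exact Real.rpow_le_one_of_one_le_of_nonpos (one_le_pow₀ hx1) (by linarith)
    have hfx : 0 < f x := Real.exp_pos _
    linarith

/-! ### Exit from the wedge -/

lemma mem_Wset_cone {b α : ℝ} (hα0 : 0 < α) (hα2 : α < Real.pi / 2) {x : ℤ × ℤ}
    (hx : x ∈ Wset b α) : 0 < x.1 ∧ |(x.2 : ℝ)| ≤ 1 / Real.cos α * x.1 := by
  have hcos : 0 < Real.cos α := Real.cos_pos_of_mem_Ioo ⟨by linarith, hα2⟩
  rcases hx with ⟨-, h⟩ | ⟨h, -⟩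
  · refine ⟨?_, ?_⟩
    · exact_mod_cast (mul_nonneg (Real.sqrt_nonneg _) hcos.le).trans_lt h
    · rw [one_div_mul_eq_div, le_div_iff₀ hcos]
      exact (mul_le_mul_of_nonneg_right (abs_snd_le_znorm x) hcos.le).trans h.le
  · linarith [Real.pi_pos]

lemma mean_drift_le {p : ℤ × ℤ → ℤ × ℤ → ℝ} {S V : Set (ℤ × ℤ)} {N n₀ : ℕ} {C₁ r₀ : ℝ}
    (hC₁ : 0 < C₁) (hVS : V ⊆ S)
    (hdrift : ∀ x ∈ S, r₀ ≤ znorm x → muNorm p x ≤ C₁ / znorm x) {x : ℤ × ℤ}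
    (hx0 : 0 < x.1) (hx : 2 * (n₀ * N : ℝ) + 2 * r₀ ≤ x.1) (hr₀ : 0 < r₀) {z : ℤ × ℤ} (hz : z ∈ V)
    (hzx : z - x ∈ jumpBox (n₀ * N)) : muNorm p z ≤ 2 * C₁ / x.1 := by
  have hx0' : (0 : ℝ) < x.1 := by exact_mod_cast hx0
  have h1 : |(z.1 : ℝ) - x.1| ≤ n₀ * N := by exact_mod_cast (mem_jumpBox.1 hzx).1
  have h0 : (0 : ℝ) ≤ n₀ * N := by positivity
  have hzn : (x.1 : ℝ) / 2 ≤ znorm z := by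
    refine le_trans ?_ ((le_abs_self _).trans (abs_fst_le_znorm z))
    linarith [(abs_le.1 h1).1]
  calc muNorm p z ≤ C₁ / znorm z := hdrift z (hVS hz) (by linarith)
    _ ≤ C₁ / ((x.1 : ℝ) / 2) := by gcongr
    _ = 2 * C₁ / x.1 := by field_simp

lemma transOp_pow_drift {p : ℤ × ℤ → ℤ × ℤ → ℝ} {V : Set (ℤ × ℤ)} {N n : ℕ}
    (hp : ∀ x y, 0 ≤ p x y) (hsum : ∀ x, ∑ y ∈ jumpBox N, p x y = 1)
    (hV : ClosedUnder p V) {f m : ℤ × ℤ → ℝ} (hf : ∀ z, transOp p N f z = f z + m z)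
    (hm : ∀ z, |m z| ≤ muNorm p z) {x : ℤ × ℤ} (hx : x ∈ V) {ε : ℝ}
    (hε : ∀ z ∈ V, z - x ∈ jumpBox (n * N) → muNorm p z ≤ ε) :
    |(transOp p N ^ n) f x - f x| ≤ n * ε := by
  have hmε := fun z hz hzx => (hm z).trans (hε z hz hzx)
  rw [abs_sub_le_iff]
  constructor
  · rw [sub_le_iff_le_add']
    refine transOp_pow_le_add hp hsum hV n hx fun z hz hzx => ?_
    linarith [hf z, (abs_le.1 (hmε z hz hzx)).2]
  · rw [sub_le_comm]
    refine transOp_pow_ge_sub hp hsum hV n hx fun z hz hzx => ?_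
    linarith [hf z, (abs_le.1 (hmε z hz hzx)).1]

lemma subset_staysIn {Ω : Type*} {ξ : ℕ → Ω → ℤ × ℤ} {W : Set (ℤ × ℤ)} {n : ℕ} (hn : 0 < n)
    {t : ℝ} (ht : 0 < t) (x : ℤ × ℤ) :
    {ω | ENNReal.ofReal t < exitTime W ξ ω} ∩ {ω | ξ 0 ω = x} ⊆
      staysIn ξ n W x ⌊t / n⌋₊ := by
  rintro ω ⟨hω, h0⟩
  refine ⟨h0, fun i hi => ?_⟩
  by_contra hi'
  refine absurd (show ENNReal.ofReal t < exitTime W ξ ω from hω) (not_lt.2 ?_)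
  refine (iInf₂_le (i * n) hi').trans ?_
  rw [← ENNReal.ofReal_natCast]
  refine ENNReal.ofReal_le_ofReal ?_
  have hn' : (0 : ℝ) < n := by exact_mod_cast hn
  have h1 : (i : ℝ) ≤ t / n := (Nat.le_floor_iff (by positivity)).1 hi
  push_cast
  exact (le_div_iff₀ hn').1 h1

/-- A level `K` separates the two regimes of the Lyapunov function. -/
lemma one_le_rpow_add_rpow {γ r K : ℝ} (hγ0 : 0 < γ) (hγ1 : γ < 1) (hr : 0 < r) (hK : 0 < K) :
    1 ≤ K ^ (-γ) * r ^ γ + K ^ (1 - γ) * r ^ (γ - 1) := by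
  have h1 : K ^ (-γ) * r ^ γ = (r / K) ^ γ := by
    rw [Real.div_rpow hr.le hK.le, Real.rpow_neg hK.le]
    ring
  have h2 : K ^ (1 - γ) * r ^ (γ - 1) = (K / r) ^ (1 - γ) := by
    rw [Real.div_rpow hK.le hr.le, ← neg_sub 1 γ, Real.rpow_neg hr.le]
    ring
  rw [h1, h2]
  rcases le_total K r with h | h
  · have := Real.one_le_rpow ((one_le_div hK).2 h) hγ0.le
    have : 0 ≤ (K / r) ^ (1 - γ) := by positivity
    linarith
  · have := Real.one_le_rpow ((one_le_div hr).2 h) (sub_nonneg.2 hγ1.le)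
    have : 0 ≤ (r / K) ^ γ := by positivity
    linarith

/-- Lemma 4.1: under (A1), (A2) and drift `‖μ(x)‖ = O(‖x‖⁻¹)`,
for `α ∈ (0,π/2)` there is `γ > 0` (independent of the starting point) such that for
every `x ∈ W(α)` there is `C > 0` with `P[τ_α > t ∣ ξ₀ = x] ≤ C t^{-γ}` for all `t > 0`. -/
theorem exit_time_tail_bound
    {Ω : Type*} [MeasurableSpace Ω] (P : Measure Ω) [IsProbabilityMeasure P]
    (S : Set (ℤ × ℤ)) (hSunb : ∀ R : ℝ, ∃ x ∈ S, R < znorm x)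
    (ξ : ℕ → Ω → ℤ × ℤ) (hmeas : ∀ t, Measurable (ξ t))
    (hinS : ∀ t, ∀ᵐ ω ∂P, ξ t ω ∈ S)
    (p : ℤ × ℤ → ℤ × ℤ → ℝ) (hpmf : IsJumpPMF p)
    (hMarkov : IsMarkovWith P ξ p)
    (κ : ℝ) (k n₀ : ℕ) (hκ : 0 < κ) (hk : 0 < k) (hn₀ : 0 < n₀)
    (hA1 : A1 P S ξ κ k n₀)
    (b : ℝ) (hb : 0 < b) (hA2 : A2 p b)
    (C₁ r₀ : ℝ) (hC₁ : 0 < C₁) (hr₀ : 0 < r₀)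
    (hdrift : ∀ x ∈ S, r₀ ≤ znorm x → muNorm p x ≤ C₁ / znorm x)
    (α : ℝ) (hα0 : 0 < α) (hα2 : α < Real.pi / 2) :
    ∃ γ : ℝ, 0 < γ ∧ ∀ x ∈ Wset b α, ∃ C : ℝ, 0 < C ∧ ∀ t : ℝ, 0 < t →
      P ({ω | ENNReal.ofReal t < exitTime (Wset b α) ξ ω} ∩ {ω | ξ 0 ω = x}) ≤
        ENNReal.ofReal (C * t ^ (-γ)) * P {ω | ξ 0 ω = x} := by
  set N := ⌈b⌉₊ with hN_def
  have hN : b ≤ N := Nat.le_ceil b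
  have hN0 : 0 < N := Nat.ceil_pos.2 hb
  have hp := hpmf.1
  have hsupp : ∀ x, ∀ y ∉ jumpBox N, p x y = 0 := fun x y =>
    hA2.eq_zero_of_notMem_jumpBox hN x
  have hsum : ∀ x, ∑ y ∈ jumpBox N, p x y = 1 := fun x =>
    (hasSum_sum_of_ne_finset_zero (hsupp x)).unique (hpmf.2 x)
  have hV := closedUnder_visited hp hMarkov
  have hVS := visited_subset hinS
  have hcos : 0 < Real.cos α := Real.cos_pos_of_mem_Ioo ⟨by linarith, hα2⟩
  have hn₀' : (0 : ℝ) < n₀ := by exact_mod_cast hn₀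
  have hN0' : (0 : ℝ) < N := by exact_mod_cast hN0
  obtain ⟨F, γ, A, c, hγ0, hγ1, hA, hc, hF0, hFA, hFL⟩ :=
    exists_lyapunov (B := n₀ * N) (d := n₀ * (2 * C₁)) (κ := κ) (T := 1 / Real.cos α)
      (R₀ := 2 * (n₀ * N : ℝ) + 2 * r₀) (k := k) (by positivity) (by positivity) hκ hk
      (by positivity)
  have hdecr : ∀ x ∈ Wset b α, x ∈ visited P ξ →
      (transOp p N ^ n₀) F x + c * ((x.1 : ℝ) ^ 2) ^ (γ - 1) ≤ F x := by
    intro x hxW hxV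
    obtain ⟨hx0, hx2⟩ := mem_Wset_cone hα0 hα2 hxW
    have hmu1 : ∀ z, |mu1 p z| ≤ muNorm p z := fun z =>
      Real.abs_le_sqrt (le_add_of_nonneg_right (sq_nonneg _))
    have hmu2 : ∀ z, |mu2 p z| ≤ muNorm p z := fun z =>
      Real.abs_le_sqrt (le_add_of_nonneg_left (sq_nonneg _))
    refine hFL ((LinearMap.proj x).comp (transOp p N ^ n₀)) x hx0 hx2 ?_ ?_ ?_ ?_ ?_ ?_
    · simp [transOp_pow_one hsum]
    · intro f g hfg
      refine transOp_pow_mono hp hV n₀ hxV fun z _ hzx => hfg z ?_ ?_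
      · exact_mod_cast (mem_jumpBox.1 hzx).1
      · exact_mod_cast (mem_jumpBox.1 hzx).2
    · intro hR
      rw [mul_div_assoc]
      exact transOp_pow_drift hp hsum hV (transOp_fst hsum hsupp) hmu1 hxV fun z hz hzx =>
        mean_drift_le hC₁ hVS hdrift hx0 hR hr₀ hz hzx
    · intro hR
      rw [mul_div_assoc]
      exact transOp_pow_drift hp hsum hV (transOp_snd hsum hsupp) hmu2 hxV fun z hz hzx =>
        mean_drift_le hC₁ hVS hdrift hx0 hR hr₀ hz hzx
    · exact hA1.le_transOp_pow hmeas hMarkov hp hsupp (hVS hxV) hxV (by simp)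
    · exact hA1.le_transOp_pow hmeas hMarkov hp hsupp (hVS hxV) hxV (by simp)
  refine ⟨γ, hγ0, fun x hx => ⟨(A + 1 / c) * n₀ ^ γ * F x + 1, ?_, fun t ht => ?_⟩⟩
  · have := hF0 x
    positivity
  set J := ⌊t / n₀⌋₊ with hJ
  set K : ℝ := ((J + 1 : ℕ) : ℝ) with hK_def
  have hK : 0 < K := by positivity
  have hKt : t / n₀ ≤ K := by
    rw [hK_def]
    push_cast
    exact (Nat.lt_floor_add_one _).le
  have hstay := measure_staysIn_le (n := n₀) (W := Wset b α) hmeas hMarkov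
    (F := fun z => ENNReal.ofReal (F z))
    (D := fun z => ENNReal.ofReal (c * ((z.1 : ℝ) ^ 2) ^ (γ - 1)))
    (a := ENNReal.ofReal (A * K ^ (-γ))) (c := ENNReal.ofReal (1 / c * K ^ (1 - γ)))
    (fun z hzW hzV => by
      rw [transOpENN_iterate_ofReal hp hsupp n₀ hF0,
        ← ENNReal.ofReal_add (transOp_pow_nonneg hp n₀ hF0 z) (by positivity)]
      exact ENNReal.ofReal_le_ofReal (hdecr z hzW hzV))
    (fun z hzW hzV => by
      obtain ⟨hz0, hz2⟩ := mem_Wset_cone hα0 hα2 hzW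
      have hz0' : (0 : ℝ) < z.1 := by exact_mod_cast hz0
      have hFz := hF0 z
      rw [← ENNReal.ofReal_mul (by positivity), ← ENNReal.ofReal_mul (by positivity),
        ← ENNReal.ofReal_add (by positivity) (by positivity), ENNReal.one_le_ofReal]
      refine (one_le_rpow_add_rpow hγ0 hγ1 (pow_pos hz0' 2) hK).trans (add_le_add ?_ ?_)
      · calc K ^ (-γ) * ((z.1 : ℝ) ^ 2) ^ γ ≤ K ^ (-γ) * (A * F z) := by
              gcongr
              exact hFA z hz0 hz2
          _ = A * K ^ (-γ) * F z := by ring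
      · exact le_of_eq (by field_simp)) x J
  have hcoef : ((J + 1 : ℕ) : ℝ≥0∞) * ENNReal.ofReal (A * K ^ (-γ)) +
      ENNReal.ofReal (1 / c * K ^ (1 - γ)) =
      ((J + 1 : ℕ) : ℝ≥0∞) * ENNReal.ofReal ((A + 1 / c) * K ^ (-γ)) := by
    rw [← ENNReal.ofReal_natCast, ← hK_def, ← ENNReal.ofReal_mul hK.le,
      ← ENNReal.ofReal_mul hK.le, ← ENNReal.ofReal_add (by positivity) (by positivity),
      sub_eq_add_neg, Real.rpow_add hK, Real.rpow_one]
    ring_nf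
  rw [hcoef, mul_assoc, ENNReal.mul_le_mul_iff_right (by simp) (ENNReal.natCast_ne_top _)]
    at hstay
  refine (measure_mono (subset_staysIn hn₀ ht x)).trans (hstay.trans ?_)
  rw [← mul_assoc, ← ENNReal.ofReal_mul (by positivity)]
  refine mul_le_mul_left (ENNReal.ofReal_le_ofReal ?_) _
  have hKγ : K ^ (-γ) ≤ n₀ ^ γ * t ^ (-γ) := by
    calc K ^ (-γ) ≤ (t / n₀) ^ (-γ) :=
          Real.rpow_le_rpow_of_nonpos (by positivity) hKt (by linarith)
      _ = n₀ ^ γ * t ^ (-γ) := by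
          rw [Real.div_rpow ht.le hn₀'.le, Real.rpow_neg hn₀'.le, div_inv_eq_mul, mul_comm]
  have hFx := hF0 x
  calc (A + 1 / c) * K ^ (-γ) * F x ≤ (A + 1 / c) * (n₀ ^ γ * t ^ (-γ)) * F x := by gcongr
    _ = ((A + 1 / c) * n₀ ^ γ * F x) * t ^ (-γ) := by ring
    _ ≤ _ := mul_le_mul_of_nonneg_right (by linarith) (by positivity)
end

section
/- Suppose (A1), (A2) and ‖μ(x)‖ = O(‖x‖^{−1}) as ‖x‖ → ∞ all hold, and fix i ∈ {1,…,7} and h ∈ (0,∞). Then there exist δ > 0 and N₀ ∈ ℕ such that for every N ≥ N₀ and all y, z ∈ ℤ with |y| ≤ 2hN and |z| ≤ b: P[Ξ hits U₂(N) before U₁(N) | ξ₀ = (N+z)q_i + y q_i⊥] ≥ δ. -/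
open MeasureTheory
open scoped ENNReal

/-- The lattice directions `q₁,…,q₇`. -/
def qv : ℕ → ℤ × ℤ
  | 1 => (-1, -1)
  | 2 => (0, -1)
  | 3 => (1, -1)
  | 4 => (1, 0)
  | 5 => (1, 1)
  | 6 => (0, 1)
  | 7 => (-1, 1)
  | _ => (1, 0)

/-- The perpendicular directions `q_i⊥`. -/
def qp : ℕ → ℤ × ℤ
  | 1 => qv 3
  | 2 => qv 4
  | 3 => qv 5
  | 4 => qv 6
  | 5 => qv 7
  | 6 => -(qv 4)
  | 7 => qv 1
  | _ => (0, 1)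

/-- Real scalar product of lattice vectors. -/
def dotZ (x y : ℤ × ℤ) : ℝ := (x.1 : ℝ) * (y.1 : ℝ) + (x.2 : ℝ) * (y.2 : ℝ)

/-- The region beyond the far end of the rectangle `S(N)` in direction `q_i`. -/
def U1 (i N : ℕ) : Set (ℤ × ℤ) :=
  {x | 2 * (N : ℝ) * znorm (qv i) ≤ dotZ x (qv i) / znorm (qv i)}

/-- The regions above/below the long sides of the rectangle `S(N)`. -/
def U2 (i N : ℕ) (h : ℝ) : Set (ℤ × ℤ) :=
  {x | 0 < dotZ x (qv i) / znorm (qv i) ∧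
       dotZ x (qv i) / znorm (qv i) < 2 * (N : ℝ) * znorm (qv i) ∧
       2 * h * (N : ℝ) * znorm (qv i) ≤ |dotZ x (qp i) / znorm (qp i)|}

/-- The σ-algebra generated by the process up to time `t`. -/
abbrev pastAlgebra {Ω : Type*} (ξ : ℕ → Ω → ℤ × ℤ) (t : ℕ) : MeasurableSpace Ω :=
  ⨆ s ∈ Finset.range (t + 1), MeasurableSpace.comap (ξ s) ⊤

lemma measurableSet_pastAlgebra_preimage {Ω : Type*} (ξ : ℕ → Ω → ℤ × ℤ) {s t : ℕ} (hst : s ≤ t)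
    (B : Set (ℤ × ℤ)) : MeasurableSet[pastAlgebra ξ t] (ξ s ⁻¹' B) := by
  have hle : MeasurableSpace.comap (ξ s) ⊤ ≤ pastAlgebra ξ t :=
    le_iSup₂_of_le s (Finset.mem_range.2 (by omega)) le_rfl
  exact hle _ ⟨B, trivial, rfl⟩

lemma pastAlgebra_mono {Ω : Type*} (ξ : ℕ → Ω → ℤ × ℤ) {s t : ℕ} (hst : s ≤ t) :
    pastAlgebra ξ s ≤ pastAlgebra ξ t := by
  refine iSup₂_le fun r hr => ?_
  exact le_iSup₂_of_le r (Finset.mem_range.2 (by have := Finset.mem_range.1 hr; omega)) le_rfl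

lemma pastAlgebra_le {Ω : Type*} [mΩ : MeasurableSpace Ω] {ξ : ℕ → Ω → ℤ × ℤ}
    (hmeas : ∀ t, Measurable (ξ t)) (t : ℕ) : pastAlgebra ξ t ≤ mΩ := by
  refine iSup₂_le fun r _ => ?_
  rintro _ ⟨B, _, rfl⟩
  exact hmeas r (Set.to_countable B).measurableSet

/-- Multi-step transition probabilities do not depend on the past beyond the present state. -/
lemma IsMarkovWith.exists_multistep {Ω : Type*} [MeasurableSpace Ω] {P : Measure Ω}
    {ξ : ℕ → Ω → ℤ × ℤ} {p : ℤ × ℤ → ℤ × ℤ → ℝ} (hmeas : ∀ t, Measurable (ξ t))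
    (hM : IsMarkovWith P ξ p) (t : ℕ) (x : ℤ × ℤ) (n : ℕ) (z : ℤ × ℤ) :
    ∃ c : ℝ≥0∞, ∀ A : Set Ω, MeasurableSet[pastAlgebra ξ t] A →
      P (A ∩ {ω | ξ t ω = x} ∩ {ω | ξ (t + n) ω = z}) = c * P (A ∩ {ω | ξ t ω = x}) := by
  induction n generalizing z with
  | zero =>
    by_cases hz : z = x
    · refine ⟨1, fun A _ => ?_⟩
      subst hz
      rw [one_mul, add_zero, Set.inter_assoc, Set.inter_self]
    · refine ⟨0, fun A _ => ?_⟩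
      rw [zero_mul]
      convert measure_empty (μ := P) using 2
      ext ω
      simp only [add_zero, Set.mem_inter_iff, Set.mem_ofPred_eq, Set.mem_empty_iff_false, iff_false]
      rintro ⟨⟨_, h1⟩, h2⟩
      exact hz (h2.symm.trans h1)
  | succ n ih =>
    choose c hc using ih
    refine ⟨∑' w, ENNReal.ofReal (p w (z - w)) * c w, fun A hA => ?_⟩
    have hset : ∀ s w, MeasurableSet {ω | ξ s ω = w} := fun s w => hmeas s (measurableSet_singleton w)
    have hA' : MeasurableSet[pastAlgebra ξ (t + n)] (A ∩ {ω | ξ t ω = x}) :=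
      MeasurableSet.inter (pastAlgebra_mono ξ (Nat.le_add_right t n) _ hA)
        (measurableSet_pastAlgebra_preimage ξ (Nat.le_add_right t n) {x})
    have hA'' : MeasurableSet (A ∩ {ω | ξ t ω = x}) := pastAlgebra_le hmeas _ _ hA'
    have hU : A ∩ {ω | ξ t ω = x} ∩ {ω | ξ (t + (n + 1)) ω = z} =
        ⋃ w, (A ∩ {ω | ξ t ω = x}) ∩ {ω | ξ (t + n) ω = w} ∩
          {ω | ξ (t + n + 1) ω = w + (z - w)} := by
      ext ω
      simp [add_assoc]
    rw [hU, measure_iUnion, ← ENNReal.tsum_mul_right]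
    · refine tsum_congr fun w => ?_
      rw [hM (t + n) w (z - w) _ hA', hc w A hA, mul_assoc]
    · intro w w' hww
      refine Set.disjoint_left.2 ?_
      rintro ω ⟨⟨_, h1⟩, _⟩ ⟨⟨_, h2⟩, _⟩
      exact hww (h1.symm.trans h2)
    · exact fun w => (hA''.inter (hset _ _)).inter (hset _ _)

/-- Weak isotropy, conditionally on the past. -/
lemma IsMarkovWith.le_measureReal_of_A1 {Ω : Type*} [MeasurableSpace Ω] {P : Measure Ω}
    [IsProbabilityMeasure P] {S : Set (ℤ × ℤ)}
    {ξ : ℕ → Ω → ℤ × ℤ} {p : ℤ × ℤ → ℤ × ℤ → ℝ} (hmeas : ∀ t, Measurable (ξ t))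
    (hinS : ∀ t, ∀ᵐ ω ∂P, ξ t ω ∈ S)
    (hM : IsMarkovWith P ξ p) {κ : ℝ} {k n₀ : ℕ} (hA1 : A1 P S ξ κ k n₀) {t : ℕ} {x y : ℤ × ℤ}
    (hκ : 0 < κ)
    (hy : y ∈ ({((k : ℤ), (0 : ℤ)), (-(k : ℤ), 0), (0, (k : ℤ)), (0, -(k : ℤ))} : Set (ℤ × ℤ)))
    {A : Set Ω} (hA : MeasurableSet[pastAlgebra ξ t] A) :
    κ * P.real (A ∩ {ω | ξ t ω = x}) ≤
      P.real (A ∩ {ω | ξ t ω = x} ∩ {ω | ξ (t + n₀) ω = x + y}) := by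
  obtain ⟨c, hc⟩ := hM.exists_multistep hmeas t x n₀ (x + y)
  by_cases h0 : P {ω | ξ t ω = x} = 0
  · have h1 : P (A ∩ {ω | ξ t ω = x}) = 0 := measure_mono_null Set.inter_subset_right h0
    rw [measureReal_def, h1]
    simp
  have hxS : x ∈ S := by
    by_contra hx
    refine h0 (measure_mono_null (fun ω hω => ?_) (ae_iff.1 (hinS t)))
    rw [Set.mem_ofPred_eq] at hω ⊢
    rwa [hω]
  have h1 := hA1 t x hxS y hy
  have h2 := hc Set.univ MeasurableSet.univ
  rw [Set.univ_inter] at h2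
  rw [h2] at h1
  have h3 : ENNReal.ofReal κ ≤ c :=
    (ENNReal.mul_le_mul_iff_left h0 (measure_ne_top P _)).1 h1
  have h4 := hc A hA
  rw [measureReal_def, measureReal_def]
  rw [← ENNReal.toReal_ofReal hκ.le, ← ENNReal.toReal_mul]
  refine ENNReal.toReal_mono (measure_ne_top P _) ?_
  rw [h4]
  gcongr

/-- Almost surely, jumps have length at most `b`. -/
lemma IsMarkovWith.ae_znorm_le {Ω : Type*} [MeasurableSpace Ω] {P : Measure Ω}
    {ξ : ℕ → Ω → ℤ × ℤ} {p : ℤ × ℤ → ℤ × ℤ → ℝ}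
    (hM : IsMarkovWith P ξ p) {b : ℝ} (hA2 : A2 p b) :
    ∀ᵐ ω ∂P, ∀ t, znorm (ξ (t + 1) ω - ξ t ω) ≤ b := by
  refine ae_all_iff.2 fun t => ?_
  have h : ∀ᵐ ω ∂P, ∀ x y : ℤ × ℤ, b < znorm y → ¬ (ξ t ω = x ∧ ξ (t + 1) ω = x + y) := by
    refine ae_all_iff.2 fun x => ae_all_iff.2 fun y => ?_
    by_cases hy : b < znorm y
    · have h1 := hM t x y Set.univ MeasurableSet.univ
      rw [hA2 x y hy, ENNReal.ofReal_zero, zero_mul, Set.univ_inter] at h1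
      rw [ae_iff]
      convert h1 using 2
      ext ω
      simp [hy]
    · exact Filter.Eventually.of_forall fun ω h => absurd h hy
  filter_upwards [h] with ω hω
  by_contra hlt
  exact hω (ξ t ω) _ (not_le.1 hlt) ⟨rfl, by simp⟩

/-- One-step conditional expectation of a function of the jump. -/
lemma IsMarkovWith.setIntegral_jump {Ω : Type*} [MeasurableSpace Ω] {P : Measure Ω}
    [IsProbabilityMeasure P]
    {ξ : ℕ → Ω → ℤ × ℤ} {p : ℤ × ℤ → ℤ × ℤ → ℝ} (hmeas : ∀ t, Measurable (ξ t))
    (hpmf : IsJumpPMF p)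
    (hM : IsMarkovWith P ξ p) (φ : ℤ × ℤ → ℝ) (t : ℕ)
    (hint : Integrable (fun ω => φ (ξ (t + 1) ω - ξ t ω)) P)
    {A : Set Ω} (hA : MeasurableSet[pastAlgebra ξ t] A)
    (hint' : IntegrableOn (fun ω => ∑' y, p (ξ t ω) y * φ y) A P) :
    ∫ ω in A, φ (ξ (t + 1) ω - ξ t ω) ∂P = ∫ ω in A, ∑' y, p (ξ t ω) y * φ y ∂P := by
  have hset : ∀ s w, MeasurableSet {ω | ξ s ω = w} := fun s w => hmeas s (measurableSet_singleton w)
  have hA' : MeasurableSet A := pastAlgebra_le hmeas _ _ hA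
  have hU : A = ⋃ x, A ∩ {ω | ξ t ω = x} := by
    ext ω
    simp
  have hdisj : Pairwise (Function.onFun Disjoint fun x => A ∩ {ω | ξ t ω = x}) := by
    intro w w' hww
    refine Set.disjoint_left.2 ?_
    rintro ω ⟨_, h1⟩ ⟨_, h2⟩
    exact hww (h1.symm.trans h2)
  have hms : ∀ x, MeasurableSet (A ∩ {ω | ξ t ω = x}) := fun x => hA'.inter (hset _ _)
  rw [hU, integral_iUnion hms hdisj hint.integrableOn,
    integral_iUnion hms hdisj (by rwa [← hU])]
  refine tsum_congr fun x => ?_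
  have hθ : Measurable (fun ω => ξ (t + 1) ω - ξ t ω) := (hmeas _).sub (hmeas _)
  have hrhs : ∫ ω in A ∩ {ω | ξ t ω = x}, ∑' y, p (ξ t ω) y * φ y ∂P =
      ∫ ω in A ∩ {ω | ξ t ω = x}, ∑' y, p x y * φ y ∂P := by
    refine setIntegral_congr_fun (hms x) fun ω hω => ?_
    have : ξ t ω = x := hω.2
    simp only [this]
  have hφ : Measurable φ := measurable_of_countable φ
  rw [hrhs, setIntegral_const, smul_eq_mul,
    ← integral_map (φ := fun ω => ξ (t + 1) ω - ξ t ω) (f := φ) hθ.aemeasurable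
      hφ.aestronglyMeasurable,
    integral_countable, ← tsum_mul_left]
  · refine tsum_congr fun y => ?_
    rw [map_measureReal_apply hθ (measurableSet_singleton y), measureReal_restrict_apply
      (hθ (measurableSet_singleton y)), smul_eq_mul, ← mul_assoc]
    congr 1
    have h1 := hM t x y A hA
    rw [measureReal_def, measureReal_def, mul_comm, ← ENNReal.toReal_ofReal (hpmf.1 x y),
      ← ENNReal.toReal_mul, ← h1]
    congr 2
    ext ω
    simp only [Set.mem_inter_iff, Set.mem_preimage, Set.mem_singleton_iff, Set.mem_ofPred_eq]
    constructor
    · rintro ⟨h3, h2, rfl⟩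
      exact ⟨⟨h2, rfl⟩, by rw [← h3]; abel⟩
    · rintro ⟨⟨h2, rfl⟩, h3⟩
      exact ⟨by rw [h3]; abel, h2, rfl⟩
  · rw [integrable_map_measure hφ.aestronglyMeasurable hθ.aemeasurable]
    exact hint.integrableOn

/-- If `g(Y_j)` gains at least `ε` on average in each step as long as `Y` stays in `D`, and `g ≤ 0`
whenever `Y` leaves `D` without entering `E`, then `Y` leaves `D` into `E` with probability
comparable to the initial value of `g`. -/
lemma mul_measureReal_le_of_submartingale_until_exit {Ω X : Type*} [MeasurableSpace Ω]
    [MeasurableSpace X] [DiscreteMeasurableSpace X]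
    {P : Measure Ω} [IsFiniteMeasure P] {Y : ℕ → Ω → X} (hY : ∀ j, Measurable (Y j))
    {D E : Set X} (hDE : Disjoint D E) {G₀ : Set Ω} (hG₀ : MeasurableSet G₀) {g : X → ℝ}
    {M B ε g₀ : ℝ} (hε : 0 < ε) (hM0 : 0 ≤ M) {G : ℕ → Set Ω}
    (hG : ∀ j, G j = {ω | ω ∈ G₀ ∧ ∀ i < j, Y i ω ∈ D})
    (hM : ∀ j, ∀ᵐ ω ∂P, ω ∈ G j → g (Y j ω) ≤ M)
    (hneg : ∀ j, ∀ᵐ ω ∂P, ω ∈ G j → Y j ω ∉ D → Y j ω ∉ E → g (Y j ω) ≤ 0)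
    (hB : ∀ j, ∀ᵐ ω ∂P, ω ∈ G j → |g (Y j ω)| ≤ B)
    (hstep : ∀ j, ε * P.real (G (j + 1)) + ∫ ω in G (j + 1), g (Y j ω) ∂P ≤
      ∫ ω in G (j + 1), g (Y (j + 1) ω) ∂P)
    (hg₀ : ∀ ω ∈ G₀, g₀ ≤ g (Y 0 ω)) :
    g₀ * P.real G₀ ≤ M * P.real (⋃ j, G j ∩ {ω | Y j ω ∈ E}) := by
  have hG0 : G 0 = G₀ := by rw [hG]; simp
  have hGs : ∀ j, G (j + 1) = G j ∩ {ω | Y j ω ∈ D} := by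
    intro j
    rw [hG, hG]
    ext ω
    simp only [Set.mem_ofPred_eq, Set.mem_inter_iff, Nat.lt_succ_iff_lt_or_eq, and_assoc]
    refine and_congr_right fun _ => ⟨fun h => ⟨fun i hi => h i (Or.inl hi), h j (Or.inr rfl)⟩, ?_⟩
    rintro ⟨h1, h2⟩ i (hi | rfl)
    · exact h1 i hi
    · exact h2
  have hYm : ∀ j (B : Set X), MeasurableSet {ω | Y j ω ∈ B} := fun j B =>
    hY j (MeasurableSet.of_discrete)
  have hGm : ∀ j, MeasurableSet (G j) := by
    intro j
    induction j with
    | zero => rwa [hG0]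
    | succ j ih => rw [hGs]; exact ih.inter (hYm _ _)
  have hgm : ∀ j, Measurable fun ω => g (Y j ω) := fun j =>
    (Measurable.of_discrete (f := g)).comp (hY j)
  have hint : ∀ j, IntegrableOn (fun ω => g (Y j ω)) (G j) P := by
    intro j
    refine Measure.integrableOn_of_bounded (M := B) (measure_ne_top P _)
      (hgm j).aestronglyMeasurable ?_
    rw [ae_restrict_iff' (hGm j)]
    exact hB j
  have hsub : ∀ j, G (j + 1) ⊆ G j := fun j => by rw [hGs]; exact Set.inter_subset_left
  have hexit : ∀ j, ∫ ω in G j, g (Y j ω) ∂P ≤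
      ∫ ω in G (j + 1), g (Y j ω) ∂P + M * P.real (G j ∩ {ω | Y j ω ∈ E}) := by
    intro j
    have h1 : ∫ ω in G j, g (Y j ω) ∂P ≤ ∫ ω in G j,
        ((G (j + 1)).indicator (fun ω => g (Y j ω)) ω +
          (G j ∩ {ω | Y j ω ∈ E}).indicator (fun _ => M) ω) ∂P := by
      refine setIntegral_mono_on_ae (hint j) ?_ (hGm j) ?_
      · refine Integrable.add ((hint j).integrable.indicator (hGm _)) ?_
        exact (integrable_const M).indicator ((hGm j).inter (hYm _ _))
      · filter_upwards [hM j, hneg j] with ω h1 h2 hω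
        by_cases hD : Y j ω ∈ D
        · have hE : Y j ω ∉ E := fun hE => Set.disjoint_left.1 hDE hD hE
          have hω' : ω ∈ G (j + 1) := by rw [hGs]; exact ⟨hω, hD⟩
          simp [hω', hE]
        · have hω' : ω ∉ G (j + 1) := by rw [hGs]; exact fun h => hD h.2
          by_cases hE : Y j ω ∈ E
          · simp [hω', hω, hE, h1 hω]
          · simp [hω', hE, h2 hω hD hE]
    refine h1.trans (le_of_eq ?_)
    rw [integral_add]
    · rw [setIntegral_indicator (hGm _), setIntegral_indicator ((hGm j).inter (hYm _ _)),
        Set.inter_eq_right.2 (hsub j), ← Set.inter_assoc, Set.inter_self, setIntegral_const,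
        smul_eq_mul, mul_comm M]
    · exact (hint j).integrable.indicator (hGm _)
    · exact (integrable_const M).indicator ((hGm j).inter (hYm _ _))
  have hsum : ∀ J, g₀ * P.real G₀ + ε * ∑ j ∈ Finset.range J, P.real (G (j + 1)) ≤
      ∫ ω in G J, g (Y J ω) ∂P +
        M * ∑ j ∈ Finset.range J, P.real (G j ∩ {ω | Y j ω ∈ E}) := by
    intro J
    induction J with
    | zero =>
      simp only [Finset.range_zero, Finset.sum_empty, mul_zero, add_zero]
      rw [hG0, mul_comm, ← smul_eq_mul, ← setIntegral_const]
      refine setIntegral_mono_on (integrable_const _).integrableOn ?_ hG₀ hg₀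
      have := hint 0
      rwa [hG0] at this
    | succ J ih =>
      rw [Finset.sum_range_succ, Finset.sum_range_succ]
      have h1 := hexit J
      have h2 := hstep J
      nlinarith
  have hunion : ∀ J, ∑ j ∈ Finset.range J, P.real (G j ∩ {ω | Y j ω ∈ E}) ≤
      P.real (⋃ j, G j ∩ {ω | Y j ω ∈ E}) := by
    intro J
    rw [← measureReal_biUnion_finset]
    · exact measureReal_mono (Set.iUnion₂_subset fun j _ =>
        Set.subset_iUnion (fun j => G j ∩ {ω | Y j ω ∈ E}) j)
    · have key : ∀ i j, i < j →
          Disjoint (G i ∩ {ω | Y i ω ∈ E}) (G j ∩ {ω | Y j ω ∈ E}) := by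
        intro i j hij
        refine Set.disjoint_left.2 ?_
        rintro ω ⟨_, h1⟩ ⟨h2, _⟩
        rw [hG] at h2
        exact Set.disjoint_left.1 hDE (h2.2 i hij) h1
      intro i _ j _ hij
      rcases lt_or_gt_of_ne hij with h | h
      · exact key i j h
      · exact (key j i h).symm
    · exact fun j _ => (hGm j).inter (hYm _ _)
  have hbound : ∀ J, ∫ ω in G J, g (Y J ω) ∂P ≤ M * P.real (G J) := by
    intro J
    rw [mul_comm, ← smul_eq_mul, ← setIntegral_const]
    exact setIntegral_mono_on_ae (hint J) (integrable_const _).integrableOn (hGm J) (hM J)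
  set Q := P.real (⋃ j, G j ∩ {ω | Y j ω ∈ E})
  have hmain : ∀ J, g₀ * P.real G₀ + ε * ∑ j ∈ Finset.range J, P.real (G (j + 1)) ≤
      M * P.real (G J) + M * Q := fun J =>
    (hsum J).trans (add_le_add (hbound J) (mul_le_mul_of_nonneg_left (hunion J) hM0))
  have hsummable : Summable fun j => P.real (G (j + 1)) := by
    refine summable_of_sum_range_le (c := (M * P.real Set.univ + M * Q - g₀ * P.real G₀) / ε)
      (fun _ => measureReal_nonneg) fun J => ?_
    rw [le_div_iff₀ hε]
    have h1 := hmain J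
    have h2 : M * P.real (G J) ≤ M * P.real Set.univ :=
      mul_le_mul_of_nonneg_left (measureReal_mono (Set.subset_univ _)) hM0
    linarith
  have hlim : Filter.Tendsto (fun J => M * P.real (G (J + 1)) + M * Q) Filter.atTop
      (nhds (M * 0 + M * Q)) :=
    (hsummable.tendsto_atTop_zero.const_mul M).add_const _
  rw [mul_zero, zero_add] at hlim
  refine ge_of_tendsto' hlim fun J => le_trans ?_ (hmain (J + 1))
  have : 0 ≤ ε * ∑ j ∈ Finset.range (J + 1), P.real (G (j + 1)) :=
    mul_nonneg hε.le (Finset.sum_nonneg fun _ _ => measureReal_nonneg)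
  linarith

/-- The coordinate of a lattice point along `q`. -/
noncomputable def parCoord (q : ℤ × ℤ) : ℤ × ℤ →+ ℝ :=
  AddMonoidHom.mk' (fun x => ((x.1 : ℝ) * q.1 + (x.2 : ℝ) * q.2) / ((q.1 : ℝ) ^ 2 + (q.2 : ℝ) ^ 2))
    fun x y => by push_cast [Prod.fst_add, Prod.snd_add]; ring

/-- The coordinate of a lattice point along the vector obtained by rotating `q` by `π / 2`. -/
noncomputable def perpCoord (q : ℤ × ℤ) : ℤ × ℤ →+ ℝ :=
  AddMonoidHom.mk' (fun x => ((x.2 : ℝ) * q.1 - (x.1 : ℝ) * q.2) / ((q.1 : ℝ) ^ 2 + (q.2 : ℝ) ^ 2))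
    fun x y => by push_cast [Prod.fst_add, Prod.snd_add]; ring

lemma parCoord_apply (q x : ℤ × ℤ) : parCoord q x =
    ((x.1 : ℝ) * q.1 + (x.2 : ℝ) * q.2) / ((q.1 : ℝ) ^ 2 + (q.2 : ℝ) ^ 2) := rfl

lemma perpCoord_apply (q x : ℤ × ℤ) : perpCoord q x =
    ((x.2 : ℝ) * q.1 - (x.1 : ℝ) * q.2) / ((q.1 : ℝ) ^ 2 + (q.2 : ℝ) ^ 2) := rfl

lemma abs_parCoord_le {q : ℤ × ℤ} (hq : 1 ≤ (q.1 : ℝ) ^ 2 + (q.2 : ℝ) ^ 2) (x : ℤ × ℤ) :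
    |parCoord q x| ≤ znorm x := by
  rw [parCoord_apply, znorm]
  refine Real.le_sqrt_of_sq_le ?_
  rw [sq_abs, div_pow, div_le_iff₀ (by positivity)]
  have h0 : 0 ≤ (x.1 : ℝ) ^ 2 + (x.2 : ℝ) ^ 2 := by positivity
  nlinarith [sq_nonneg ((x.2 : ℝ) * q.1 - (x.1 : ℝ) * q.2), mul_nonneg
    (mul_nonneg h0 (sub_nonneg.2 hq)) (by linarith : 0 ≤ (q.1 : ℝ) ^ 2 + (q.2 : ℝ) ^ 2)]

lemma abs_perpCoord_le {q : ℤ × ℤ} (hq : 1 ≤ (q.1 : ℝ) ^ 2 + (q.2 : ℝ) ^ 2) (x : ℤ × ℤ) :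
    |perpCoord q x| ≤ znorm x := by
  rw [perpCoord_apply, znorm]
  refine Real.le_sqrt_of_sq_le ?_
  rw [sq_abs, div_pow, div_le_iff₀ (by positivity)]
  have h0 : 0 ≤ (x.1 : ℝ) ^ 2 + (x.2 : ℝ) ^ 2 := by positivity
  nlinarith [sq_nonneg ((x.1 : ℝ) * q.1 + (x.2 : ℝ) * q.2), mul_nonneg
    (mul_nonneg h0 (sub_nonneg.2 hq)) (by linarith : 0 ≤ (q.1 : ℝ) ^ 2 + (q.2 : ℝ) ^ 2)]

lemma qv_qp_spec {i : ℕ} (hi : 1 ≤ i ∧ i ≤ 7) :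
    qp i = (-(qv i).2, (qv i).1) ∧ |((qv i).1 : ℝ)| ≤ 1 ∧ |((qv i).2 : ℝ)| ≤ 1 ∧
      1 ≤ ((qv i).1 : ℝ) ^ 2 + ((qv i).2 : ℝ) ^ 2 := by
  obtain ⟨h1, h2⟩ := hi
  interval_cases i <;> simp [qv, qp]

lemma znorm_qp {i : ℕ} (hi : 1 ≤ i ∧ i ≤ 7) : znorm (qp i) = znorm (qv i) := by
  rw [(qv_qp_spec hi).1, znorm, znorm]
  congr 1
  push_cast
  ring

lemma znorm_qv_pos {i : ℕ} (hi : 1 ≤ i ∧ i ≤ 7) : 0 < znorm (qv i) :=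
  Real.sqrt_pos.2 (by linarith [(qv_qp_spec hi).2.2.2])

lemma dotZ_qv_div {i : ℕ} (hi : 1 ≤ i ∧ i ≤ 7) (x : ℤ × ℤ) :
    dotZ x (qv i) / znorm (qv i) = parCoord (qv i) x * znorm (qv i) := by
  have h0 := znorm_qv_pos hi
  have h1 : znorm (qv i) ^ 2 = ((qv i).1 : ℝ) ^ 2 + ((qv i).2 : ℝ) ^ 2 :=
    Real.sq_sqrt (by positivity)
  rw [parCoord_apply, ← h1, dotZ]
  field_simp

lemma dotZ_qp_div {i : ℕ} (hi : 1 ≤ i ∧ i ≤ 7) (x : ℤ × ℤ) :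
    dotZ x (qp i) / znorm (qp i) = perpCoord (qv i) x * znorm (qv i) := by
  have h0 := znorm_qv_pos hi
  have h1 : znorm (qv i) ^ 2 = ((qv i).1 : ℝ) ^ 2 + ((qv i).2 : ℝ) ^ 2 :=
    Real.sq_sqrt (by positivity)
  rw [znorm_qp hi, perpCoord_apply, ← h1, dotZ, (qv_qp_spec hi).1]
  push_cast
  field_simp
  ring

lemma mem_U1_iff {i : ℕ} (hi : 1 ≤ i ∧ i ≤ 7) (N : ℕ) (x : ℤ × ℤ) :
    x ∈ U1 i N ↔ 2 * (N : ℝ) ≤ parCoord (qv i) x := by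
  rw [U1, Set.mem_ofPred_eq, dotZ_qv_div hi, mul_le_mul_iff_left₀ (znorm_qv_pos hi)]

lemma mem_U2_iff {i : ℕ} (hi : 1 ≤ i ∧ i ≤ 7) (N : ℕ) (h : ℝ) (x : ℤ × ℤ) :
    x ∈ U2 i N h ↔ 0 < parCoord (qv i) x ∧ parCoord (qv i) x < 2 * (N : ℝ) ∧
      2 * h * N ≤ |perpCoord (qv i) x| := by
  have h0 := znorm_qv_pos hi
  rw [U2, Set.mem_ofPred_eq, dotZ_qv_div hi, dotZ_qp_div hi, abs_mul, abs_of_pos h0,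
    mul_le_mul_iff_left₀ h0, mul_lt_mul_iff_left₀ h0, mul_pos_iff_of_pos_right h0]

lemma parCoord_start {i : ℕ} (hi : 1 ≤ i ∧ i ≤ 7) (m y : ℤ) :
    parCoord (qv i) (m • qv i + y • qp i) = m := by
  have h1 := (qv_qp_spec hi).2.2.2
  rw [parCoord_apply, (qv_qp_spec hi).1]
  push_cast [Prod.fst_add, Prod.snd_add, Prod.smul_fst, Prod.smul_snd, smul_eq_mul]
  field_simp
  ring

lemma perpCoord_start {i : ℕ} (hi : 1 ≤ i ∧ i ≤ 7) (m y : ℤ) :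
    perpCoord (qv i) (m • qv i + y • qp i) = y := by
  have h1 := (qv_qp_spec hi).2.2.2
  rw [perpCoord_apply, (qv_qp_spec hi).1]
  push_cast [Prod.fst_add, Prod.snd_add, Prod.smul_fst, Prod.smul_snd, smul_eq_mul]
  field_simp
  ring

lemma abs_map_sub_le_of_jumps {φ : ℤ × ℤ →+ ℝ} (hφ : ∀ x, |φ x| ≤ znorm x) {x : ℕ → ℤ × ℤ} {b : ℝ}
    (hx : ∀ t, znorm (x (t + 1) - x t) ≤ b) (t n : ℕ) : |φ (x (t + n) - x t)| ≤ n * b := by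
  induction n with
  | zero => simp
  | succ n ih =>
    have h1 : x (t + (n + 1)) - x t = (x (t + n + 1) - x (t + n)) + (x (t + n) - x t) := by
      rw [← add_assoc]; abel
    rw [h1, map_add]
    refine (abs_add_le _ _).trans ?_
    have h2 := (hφ _).trans (hx (t + n))
    push_cast
    linarith

/-- A bound on the mean one-step displacements gives a bound on the mean `n`-step displacement. -/
lemma IsMarkovWith.abs_setIntegral_displacement_le {Ω : Type*} [MeasurableSpace Ω] {P : Measure Ω}
    [IsProbabilityMeasure P]
    {ξ : ℕ → Ω → ℤ × ℤ} {p : ℤ × ℤ → ℤ × ℤ → ℝ} (hmeas : ∀ t, Measurable (ξ t))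
    (hpmf : IsJumpPMF p) (hM : IsMarkovWith P ξ p) {b : ℝ} (hA2 : A2 p b)
    {φ : ℤ × ℤ →+ ℝ} (hφ : ∀ x, |φ x| ≤ znorm x) {t : ℕ} {A : Set Ω}
    (hA : MeasurableSet[pastAlgebra ξ t] A) {β : ℝ} (n : ℕ)
    (hβ : ∀ r < n, ∀ᵐ ω ∂P, ω ∈ A → |∑' y, p (ξ (t + r) ω) y * φ y| ≤ β) :
    |∫ ω in A, φ (ξ (t + n) ω - ξ t ω) ∂P| ≤ n * β * P.real A := by
  have hA' : MeasurableSet A := pastAlgebra_le hmeas _ _ hA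
  have hint : ∀ s r, Integrable (fun ω => φ (ξ (s + r) ω - ξ s ω)) P := by
    intro s r
    refine Integrable.of_bound (C := r * b) ?_ ?_
    · exact ((Measurable.of_discrete (f := φ)).comp
        ((hmeas _).sub (hmeas _))).aestronglyMeasurable
    · filter_upwards [hM.ae_znorm_le hA2] with ω hω
      exact abs_map_sub_le_of_jumps (x := fun t => ξ t ω) hφ hω s r
  induction n with
  | zero => simp
  | succ n ih =>
    have ih := ih fun r hr => hβ r (by omega)
    have hβn : ∀ᵐ ω ∂P.restrict A, ‖∑' y, p (ξ (t + n) ω) y * φ y‖ ≤ β := by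
      rw [ae_restrict_iff' hA']
      exact hβ n (by omega)
    have h1 : ∫ ω in A, φ (ξ (t + (n + 1)) ω - ξ t ω) ∂P =
        ∫ ω in A, φ (ξ (t + n + 1) ω - ξ (t + n) ω) ∂P +
          ∫ ω in A, φ (ξ (t + n) ω - ξ t ω) ∂P := by
      rw [← integral_add (hint (t + n) 1).integrableOn (hint t n).integrableOn]
      congr 1
      ext ω
      rw [← map_add]
      congr 1
      rw [← add_assoc]; abel
    rw [h1, hM.setIntegral_jump hmeas hpmf φ (t + n) (hint (t + n) 1)
      (pastAlgebra_mono ξ (Nat.le_add_right t n) _ hA)]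
    · have h2 := norm_setIntegral_le_of_norm_le_const_ae (measure_lt_top P A) hβn
      rw [Real.norm_eq_abs] at h2
      refine (abs_add_le _ _).trans ?_
      push_cast
      linarith
    · refine Measure.integrableOn_of_bounded (measure_ne_top P A) ?_ hβn
      exact ((Measurable.of_discrete (f := fun x => ∑' y, p x y * φ y)).comp
        (hmeas (t + n))).aestronglyMeasurable

/-- Lower bound for the exponential moment of a small displacement with small mean and
non-degenerate second moment. -/
lemma le_integral_exp_sub_one {Ω : Type*} [MeasurableSpace Ω] {μ : Measure Ω} [IsFiniteMeasure μ]
    {da dc : Ω → ℝ} (hda : Measurable da) (hdc : Measurable dc) {K C N A L α u : ℝ}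
    (hN : 0 < N) (hα : 0 < α) (hA : 0 ≤ A)
    (hdaK : ∀ᵐ ω ∂μ, |da ω| ≤ K) (hdcK : ∀ᵐ ω ∂μ, |dc ω| ≤ K)
    (hdaC : |∫ ω, da ω ∂μ| ≤ C / N * μ.real Set.univ)
    (hdcC : |∫ ω, dc ω ∂μ| ≤ C / N * μ.real Set.univ) (hu : |u| ≤ 1 / 2)
    (hL : L * μ.real Set.univ ≤ ∫ ω, (dc ω - 2 * A * u * da ω) ^ 2 ∂μ)
    (hN1 : α / N * ((1 + A) * K) + α * A / N ^ 2 * K ^ 2 ≤ 1)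
    (hN2 : α * A ^ 2 * K ^ 4 ≤ 2 * N ^ 2)
    (hαL : α * L = 8 * ((1 + A) * C + A * K ^ 2 + 1)) :
    α / (2 * N ^ 2) * μ.real Set.univ ≤
      ∫ ω, (Real.exp (α / N * (dc ω - 2 * A * u * da ω) - α * A / N ^ 2 * da ω ^ 2) - 1) ∂μ := by
  have hu2 : |2 * A * u| ≤ A := by
    rw [abs_mul, abs_of_nonneg (by positivity : 0 ≤ 2 * A)]
    nlinarith
  have hida : Integrable da μ := Integrable.of_bound hda.aestronglyMeasurable K hdaK
  have hidc : Integrable dc μ := Integrable.of_bound hdc.aestronglyMeasurable K hdcK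
  have hlK : ∀ᵐ ω ∂μ, |dc ω - 2 * A * u * da ω| ≤ (1 + A) * K := by
    filter_upwards [hdaK, hdcK] with ω h1 h2
    refine (abs_sub _ _).trans ?_
    rw [abs_mul]
    have := mul_le_mul hu2 h1 (abs_nonneg _) hA
    linarith
  have hlm : Measurable fun ω => dc ω - 2 * A * u * da ω := hdc.sub (hda.const_mul _)
  have hil : Integrable (fun ω => dc ω - 2 * A * u * da ω) μ := hidc.sub (hida.const_mul _)
  have hil2 : Integrable (fun ω => (dc ω - 2 * A * u * da ω) ^ 2) μ := by
    refine Integrable.of_bound (hlm.pow_const 2).aestronglyMeasurable (((1 + A) * K) ^ 2) ?_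
    filter_upwards [hlK] with ω h1
    rw [Real.norm_eq_abs, abs_pow]
    gcongr
  have hs : ∀ᵐ ω ∂μ,
      |α / N * (dc ω - 2 * A * u * da ω) - α * A / N ^ 2 * da ω ^ 2| ≤ 1 := by
    filter_upwards [hlK, hdaK] with ω h1 h2
    refine (abs_sub _ _).trans (le_trans ?_ hN1)
    rw [abs_mul, abs_mul, abs_of_nonneg (by positivity : 0 ≤ α / N),
      abs_of_nonneg (by positivity : 0 ≤ α * A / N ^ 2), abs_pow]
    gcongr
  have hexp : ∀ s : ℝ, |s| ≤ 1 → s + s ^ 2 / 4 ≤ Real.exp s - 1 := by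
    intro s hs
    have h1 := Real.exp_bound hs (n := 3) (by norm_num)
    have h2 := (abs_le.1 h1).1
    norm_num [Finset.sum_range_succ, Nat.factorial] at h2
    have h3 : |s| ^ 3 ≤ s ^ 2 := by
      rw [← sq_abs s]
      exact pow_le_pow_of_le_one (abs_nonneg s) hs (by norm_num)
    nlinarith [sq_nonneg s]
  have hpt : ∀ᵐ ω ∂μ, (α / N) * (dc ω - 2 * A * u * da ω) +
      (α ^ 2 / (8 * N ^ 2)) * (dc ω - 2 * A * u * da ω) ^ 2 -
        (α * A * K ^ 2 / N ^ 2 + (α * A / N ^ 2 * K ^ 2) ^ 2 / 4) ≤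
      Real.exp (α / N * (dc ω - 2 * A * u * da ω) - α * A / N ^ 2 * da ω ^ 2) - 1 := by
    filter_upwards [hs, hdaK] with ω h1 h2
    refine le_trans ?_ (hexp _ h1)
    set l := dc ω - 2 * A * u * da ω
    have h3 : da ω ^ 2 ≤ K ^ 2 := sq_le_sq' (abs_le.1 h2).1 (abs_le.1 h2).2
    have h4 : α * A / N ^ 2 * da ω ^ 2 ≤ α * A / N ^ 2 * K ^ 2 := by gcongr
    have h5 : 0 ≤ α * A / N ^ 2 * da ω ^ 2 := by positivity
    set Z := α * A / N ^ 2 * da ω ^ 2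
    set W := α * A / N ^ 2 * K ^ 2 with hW
    have h6 : α * A * K ^ 2 / N ^ 2 = W := by rw [hW]; ring
    have h7 : α ^ 2 / (8 * N ^ 2) * l ^ 2 = (α / N * l) ^ 2 / 8 := by field_simp
    rw [h6, h7]
    have h8 : Z ^ 2 ≤ W ^ 2 := by gcongr
    nlinarith [sq_nonneg (α / N * l - 2 * Z)]
  have hir : Integrable (fun ω =>
      Real.exp (α / N * (dc ω - 2 * A * u * da ω) - α * A / N ^ 2 * da ω ^ 2) - 1) μ := by
    refine Integrable.of_bound (C := Real.exp 1 + 1) ?_ ?_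
    · exact (((hlm.const_mul _).sub ((hda.pow_const 2).const_mul _)).exp.sub_const
        1).aestronglyMeasurable
    · filter_upwards [hs] with ω h1
      refine (norm_sub_le _ _).trans ?_
      rw [Real.norm_eq_abs, Real.abs_exp, norm_one]
      have := Real.exp_le_exp.2 (abs_le.1 h1).2
      linarith
  have hmono := integral_mono_ae (((hil.const_mul (α / N)).add
    (hil2.const_mul (α ^ 2 / (8 * N ^ 2)))).sub (integrable_const _)) hir hpt
  refine le_trans ?_ hmono
  have hsplit := integral_sub ((hil.const_mul (α / N)).add
    (hil2.const_mul (α ^ 2 / (8 * N ^ 2)))) (integrable_const (μ := μ)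
      (α * A * K ^ 2 / N ^ 2 + (α * A / N ^ 2 * K ^ 2) ^ 2 / 4))
  have hsplit2 := integral_add (hil.const_mul (α / N)) (hil2.const_mul (α ^ 2 / (8 * N ^ 2)))
  simp only [Pi.add_apply] at hsplit hsplit2
  simp only [Pi.sub_apply, Pi.add_apply]
  rw [hsplit, hsplit2, integral_const_mul, integral_const_mul, integral_const,
    integral_sub hidc (hida.const_mul _), integral_const_mul, smul_eq_mul]
  set m := μ.real Set.univ with hm
  have hm0 : 0 ≤ m := measureReal_nonneg
  set I := ∫ ω, da ω ∂μ
  set J := ∫ ω, dc ω ∂μ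
  set Q := ∫ ω, (dc ω - 2 * A * u * da ω) ^ 2 ∂μ
  have hJI : -((1 + A) * (C / N * m)) ≤ J - 2 * A * u * I := by
    have h1 : |2 * A * u * I| ≤ A * (C / N * m) := by
      rw [abs_mul]
      exact mul_le_mul hu2 hdaC (abs_nonneg _) hA
    have h2 := (abs_le.1 h1).2
    have h3 := (abs_le.1 hdcC).1
    linarith
  have h1 : α / N * -((1 + A) * (C / N * m)) ≤ α / N * (J - 2 * A * u * I) := by gcongr
  have h2 : α ^ 2 / (8 * N ^ 2) * (L * m) ≤ α ^ 2 / (8 * N ^ 2) * Q := by gcongr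
  have h3 : α ^ 2 / (8 * N ^ 2) * (L * m) =
      α * m / N ^ 2 * ((1 + A) * C + A * K ^ 2 + 1) := by
    have : α ^ 2 / (8 * N ^ 2) * (L * m) = α * m / (8 * N ^ 2) * (α * L) := by ring
    rw [this, hαL]
    field_simp
  have h4 : α / N * -((1 + A) * (C / N * m)) = - (α * m / N ^ 2 * ((1 + A) * C)) := by
    field_simp
  have h5 : (α * A / N ^ 2 * K ^ 2) ^ 2 / 4 * m ≤ α * m / N ^ 2 * (1 / 2) := by
    have : (α * A / N ^ 2 * K ^ 2) ^ 2 / 4 * m =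
        α * m / N ^ 2 * (α * A ^ 2 * K ^ 4 / (4 * N ^ 2)) := by field_simp
    rw [this]
    refine mul_le_mul_of_nonneg_left ?_ (by positivity)
    rw [div_le_iff₀ (by positivity)]
    linarith
  have h6 : α * A * K ^ 2 / N ^ 2 * m = α * m / N ^ 2 * (A * K ^ 2) := by ring
  have h7 : α / (2 * N ^ 2) * m = α * m / N ^ 2 * (1 / 2) := by field_simp
  rw [h7]
  linarith

/-- The exponential of a function whose level curves are parabolas around the line through `N q`
orthogonal to `q`. -/
noncomputable def parabolicBarrier (q : ℤ × ℤ) (N A α : ℝ) (x : ℤ × ℤ) : ℝ :=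
  Real.exp (α * (perpCoord q x / N - A * ((parCoord q x - N) / N) ^ 2))

lemma parabolicBarrier_sub (q : ℤ × ℤ) {N : ℝ} (hN : 0 < N) (A α : ℝ) (x y : ℤ × ℤ) :
    parabolicBarrier q N A α y - parabolicBarrier q N A α x = parabolicBarrier q N A α x *
      (Real.exp (α / N * (perpCoord q (y - x) - 2 * A * ((parCoord q x - N) / N) *
        parCoord q (y - x)) - α * A / N ^ 2 * parCoord q (y - x) ^ 2) - 1) := by
  rw [mul_sub, mul_one, parabolicBarrier, parabolicBarrier, ← Real.exp_add]
  congr 2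
  rw [map_sub, map_sub]
  field_simp
  ring

lemma setIntegral_nonneg_of_fibers {Ω : Type*} [MeasurableSpace Ω] {P : Measure Ω}
    {X : Ω → ℤ × ℤ} (hX : Measurable X) {B : Set Ω} (hB : MeasurableSet B) {F : Ω → ℝ}
    (hF : IntegrableOn F B P) (h : ∀ x, 0 ≤ ∫ ω in B ∩ {ω | X ω = x}, F ω ∂P) :
    0 ≤ ∫ ω in B, F ω ∂P := by
  have hU : B = ⋃ x, B ∩ {ω | X ω = x} := by
    ext ω
    simp
  have hms : ∀ x, MeasurableSet (B ∩ {ω | X ω = x}) := fun x =>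
    hB.inter (hX (measurableSet_singleton x))
  rw [hU, integral_iUnion hms _ (by rwa [← hU])]
  · exact tsum_nonneg h
  · intro w w' hww
    refine Set.disjoint_left.2 ?_
    rintro ω ⟨_, h1⟩ ⟨_, h2⟩
    exact hww (h1.symm.trans h2)

/-- Lower bound for the conditional expectation of a nonnegative function of the `n₀`-step
displacement under weak isotropy. -/
lemma IsMarkovWith.mul_le_setIntegral_displacement {Ω : Type*} [MeasurableSpace Ω] {P : Measure Ω}
    [IsProbabilityMeasure P] {S : Set (ℤ × ℤ)}
    {ξ : ℕ → Ω → ℤ × ℤ} {p : ℤ × ℤ → ℤ × ℤ → ℝ} (hmeas : ∀ t, Measurable (ξ t))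
    (hinS : ∀ t, ∀ᵐ ω ∂P, ξ t ω ∈ S)
    (hM : IsMarkovWith P ξ p) {κ : ℝ} {k n₀ : ℕ} (hA1 : A1 P S ξ κ k n₀) (hκ : 0 < κ)
    (hk : 0 < k) {t : ℕ} {x : ℤ × ℤ} {A : Set Ω} (hA : MeasurableSet[pastAlgebra ξ t] A)
    {ψ : ℤ × ℤ → ℝ} (hψ : ∀ y, 0 ≤ ψ y)
    (hint : IntegrableOn (fun ω => ψ (ξ (t + n₀) ω - x)) (A ∩ {ω | ξ t ω = x}) P) :
    κ * (ψ ((k : ℤ), 0) + ψ (0, (k : ℤ))) * P.real (A ∩ {ω | ξ t ω = x}) ≤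
      ∫ ω in A ∩ {ω | ξ t ω = x}, ψ (ξ (t + n₀) ω - x) ∂P := by
  have hA' : MeasurableSet (A ∩ {ω | ξ t ω = x}) :=
    (pastAlgebra_le hmeas _ _ hA).inter (hmeas t (measurableSet_singleton x))
  have h1 := hM.le_measureReal_of_A1 hmeas hinS hA1 (x := x) (y := ((k : ℤ), 0)) hκ (by simp) hA
  have h2 := hM.le_measureReal_of_A1 hmeas hinS hA1 (x := x) (y := (0, (k : ℤ))) hκ (by simp) hA
  have hset : ∀ y : ℤ × ℤ, MeasurableSet {ω | ξ (t + n₀) ω = x + y} := fun y =>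
    hmeas _ (measurableSet_singleton _)
  have hi : ∀ y : ℤ × ℤ, IntegrableOn
      ({ω | ξ (t + n₀) ω = x + y}.indicator fun _ => ψ y) (A ∩ {ω | ξ t ω = x}) P := fun y =>
    (integrable_const _).indicator (hset y)
  have h3 : ∫ ω in A ∩ {ω | ξ t ω = x},
      ({ω | ξ (t + n₀) ω = x + ((k : ℤ), (0 : ℤ))}.indicator (fun _ => ψ ((k : ℤ), 0)) ω +
        {ω | ξ (t + n₀) ω = x + ((0 : ℤ), (k : ℤ))}.indicator (fun _ => ψ (0, (k : ℤ))) ω) ∂P ≤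
      ∫ ω in A ∩ {ω | ξ t ω = x}, ψ (ξ (t + n₀) ω - x) ∂P := by
    refine setIntegral_mono ((hi _).add (hi _)) hint fun ω => ?_
    dsimp only
    by_cases ha : ξ (t + n₀) ω = x + ((k : ℤ), (0 : ℤ))
    · have hb : ¬ ξ (t + n₀) ω = x + ((0 : ℤ), (k : ℤ)) := by
        rw [ha]
        intro h
        have := congrArg Prod.snd (add_left_cancel h)
        simp only at this
        omega
      rw [Set.indicator_of_mem (by exact ha), Set.indicator_of_notMem (by exact hb), ha]
      simp
    · rw [Set.indicator_of_notMem (by exact ha), zero_add]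
      by_cases hb : ξ (t + n₀) ω = x + ((0 : ℤ), (k : ℤ))
      · rw [Set.indicator_of_mem (by exact hb), hb]
        simp
      · rw [Set.indicator_of_notMem (by exact hb)]
        exact hψ _
  refine le_trans ?_ h3
  rw [integral_add (hi _) (hi _), setIntegral_indicator (hset _), setIntegral_indicator (hset _),
    setIntegral_const, setIntegral_const, smul_eq_mul, smul_eq_mul]
  have h4 := mul_le_mul_of_nonneg_right h1 (hψ ((k : ℤ), 0))
  have h5 := mul_le_mul_of_nonneg_right h2 (hψ (0, (k : ℤ)))
  linarith

lemma abs_mu1_le_muNorm (p : ℤ × ℤ → ℤ × ℤ → ℝ) (x : ℤ × ℤ) : |mu1 p x| ≤ muNorm p x :=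
  Real.abs_le_sqrt (by linarith [sq_nonneg (mu2 p x)])

lemma abs_mu2_le_muNorm (p : ℤ × ℤ → ℤ × ℤ → ℝ) (x : ℤ × ℤ) : |mu2 p x| ≤ muNorm p x :=
  Real.abs_le_sqrt (by linarith [sq_nonneg (mu1 p x)])

/-- One `n₀`-step increment of the barrier function inside the strip. -/
lemma IsMarkovWith.le_setIntegral_parabolicBarrier_sub {Ω : Type*} [MeasurableSpace Ω]
    {P : Measure Ω} [IsProbabilityMeasure P] {S : Set (ℤ × ℤ)}
    {ξ : ℕ → Ω → ℤ × ℤ} {p : ℤ × ℤ → ℤ × ℤ → ℝ} (hmeas : ∀ t, Measurable (ξ t))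
    (hinS : ∀ t, ∀ᵐ ω ∂P, ξ t ω ∈ S) (hpmf : IsJumpPMF p)
    (hM : IsMarkovWith P ξ p) {κ : ℝ} {k n₀ : ℕ} (hA1 : A1 P S ξ κ k n₀) (hκ : 0 < κ)
    (hk : 0 < k) {b : ℝ} (hb : 0 < b) (hA2 : A2 p b)
    {C₁ r₀ : ℝ} (hC₁ : 0 < C₁) (hdrift : ∀ x ∈ S, r₀ ≤ znorm x → muNorm p x ≤ C₁ / znorm x)
    {q : ℤ × ℤ} (hq1 : |(q.1 : ℝ)| ≤ 1) (hq2 : |(q.2 : ℝ)| ≤ 1)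
    (hq : 1 ≤ (q.1 : ℝ) ^ 2 + (q.2 : ℝ) ^ 2) {N A α : ℝ} (hN : 0 < N) (hA : 0 ≤ A) (hα : 0 < α)
    (hNK : 4 * (n₀ * b) ≤ N) (hNr : 4 * r₀ ≤ N)
    (hN1 : α / N * ((1 + A) * (n₀ * b)) + α * A / N ^ 2 * (n₀ * b) ^ 2 ≤ 1)
    (hN2 : α * A ^ 2 * (n₀ * b) ^ 4 ≤ 2 * N ^ 2)
    (hαL : α * (κ * k ^ 2 / 2) = 8 * ((1 + A) * (8 * n₀ * C₁) + A * (n₀ * b) ^ 2 + 1))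
    {t : ℕ} {x : ℤ × ℤ} (hx : |parCoord q x - N| < N / 2)
    {G : Set Ω} (hG : MeasurableSet[pastAlgebra ξ t] G) :
    parabolicBarrier q N A α x * (α / (2 * N ^ 2)) * P.real (G ∩ {ω | ξ t ω = x}) ≤
      ∫ ω in G ∩ {ω | ξ t ω = x},
        (parabolicBarrier q N A α (ξ (t + n₀) ω) - parabolicBarrier q N A α (ξ t ω)) ∂P := by
  have hG' : MeasurableSet[pastAlgebra ξ t] (G ∩ {ω | ξ t ω = x}) :=
    MeasurableSet.inter hG (measurableSet_pastAlgebra_preimage ξ le_rfl {x})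
  have hm' : MeasurableSet (G ∩ {ω | ξ t ω = x}) := pastAlgebra_le hmeas _ _ hG'
  set H := G ∩ {ω | ξ t ω = x} with hH
  have hHx : ∀ ω ∈ H, ξ t ω = x := fun ω hω => hω.2
  have hjump := hM.ae_znorm_le hA2
  have hm2 : (q.1 : ℝ) ^ 2 + (q.2 : ℝ) ^ 2 ≤ 2 := by
    have h1 := (sq_le_one_iff_abs_le_one (q.1 : ℝ)).2 hq1
    have h2 := (sq_le_one_iff_abs_le_one (q.2 : ℝ)).2 hq2
    linarith
  have hfar : ∀ r < n₀, ∀ᵐ ω ∂P, ω ∈ H → muNorm p (ξ (t + r) ω) ≤ 4 * C₁ / N := by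
    intro r hr
    filter_upwards [hjump, hinS (t + r)] with ω hω hS hωH
    have h1 := abs_map_sub_le_of_jumps (x := fun t => ξ t ω) (abs_parCoord_le hq) hω t r
    rw [hHx ω hωH, map_sub] at h1
    have h2 : (r : ℝ) * b ≤ n₀ * b := by gcongr
    have h3 := (abs_le.1 h1).1
    have h4 := (abs_lt.1 hx).1
    have h5 := (le_abs_self _).trans (abs_parCoord_le hq (ξ (t + r) ω))
    have h6 : N / 4 ≤ znorm (ξ (t + r) ω) := by linarith
    refine (hdrift _ hS (by linarith)).trans ?_
    rw [div_le_div_iff₀ (by linarith) hN]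
    nlinarith
  let φ₁ : ℤ × ℤ →+ ℝ := (Int.castAddHom ℝ).comp (AddMonoidHom.fst ℤ ℤ)
  let φ₂ : ℤ × ℤ →+ ℝ := (Int.castAddHom ℝ).comp (AddMonoidHom.snd ℤ ℤ)
  have hφ₁ : ∀ y, |φ₁ y| ≤ znorm y := fun y =>
    Real.abs_le_sqrt (by simp [φ₁]; positivity)
  have hφ₂ : ∀ y, |φ₂ y| ≤ znorm y := fun y =>
    Real.abs_le_sqrt (by simp [φ₂]; positivity)
  have hI₁ := hM.abs_setIntegral_displacement_le hmeas hpmf hA2 hφ₁ hG' (β := 4 * C₁ / N) n₀ (by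
    intro r hr
    filter_upwards [hfar r hr] with ω h1 h2
    exact (abs_mu1_le_muNorm p _).trans (h1 h2))
  have hI₂ := hM.abs_setIntegral_displacement_le hmeas hpmf hA2 hφ₂ hG' (β := 4 * C₁ / N) n₀ (by
    intro r hr
    filter_upwards [hfar r hr] with ω h1 h2
    exact (abs_mu2_le_muNorm p _).trans (h1 h2))
  have hdm : ∀ φ : ℤ × ℤ → ℝ, Measurable fun ω => φ (ξ (t + n₀) ω - ξ t ω) := fun φ =>
    (Measurable.of_discrete (f := φ)).comp ((hmeas _).sub (hmeas _))
  have hint : ∀ φ : ℤ × ℤ →+ ℝ, (∀ y, |φ y| ≤ znorm y) →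
      ∀ᵐ ω ∂P.restrict H, |φ (ξ (t + n₀) ω - ξ t ω)| ≤ n₀ * b := by
    intro φ hφ
    filter_upwards [ae_restrict_of_ae hjump] with ω hω
    exact abs_map_sub_le_of_jumps (x := fun t => ξ t ω) hφ hω t n₀
  have hint₁ : IntegrableOn (fun ω => φ₁ (ξ (t + n₀) ω - ξ t ω)) H P :=
    Integrable.of_bound (hdm φ₁).aestronglyMeasurable _ (hint φ₁ hφ₁)
  have hint₂ : IntegrableOn (fun ω => φ₂ (ξ (t + n₀) ω - ξ t ω)) H P :=
    Integrable.of_bound (hdm φ₂).aestronglyMeasurable _ (hint φ₂ hφ₂)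
  have hlin : ∀ (φ : ℤ × ℤ →+ ℝ) (c₁ c₂ : ℝ), |c₁| ≤ 1 → |c₂| ≤ 1 →
      (∀ y, φ y = c₁ * φ₁ y + c₂ * φ₂ y) →
      |∫ ω in H, φ (ξ (t + n₀) ω - ξ t ω) ∂P| ≤ 8 * n₀ * C₁ / N * P.real H := by
    intro φ c₁ c₂ h1 h2 hφ
    simp_rw [hφ]
    rw [integral_add (hint₁.const_mul _) (hint₂.const_mul _), integral_const_mul,
      integral_const_mul]
    refine (abs_add_le _ _).trans ?_
    rw [abs_mul, abs_mul]
    have h3 := mul_le_mul h1 hI₁ (abs_nonneg _) zero_le_one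
    have h4 := mul_le_mul h2 hI₂ (abs_nonneg _) zero_le_one
    refine (add_le_add h3 h4).trans (le_of_eq ?_)
    ring
  have hcoef : ∀ c : ℝ, |c| ≤ 1 → |c / ((q.1 : ℝ) ^ 2 + (q.2 : ℝ) ^ 2)| ≤ 1 := by
    intro c hc
    rw [abs_div, abs_of_pos (by linarith : 0 < (q.1 : ℝ) ^ 2 + (q.2 : ℝ) ^ 2)]
    exact div_le_one_of_le₀ (by linarith) (by linarith)
  have hda := hlin (parCoord q) _ _ (hcoef q.1 hq1) (hcoef q.2 hq2) (fun y => by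
    simp only [φ₁, φ₂, parCoord_apply, AddMonoidHom.comp_apply, AddMonoidHom.coe_fst,
      AddMonoidHom.coe_snd, Int.coe_castAddHom]
    ring)
  have hdc := hlin (perpCoord q) _ _ (hcoef (-q.2) (by rwa [abs_neg])) (hcoef q.1 hq1) (fun y => by
    simp only [φ₁, φ₂, perpCoord_apply, AddMonoidHom.comp_apply, AddMonoidHom.coe_fst,
      AddMonoidHom.coe_snd, Int.coe_castAddHom]
    ring)
  set u := (parCoord q x - N) / N with hu
  have hu2 : |u| ≤ 1 / 2 := by
    rw [hu, abs_div, abs_of_pos hN, div_le_iff₀ hN]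
    linarith
  have hcongr : ∀ φ : ℤ × ℤ → ℤ × ℤ → ℝ, ∫ ω in H, φ (ξ (t + n₀) ω) (ξ t ω) ∂P =
      ∫ ω in H, φ (ξ (t + n₀) ω) x ∂P := fun φ =>
    setIntegral_congr_fun hm' fun ω hω => by simp only [hHx ω hω]
  have hLint : κ * k ^ 2 / 2 * P.real H ≤ ∫ ω in H, (perpCoord q (ξ (t + n₀) ω - ξ t ω) -
      2 * A * u * parCoord q (ξ (t + n₀) ω - ξ t ω)) ^ 2 ∂P := by
    rw [hcongr fun z x => (perpCoord q (z - x) - 2 * A * u * parCoord q (z - x)) ^ 2]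
    refine le_trans ?_ (hM.mul_le_setIntegral_displacement hmeas hinS hA1 hκ hk hG
      (ψ := fun y => (perpCoord q y - 2 * A * u * parCoord q y) ^ 2)
      (fun y => sq_nonneg _) ?_)
    · refine mul_le_mul_of_nonneg_right ?_ measureReal_nonneg
      rw [mul_div_assoc]
      refine mul_le_mul_of_nonneg_left ?_ hκ.le
      simp only [perpCoord_apply, parCoord_apply]
      push_cast
      set m := (q.1 : ℝ) ^ 2 + (q.2 : ℝ) ^ 2 with hm
      have hm0 : 0 < m := by linarith
      have : ((0 * (q.1 : ℝ) - k * q.2) / m - 2 * A * u * ((k * q.1 + 0 * q.2) / m)) ^ 2 +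
          ((k * (q.1 : ℝ) - 0 * q.2) / m - 2 * A * u * ((0 * q.1 + k * q.2) / m)) ^ 2 =
          (k : ℝ) ^ 2 * (1 + (2 * A * u) ^ 2) / m := by
        have h1 : (k : ℝ) ^ 2 * (1 + (2 * A * u) ^ 2) / m =
            (k : ℝ) ^ 2 * (1 + (2 * A * u) ^ 2) * m / m ^ 2 := by field_simp
        rw [h1]
        simp only [div_eq_mul_inv, ← inv_pow]
        generalize m⁻¹ = v
        rw [hm]
        ring
      rw [this, div_le_div_iff₀ two_pos hm0]
      have h2 : (k : ℝ) ^ 2 * m ≤ (k : ℝ) ^ 2 * 2 := by gcongr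
      nlinarith [mul_nonneg (sq_nonneg (k : ℝ)) (sq_nonneg (2 * A * u))]
    · have h1 : IntegrableOn (fun ω => (perpCoord q (ξ (t + n₀) ω - ξ t ω) -
          2 * A * u * parCoord q (ξ (t + n₀) ω - ξ t ω)) ^ 2) H P := by
        refine Integrable.of_bound (C := (n₀ * b + |2 * A * u| * (n₀ * b)) ^ 2)
          (hdm fun y => (perpCoord q y - 2 * A * u * parCoord q y) ^ 2).aestronglyMeasurable ?_
        filter_upwards [hint _ (abs_parCoord_le hq), hint _ (abs_perpCoord_le hq)] with ω h1 h2
        rw [Real.norm_eq_abs, abs_pow]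
        gcongr
        refine (abs_sub _ _).trans ?_
        rw [abs_mul (2 * A * u)]
        gcongr
      refine h1.congr_fun (fun ω hω => ?_) hm'
      simp only [hHx ω hω]
  have hmain := le_integral_exp_sub_one (μ := P.restrict H) (hdm (parCoord q)) (hdm (perpCoord q))
    hN hα hA (hint _ (abs_parCoord_le hq)) (hint _ (abs_perpCoord_le hq))
    (by simpa using hda) (by simpa using hdc) hu2 (by simpa using hLint) hN1 hN2 hαL
  rw [measureReal_restrict_apply_univ] at hmain
  have hrw : ∫ ω in H, (parabolicBarrier q N A α (ξ (t + n₀) ω) -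
      parabolicBarrier q N A α (ξ t ω)) ∂P = parabolicBarrier q N A α x *
      ∫ ω in H, (Real.exp (α / N * (perpCoord q (ξ (t + n₀) ω - ξ t ω) - 2 * A * u *
        parCoord q (ξ (t + n₀) ω - ξ t ω)) -
          α * A / N ^ 2 * parCoord q (ξ (t + n₀) ω - ξ t ω) ^ 2) - 1) ∂P := by
    rw [← integral_const_mul]
    refine setIntegral_congr_fun hm' fun ω hω => ?_
    simp only [parabolicBarrier_sub q hN, hHx ω hω, hu]
  rw [hrw, mul_assoc]
  exact mul_le_mul_of_nonneg_left hmain (Real.exp_nonneg _)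

set_option maxHeartbeats 2000000 in
/-- Lemma 4.3: under (A1), (A2) and drift `O(‖x‖⁻¹)`, started near
the central bisector of the rectangle `S(N)`, the walk exits via the long sides `U₂(N)`
before reaching `U₁(N)` with probability bounded away from `0`, uniformly in `N` large. -/
theorem exit_rectangle_via_sides
    {Ω : Type*} [MeasurableSpace Ω] (P : Measure Ω) [IsProbabilityMeasure P]
    (S : Set (ℤ × ℤ)) (hSunb : ∀ R : ℝ, ∃ x ∈ S, R < znorm x)
    (ξ : ℕ → Ω → ℤ × ℤ) (hmeas : ∀ t, Measurable (ξ t))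
    (hinS : ∀ t, ∀ᵐ ω ∂P, ξ t ω ∈ S)
    (p : ℤ × ℤ → ℤ × ℤ → ℝ) (hpmf : IsJumpPMF p)
    (hMarkov : IsMarkovWith P ξ p)
    (κ : ℝ) (k n₀ : ℕ) (hκ : 0 < κ) (hk : 0 < k) (hn₀ : 0 < n₀)
    (hA1 : A1 P S ξ κ k n₀)
    (b : ℝ) (hb : 0 < b) (hA2 : A2 p b)
    (C₁ r₀ : ℝ) (hC₁ : 0 < C₁) (hr₀ : 0 < r₀)
    (hdrift : ∀ x ∈ S, r₀ ≤ znorm x → muNorm p x ≤ C₁ / znorm x)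
    (i : ℕ) (hi : 1 ≤ i ∧ i ≤ 7) (h : ℝ) (hh : 0 < h) :
    ∃ δ : ℝ, 0 < δ ∧ ∃ N₀ : ℕ, ∀ N : ℕ, N₀ ≤ N →
      ∀ y z : ℤ, |(y : ℝ)| ≤ 2 * h * N → |(z : ℝ)| ≤ b →
        ENNReal.ofReal δ * P {ω | ξ 0 ω = ((N : ℤ) + z) • qv i + y • qp i} ≤
          P ({ω | ∃ t : ℕ, ξ t ω ∈ U2 i N h ∧ ∀ s ≤ t, ξ s ω ∉ U1 i N} ∩
             {ω | ξ 0 ω = ((N : ℤ) + z) • qv i + y • qp i}) := by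
  obtain ⟨-, hq1, hq2, hq⟩ := qv_qp_spec hi
  set q := qv i with hqi
  set K : ℝ := n₀ * b with hK
  have hK0 : 0 ≤ K := by positivity
  set A : ℝ := 16 * h + 4 with hA
  have hA0 : 0 < A := by positivity
  set L : ℝ := κ * k ^ 2 / 2 with hL
  have hk' : (0 : ℝ) < k := Nat.cast_pos.2 hk
  have hL0 : 0 < L := by positivity
  set α : ℝ := 8 * ((1 + A) * (8 * n₀ * C₁) + A * K ^ 2 + 1) / L with hα
  have hα0 : 0 < α := by positivity
  have hαL : α * L = 8 * ((1 + A) * (8 * n₀ * C₁) + A * K ^ 2 + 1) := by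
    rw [hα]; field_simp
  set fb : ℝ := Real.exp (-(α * (2 * h + 3 / 4))) with hfb
  set M : ℝ := Real.exp (α * (2 * h + 1 / 4)) with hM
  set g₀ : ℝ := Real.exp (-(α * (2 * h + 1 / 4))) - fb with hg₀
  have hg₀pos : 0 < g₀ := sub_pos.2 (Real.exp_lt_exp.2 (by linarith))
  have hM0 : 0 < M := Real.exp_pos _
  obtain ⟨N₀, hN₀⟩ := exists_nat_ge (1 + 4 * K + 4 * r₀ + (α * ((1 + A) * K) + α * A * K ^ 2) +
    α * A ^ 2 * K ^ 4 + 4 * (A * b ^ 2) + 4 * b)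
  refine ⟨g₀ / M, by positivity, N₀, fun n hn y z hy hz => ?_⟩
  have hNR : 1 + 4 * K + 4 * r₀ + (α * ((1 + A) * K) + α * A * K ^ 2) +
      α * A ^ 2 * K ^ 4 + 4 * (A * b ^ 2) + 4 * b ≤ (n : ℝ) :=
    hN₀.trans (Nat.cast_le.2 hn)
  set N : ℝ := (n : ℝ) with hNn
  have e1 : 0 ≤ α * ((1 + A) * K) + α * A * K ^ 2 := by positivity
  have e2 : 0 ≤ α * A ^ 2 * K ^ 4 := by positivity
  have e3 : 0 ≤ A * b ^ 2 := by positivity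
  have hN1 : 1 ≤ N := by linarith
  have hNpos : 0 < N := by linarith
  have hNsq : N ≤ N ^ 2 := by nlinarith
  have hNK : 4 * K ≤ N := by linarith
  have hNr : 4 * r₀ ≤ N := by linarith
  have hNb : 4 * b ≤ N := by linarith
  have hNz : 4 * (A * b ^ 2) ≤ N ^ 2 := by linarith
  have hNα : α * A ^ 2 * K ^ 4 ≤ 2 * N ^ 2 := by linarith
  have hNexp : α / N * ((1 + A) * K) + α * A / N ^ 2 * K ^ 2 ≤ 1 := by
    have h1 : α * A / N ^ 2 * K ^ 2 ≤ α * A * K ^ 2 / N := by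
      rw [div_mul_eq_mul_div]
      gcongr
    have h2 : α / N * ((1 + A) * K) = α * ((1 + A) * K) / N := by ring
    have h3 : (α * ((1 + A) * K) + α * A * K ^ 2) / N ≤ 1 := by
      rw [div_le_one hNpos]; linarith
    rw [add_div] at h3
    linarith
  set x₀ := ((n : ℤ) + z) • q + y • qp i with hx₀
  have hpar₀ : parCoord q x₀ = N + z := by
    rw [hx₀, hqi, parCoord_start hi]; push_cast; rfl
  have hperp₀ : perpCoord q x₀ = y := by
    rw [hx₀, hqi, perpCoord_start hi]
  set D : Set (ℤ × ℤ) := {x | |parCoord q x - N| < N / 2 ∧ |perpCoord q x| < 2 * h * N} with hD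
  set E : Set (ℤ × ℤ) := {x | |parCoord q x - N| < N / 2 ∧ 2 * h * N ≤ |perpCoord q x|} with hE
  set G : ℕ → Set Ω := fun j => {ω | ω ∈ {ω | ξ 0 ω = x₀} ∧ ∀ i < j, ξ (i * n₀) ω ∈ D} with hG
  set f := parabolicBarrier q N A α with hf
  have hjump := hMarkov.ae_znorm_le hA2
  have hnear : ∀ᵐ ω ∂P, ∀ t r, r ≤ n₀ →
      |parCoord q (ξ (t + r) ω) - parCoord q (ξ t ω)| ≤ K ∧
        |perpCoord q (ξ (t + r) ω) - perpCoord q (ξ t ω)| ≤ K := by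
    filter_upwards [hjump] with ω hω t r hr
    have h1 := abs_map_sub_le_of_jumps (x := fun t => ξ t ω) (abs_parCoord_le hq) hω t r
    have h2 := abs_map_sub_le_of_jumps (x := fun t => ξ t ω) (abs_perpCoord_le hq) hω t r
    have h3 : (r : ℝ) * b ≤ K := by rw [hK]; gcongr
    rw [map_sub] at h1 h2
    exact ⟨h1.trans h3, h2.trans h3⟩
  have hperp : ∀ j, ∀ᵐ ω ∂P, ω ∈ G j → |perpCoord q (ξ (j * n₀) ω)| ≤ (2 * h + 1 / 4) * N := by
    intro j
    filter_upwards [hnear] with ω hω hωG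
    rcases j with _ | j
    · rw [zero_mul, show ξ 0 ω = x₀ from hωG.1, hperp₀]
      linarith
    · have h1 := (hω (j * n₀) n₀ le_rfl).2
      have h2 := (hωG.2 j (Nat.lt_succ_self j)).2
      rw [Nat.succ_mul]
      have h3 := abs_sub_abs_le_abs_sub (perpCoord q (ξ (j * n₀ + n₀) ω))
        (perpCoord q (ξ (j * n₀) ω))
      linarith
  have hfM : ∀ x, |perpCoord q x| ≤ (2 * h + 1 / 4) * N → f x ≤ M := by
    intro x hx
    refine Real.exp_le_exp.2 (mul_le_mul_of_nonneg_left ?_ hα0.le)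
    have h1 : perpCoord q x / N ≤ 2 * h + 1 / 4 :=
      (div_le_iff₀ hNpos).2 ((le_abs_self _).trans hx)
    have h2 : 0 ≤ A * ((parCoord q x - N) / N) ^ 2 := by positivity
    linarith
  have hf0 : ∀ x, 0 ≤ f x := fun x => Real.exp_nonneg _
  have hfb0 : 0 ≤ fb := Real.exp_nonneg _
  set ε := Real.exp (-(α * (2 * h + A / 4))) * (α / (2 * N ^ 2)) with hε
  have hε0 : 0 < ε := by positivity
  have hGmeas : ∀ j, MeasurableSet[pastAlgebra ξ (j * n₀)] (G (j + 1)) := by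
    intro j
    have h1 : G (j + 1) = ξ 0 ⁻¹' {x₀} ∩ ⋂ i ∈ Finset.range (j + 1), ξ (i * n₀) ⁻¹' D := by
      ext ω
      simp [hG]
    rw [h1]
    refine MeasurableSet.inter (measurableSet_pastAlgebra_preimage ξ (Nat.zero_le _) _) ?_
    refine MeasurableSet.biInter (Finset.countable_toSet _) fun i hi => ?_
    refine measurableSet_pastAlgebra_preimage ξ (Nat.mul_le_mul_right _ ?_) _
    have := Finset.mem_range.1 hi
    omega
  have hgm : ∀ t, Measurable fun ω => f (ξ t ω) - fb := fun t =>
    (Measurable.of_discrete (f := fun x => f x - fb)).comp (hmeas t)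
  have hgint : ∀ t (B : Set Ω), MeasurableSet B →
      (∀ᵐ ω ∂P, ω ∈ B → |perpCoord q (ξ t ω)| ≤ (2 * h + 1 / 4) * N) →
      IntegrableOn (fun ω => f (ξ t ω) - fb) B P := by
    intro t B hB hBt
    refine Measure.integrableOn_of_bounded (M := M + fb) (measure_ne_top P _)
      (hgm t).aestronglyMeasurable ?_
    rw [ae_restrict_iff' hB]
    filter_upwards [hBt] with ω h1 h2
    rw [Real.norm_eq_abs, abs_le]
    have h3 := hfM _ (h1 h2)
    have h4 := hf0 (ξ t ω)
    constructor <;> linarith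
  have hfD : ∀ x ∈ D, Real.exp (-(α * (2 * h + A / 4))) ≤ f x := by
    intro x hx
    refine Real.exp_le_exp.2 ?_
    rw [← mul_neg]
    refine mul_le_mul_of_nonneg_left ?_ hα0.le
    have h1 : -(2 * h) ≤ perpCoord q x / N := by
      rw [le_div_iff₀ hNpos]
      linarith [(abs_lt.1 hx.2).1]
    have h2 : ((parCoord q x - N) / N) ^ 2 ≤ (1 / 2) ^ 2 := by
      refine sq_le_sq' ?_ ?_
      · rw [le_div_iff₀ hNpos]; linarith [(abs_lt.1 hx.1).1]
      · rw [div_le_iff₀ hNpos]; linarith [(abs_lt.1 hx.1).2]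
    have h3 := mul_le_mul_of_nonneg_left h2 hA0.le
    linarith
  have hstep : ∀ j, ε * P.real (G (j + 1)) + ∫ ω in G (j + 1), (f (ξ (j * n₀) ω) - fb) ∂P ≤
      ∫ ω in G (j + 1), (f (ξ ((j + 1) * n₀) ω) - fb) ∂P := by
    intro j
    have hGj := pastAlgebra_le hmeas _ _ (hGmeas j)
    have hi1 : IntegrableOn (fun ω => f (ξ (j * n₀) ω) - fb) (G (j + 1)) P := by
      refine hgint _ _ hGj ?_
      filter_upwards [hperp j] with ω h1 h2
      exact h1 ⟨h2.1, fun i hi => h2.2 i (by omega)⟩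
    have hi2 : IntegrableOn (fun ω => f (ξ ((j + 1) * n₀) ω) - fb) (G (j + 1)) P :=
      hgint _ _ hGj (hperp (j + 1))
    have hic : IntegrableOn (fun _ => ε) (G (j + 1)) P := (integrable_const ε).integrableOn
    have key := setIntegral_nonneg_of_fibers (hmeas (j * n₀)) hGj ((hi2.sub hi1).sub hic) ?_
    · have e := integral_sub (hi2.sub hi1) hic
      have e' := integral_sub hi2 hi1
      simp only [Pi.sub_apply] at key e e'
      rw [e, e', setIntegral_const, smul_eq_mul] at key
      linarith
    · intro x
      by_cases hx : x ∈ D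
      · have h1 := hMarkov.le_setIntegral_parabolicBarrier_sub hmeas hinS hpmf hA1 hκ hk hb hA2 hC₁
          hdrift hq1 hq2 hq hNpos hA0.le hα0 hNK hNr hNexp hNα hαL hx.1 (hGmeas j)
        have h2 : ε * P.real (G (j + 1) ∩ {ω | ξ (j * n₀) ω = x}) ≤
            f x * (α / (2 * N ^ 2)) * P.real (G (j + 1) ∩ {ω | ξ (j * n₀) ω = x}) :=
          mul_le_mul_of_nonneg_right (mul_le_mul_of_nonneg_right (hfD x hx) (by positivity))
            measureReal_nonneg
        have hsub : G (j + 1) ∩ {ω | ξ (j * n₀) ω = x} ⊆ G (j + 1) := Set.inter_subset_left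
        have e := integral_sub ((hi2.sub hi1).mono_set hsub) (hic.mono_set hsub)
        simp only [Pi.sub_apply, sub_sub_sub_cancel_right, Nat.succ_mul] at e ⊢
        rw [e, setIntegral_const, smul_eq_mul]
        rw [← hf] at h1
        linarith
      · have h1 : G (j + 1) ∩ {ω | ξ (j * n₀) ω = x} = ∅ := by
          refine Set.eq_empty_of_forall_notMem fun ω hω => hx ?_
          have h2 := hω.1.2 j (Nat.lt_succ_self j)
          rwa [show ξ (j * n₀) ω = x from hω.2] at h2
        rw [h1]
        simp
  have hmain := mul_measureReal_le_of_submartingale_until_exit (P := P) (Y := fun j => ξ (j * n₀))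
    (fun j => hmeas _) (D := D) (E := E) (G := G) (G₀ := {ω | ξ 0 ω = x₀}) (g := fun x => f x - fb)
    (M := M) (B := M + fb) (ε := ε) (g₀ := g₀)
    (Set.disjoint_left.2 fun x h1 h2 => absurd h1.2 (not_lt.2 h2.2))
    (hmeas 0 (measurableSet_singleton x₀)) hε0 hM0.le (fun j => rfl) ?_ ?_ ?_ hstep ?_
  · have hae : (⋃ j, G j ∩ {ω | ξ (j * n₀) ω ∈ E} : Set Ω) ≤ᵐ[P]
        ({ω | ∃ t : ℕ, ξ t ω ∈ U2 i n h ∧ ∀ s ≤ t, ξ s ω ∉ U1 i n} ∩ {ω | ξ 0 ω = x₀} : Set Ω) := by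
      filter_upwards [hnear] with ω hω hmem
      obtain ⟨j, hωG, hωE⟩ := Set.mem_iUnion.1 hmem
      refine ⟨⟨j * n₀, ?_, fun s hs => ?_⟩, hωG.1⟩
      · rw [mem_U2_iff hi]
        have h1 := abs_lt.1 hωE.1
        exact ⟨by linarith [h1.1], by linarith [h1.2], hωE.2⟩
      · rw [mem_U1_iff hi, not_le]
        rcases hs.eq_or_lt with rfl | hs
        · linarith [(abs_lt.1 hωE.1).2]
        · have h1 := (abs_lt.1 (hωG.2 (s / n₀) ((Nat.div_lt_iff_lt_mul hn₀).2 hs)).1).2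
          have h2 := (abs_le.1 (hω (s / n₀ * n₀) (s % n₀) (Nat.mod_lt s hn₀).le).1).2
          rw [mul_comm, Nat.div_add_mod, mul_comm] at h2
          linarith
    have h1 := measure_mono_ae hae
    refine le_trans ?_ h1
    rw [← ofReal_measureReal, ← ofReal_measureReal,
      ← ENNReal.ofReal_mul (by positivity)]
    refine ENNReal.ofReal_le_ofReal ?_
    rw [div_mul_eq_mul_div, div_le_iff₀ hM0, mul_comm _ M]
    exact hmain
  · intro j
    filter_upwards [hperp j] with ω h1 h2
    have := hfM _ (h1 h2)
    linarith
  · intro j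
    filter_upwards [hperp j] with ω h1 h2 hωD hωE
    have h3 : N / 2 ≤ |parCoord q (ξ (j * n₀) ω) - N| := by
      by_contra! hlt
      exact (lt_or_ge |perpCoord q (ξ (j * n₀) ω)| (2 * h * N)).elim
        (fun h => hωD ⟨hlt, h⟩) fun h => hωE ⟨hlt, h⟩
    refine sub_nonpos.2 (Real.exp_le_exp.2 ?_)
    rw [← mul_neg]
    refine mul_le_mul_of_nonneg_left ?_ hα0.le
    have h4 : perpCoord q (ξ (j * n₀) ω) / N ≤ 2 * h + 1 / 4 :=
      (div_le_iff₀ hNpos).2 ((le_abs_self _).trans (h1 h2))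
    have h5 : (1 / 2) ^ 2 ≤ ((parCoord q (ξ (j * n₀) ω) - N) / N) ^ 2 := by
      rw [← sq_abs (_ / N), abs_div, abs_of_pos hNpos]
      refine pow_le_pow_left₀ (by norm_num) ?_ 2
      rw [le_div_iff₀ hNpos]
      linarith
    have h6 := mul_le_mul_of_nonneg_left h5 hA0.le
    rw [hA] at h6 ⊢
    linarith
  · intro j
    filter_upwards [hperp j] with ω h1 h2
    have h3 := hfM _ (h1 h2)
    have h4 := hf0 (ξ (j * n₀) ω)
    exact abs_le.2 ⟨by linarith, by linarith⟩
  · intro ω hω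
    rw [zero_mul, show ξ 0 ω = x₀ from hω]
    refine sub_le_sub_right (Real.exp_le_exp.2 ?_) _
    rw [hpar₀, hperp₀, ← mul_neg]
    refine mul_le_mul_of_nonneg_left ?_ hα0.le
    have h1 : -(2 * h) ≤ (y : ℝ) / N := by
      rw [le_div_iff₀ hNpos]
      linarith [(abs_le.1 hy).1]
    have h2 : A * ((N + z - N) / N) ^ 2 ≤ 1 / 4 := by
      rw [add_sub_cancel_left, div_pow, ← mul_div_assoc, div_le_iff₀ (by positivity)]
      have h3 : (z : ℝ) ^ 2 ≤ b ^ 2 := sq_le_sq' (abs_le.1 hz).1 (abs_le.1 hz).2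
      have h4 := mul_le_mul_of_nonneg_left h3 hA0.le
      linarith
    linarith
end
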